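/- Let (s, ⟨·,·⟩) be a metric solvable Lie algebra with nilradical n and a = n^⊥, and let c < 0. Then Ric = cI + D for some derivation D of s (i.e. (s, ⟨·,·⟩) is a solsoliton with cosmological constant c) if and only if the following four conditions hold: (i) (n, ⟨·,·⟩|_{n×n}) is a nilsoliton with Ricci operator Ric₁ = cI + D₁ for some derivation D₁ of n; (ii) [a, a] = 0; (iii) for every A ∈ a, (ad A)ᵗ is a derivation of s (equivalently, [ad A, (ad A)ᵗ] = 0); (iv) ⟨A, A⟩ = -(1/c)·tr(S(ad A)²) for every A ∈ a. -/

import Mathlib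

noncomputable section

open scoped RealInnerProductSpace

/-! ### Lie-algebraic notions for a bracket given as a bundled bilinear map -/

section Alg

variable {E : Type*} [AddCommGroup E] [Module ℝ E]

/-- `μ` is a Lie bracket: alternating and satisfying the (Leibniz form of the) Jacobi identity. -/
def IsLieBracket (μ : E →ₗ[ℝ] E →ₗ[ℝ] E) : Prop :=
  (∀ X, μ X X = 0) ∧ ∀ X Y Z, μ X (μ Y Z) = μ (μ X Y) Z + μ Y (μ X Z)

/-- `D` is a derivation of the algebra `(E, μ)`. -/
def IsDeriv (μ : E →ₗ[ℝ] E →ₗ[ℝ] E) (D : E →ₗ[ℝ] E) : Prop :=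
  ∀ X Y, D (μ X Y) = μ (D X) Y + μ X (D Y)

/-- The subspace spanned by brackets of elements of `p` and `q`. -/
def bracketSpan (μ : E →ₗ[ℝ] E →ₗ[ℝ] E) (p q : Submodule ℝ E) : Submodule ℝ E :=
  Submodule.span ℝ {z | ∃ x ∈ p, ∃ y ∈ q, μ x y = z}

/-- Derived series of `(E, μ)`. -/
def derSeries (μ : E →ₗ[ℝ] E →ₗ[ℝ] E) : ℕ → Submodule ℝ E
  | 0 => ⊤
  | k + 1 => bracketSpan μ (derSeries μ k) (derSeries μ k)

/-- `(E, μ)` is a solvable Lie algebra. -/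
def IsSolvableB (μ : E →ₗ[ℝ] E →ₗ[ℝ] E) : Prop := ∃ k, derSeries μ k = ⊥

/-- Lower central series of the subalgebra `p` of `(E, μ)`. -/
def lcsOn (μ : E →ₗ[ℝ] E →ₗ[ℝ] E) (p : Submodule ℝ E) : ℕ → Submodule ℝ E
  | 0 => p
  | k + 1 => bracketSpan μ p (lcsOn μ p k)

/-- The subalgebra `p` of `(E, μ)` is a nilpotent Lie algebra. -/
def IsNilpotentOn (μ : E →ₗ[ℝ] E →ₗ[ℝ] E) (p : Submodule ℝ E) : Prop := ∃ k, lcsOn μ p k = ⊥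

/-- `p` is an ideal of `(E, μ)`. -/
def IsIdeal (μ : E →ₗ[ℝ] E →ₗ[ℝ] E) (p : Submodule ℝ E) : Prop := ∀ X : E, ∀ Y ∈ p, μ X Y ∈ p

/-- `p` is the nilradical (maximal nilpotent ideal) of `(E, μ)`. -/
def IsNilradical (μ : E →ₗ[ℝ] E →ₗ[ℝ] E) (p : Submodule ℝ E) : Prop :=
  IsIdeal μ p ∧ IsNilpotentOn μ p ∧ ∀ q, IsIdeal μ q → IsNilpotentOn μ q → q ≤ p

/-- The natural action `π(f)μ` of `f ∈ End(E)` on bilinear maps: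
`(π(f)μ)(X,Y) = f(μ(X,Y)) - μ(fX,Y) - μ(X,fY)`. -/
def piAct (f : E →ₗ[ℝ] E) (μ : E →ₗ[ℝ] E →ₗ[ℝ] E) : E →ₗ[ℝ] E →ₗ[ℝ] E :=
  (LinearMap.llcomp ℝ E E E f) ∘ₗ μ - μ ∘ₗ f - (LinearMap.lcomp ℝ E f) ∘ₗ μ

/-- The center of `(E, μ)`. -/
def centerB (μ : E →ₗ[ℝ] E →ₗ[ℝ] E) : Submodule ℝ E where
  carrier := {X | μ X = 0}
  add_mem' := by intro a b ha hb; simp only [Set.mem_setOf_eq, map_add] at *; rw [ha, hb, add_zero]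
  zero_mem' := by simp only [Set.mem_setOf_eq, map_zero]
  smul_mem' := by intro c a ha; simp only [Set.mem_setOf_eq, map_smul] at *; rw [ha, smul_zero]

end Alg

/-! ### Metric notions -/

section MetricDefs

variable {E : Type*} [NormedAddCommGroup E] [InnerProductSpace ℝ E] [FiniteDimensional ℝ E]

/-- The transpose of an operator with respect to the inner product. -/
def transp (f : E →ₗ[ℝ] E) : E →ₗ[ℝ] E := LinearMap.adjoint f

/-- The symmetric part `S(f) = (f + fᵗ)/2` of an operator. -/
def symPart (f : E →ₗ[ℝ] E) : E →ₗ[ℝ] E := (1 / 2 : ℝ) • (f + transp f)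

variable (E) in
/-- A fixed orthonormal basis of `E`. -/
def stdONB : OrthonormalBasis (Fin (Module.finrank ℝ E)) ℝ E := stdOrthonormalBasis ℝ E

/-- The operator `R` appearing in the formula for the Ricci operator of a metric Lie algebra:
`⟨R X, X⟩ = -(1/2) Σ ⟨[X,Xᵢ],Xⱼ⟩² + (1/4) Σ ⟨[Xᵢ,Xⱼ],X⟩²` for any orthonormal basis `{Xᵢ}`. -/
def Rop (μ : E →ₗ[ℝ] E →ₗ[ℝ] E) : E →ₗ[ℝ] E :=
  (-(1 / 2 : ℝ)) • ∑ i, (transp (μ (stdONB E i))) ∘ₗ (μ (stdONB E i))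
    + (1 / 4 : ℝ) • ∑ i, (μ (stdONB E i)) ∘ₗ (transp (μ (stdONB E i)))

/-- The symmetric operator `B` defined by the Killing form: `⟨B X, X⟩ = tr((ad X)²)`. -/
def Bop (μ : E →ₗ[ℝ] E →ₗ[ℝ] E) : E →ₗ[ℝ] E :=
  ∑ i, (((LinearMap.trace ℝ E) ∘ₗ (LinearMap.lcomp ℝ E (μ (stdONB E i))) ∘ₗ μ).smulRight
    (stdONB E i))

/-- The mean curvature vector `H`, characterized by `⟨H, X⟩ = tr (ad X)`. -/
def meanCurv (μ : E →ₗ[ℝ] E →ₗ[ℝ] E) : E :=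
  ∑ i, (LinearMap.trace ℝ E (μ (stdONB E i))) • (stdONB E i : E)

/-- The Ricci operator `Ric = R - (1/2) B - S(ad H)` of a metric Lie algebra. -/
def Ric (μ : E →ₗ[ℝ] E →ₗ[ℝ] E) : E →ₗ[ℝ] E :=
  Rop μ - (1 / 2 : ℝ) • Bop μ - symPart (μ (meanCurv μ))

/-- `(E, μ, ⟨⬝,⬝⟩)` is a solsoliton: `Ric = c I + D` for some `c ∈ ℝ` and derivation `D`. -/
def IsSolsoliton (μ : E →ₗ[ℝ] E →ₗ[ℝ] E) : Prop :=
  ∃ (c : ℝ) (D : E →ₗ[ℝ] E), IsDeriv μ D ∧ Ric μ = c • LinearMap.id + D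

/-- The natural inner product on bilinear maps, `⟨μ,ν⟩ = Σ ⟨μ(Xᵢ,Xⱼ), ν(Xᵢ,Xⱼ)⟩`. -/
def binner (μ ν : E →ₗ[ℝ] E →ₗ[ℝ] E) : ℝ :=
  ∑ i, ∑ j, ⟪μ (stdONB E i) (stdONB E j), ν (stdONB E i) (stdONB E j)⟫

/-- Orthogonal projection onto a subspace, as an endomorphism of `E`. -/
def projL (p : Submodule ℝ E) : E →ₗ[ℝ] E :=
  p.subtype ∘ₗ (Submodule.orthogonalProjectionOnto p).toLinearMap

/-- An orthonormal basis of the subspace `p`, as a family of vectors of `E`. -/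
def onbOf (p : Submodule ℝ E) : Fin (Module.finrank ℝ ↥p) → E :=
  fun i => ((stdOrthonormalBasis ℝ ↥p) i : E)

/-- The restriction `ad X |_p` of `ad X` to the subspace `p`, as an endomorphism of `E`
(it kills `pᗮ`). -/
def adOn (μ : E →ₗ[ℝ] E →ₗ[ℝ] E) (p : Submodule ℝ E) (X : E) : E →ₗ[ℝ] E :=
  (μ X) ∘ₗ projL p

/-- The Ricci operator of the restricted metric Lie algebra `(p, μ|ₚ, ⟨⬝,⬝⟩|ₚ)`, for `p` a
bracket-closed subspace, realized as an endomorphism of `E` killing `pᗮ`.  (For `p` nilpotent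
this is the full Ricci operator of `p`.) -/
def RopOn (μ : E →ₗ[ℝ] E →ₗ[ℝ] E) (p : Submodule ℝ E) : E →ₗ[ℝ] E :=
  (-(1 / 2 : ℝ)) • ∑ i, (transp (adOn μ p (onbOf p i))) ∘ₗ (adOn μ p (onbOf p i))
    + (1 / 4 : ℝ) • ∑ i, (adOn μ p (onbOf p i)) ∘ₗ (transp (adOn μ p (onbOf p i)))

/-- The metric nilpotent Lie algebra `(p, μ|ₚ, ⟨⬝,⬝⟩|ₚ)` is a nilsoliton with Ricci operator
`c I + D₁`, where `D₁` is (induced by) a derivation of `p`. -/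
def IsNilsolitonOn (μ : E →ₗ[ℝ] E →ₗ[ℝ] E) (p : Submodule ℝ E) (c : ℝ) (D₁ : E →ₗ[ℝ] E) :
    Prop :=
  (∀ X ∈ p, D₁ X ∈ p) ∧ (∀ X ∈ p, ∀ Y ∈ p, D₁ (μ X Y) = μ (D₁ X) Y + μ X (D₁ Y)) ∧
    ∀ X ∈ p, RopOn μ p X = c • X + D₁ X

end MetricDefs

section WeightedFiltration

set_option linter.unusedSectionVars false

open Module

variable {V : Type*} [AddCommGroup V] [Module ℝ V] {ι : Type*} [Fintype ι]

/-- The decreasing filtration of `V` attached to a basis with real weights. -/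
def wfilt (u : Basis ι ℝ V) (a : ι → ℝ) (t : ℝ) : Submodule ℝ V where
  carrier := {x | ∀ i, a i < t → u.repr x i = 0}
  add_mem' := by
    intro x y hx hy i hi
    simp [hx i hi, hy i hi]
  zero_mem' := by
    intro i _
    simp
  smul_mem' := by
    intro r x hx i hi
    simp [hx i hi]

theorem mem_wfilt {u : Basis ι ℝ V} {a : ι → ℝ} {t : ℝ} {x : V} :
    x ∈ wfilt u a t ↔ ∀ i, a i < t → u.repr x i = 0 := Iff.rfl

theorem wfilt_anti (u : Basis ι ℝ V) (a : ι → ℝ) {s t : ℝ} (h : s ≤ t) :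
    wfilt u a t ≤ wfilt u a s := fun _ hx i hi => hx i (hi.trans_le h)

theorem basis_mem_wfilt (u : Basis ι ℝ V) (a : ι → ℝ) (i : ι) : u i ∈ wfilt u a (a i) := by
  classical
  intro j hj
  rw [u.repr_self, Finsupp.single_apply, if_neg]
  rintro rfl
  exact lt_irrefl _ hj

theorem exists_lt_mem_wfilt (u : Basis ι ℝ V) (a : ι → ℝ) {t : ℝ} {z : V}
    (hz : ∀ i, a i ≤ t → u.repr z i = 0) : ∃ s, t < s ∧ z ∈ wfilt u a s := by
  classical
  by_cases hne : (Finset.univ.filter fun i => t < a i).Nonempty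
  · obtain ⟨i, hi, hmin⟩ := Finset.exists_min_image _ a hne
    refine ⟨a i, (Finset.mem_filter.1 hi).2, fun j hj => hz j ?_⟩
    by_contra hlt
    exact absurd (hmin j (by simpa using hlt)) (not_le.2 hj)
  · refine ⟨t + 1, by linarith, fun j _ => hz j ?_⟩
    by_contra hlt
    exact hne ⟨j, by simpa using hlt⟩

theorem repr_eq_zero_of_mem_wfilt_lt {u : Basis ι ℝ V} {a : ι → ℝ} {s t : ℝ} (h : t < s) {z : V}
    (hz : z ∈ wfilt u a s) (i : ι) (hi : a i ≤ t) : u.repr z i = 0 := hz i (hi.trans_lt h)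

/-- The operator that is diagonal in the basis `u` with entries `w`. -/
def diagOp (u : Basis ι ℝ V) (w : ι → ℝ) : V →ₗ[ℝ] V := u.constr ℝ fun i => w i • u i

theorem diagOp_basis (u : Basis ι ℝ V) (w : ι → ℝ) (i : ι) : diagOp u w (u i) = w i • u i :=
  u.constr_basis ℝ _ i

theorem repr_diagOp (u : Basis ι ℝ V) (w : ι → ℝ) (x : V) (i : ι) :
    u.repr (diagOp u w x) i = w i * u.repr x i := by
  classical
  conv_lhs => rw [← u.sum_repr x]
  simp only [map_sum, map_smul, diagOp_basis, Finsupp.coe_finsetSum, Finset.sum_apply,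
    Finsupp.smul_apply, Basis.repr_self, smul_eq_mul, Finsupp.single_apply]
  rw [Finset.sum_eq_single i]
  · simp; ring
  · intro j _ hj; simp [hj]
  · simp

theorem trace_eq_sum_repr (u : Basis ι ℝ V) (f : V →ₗ[ℝ] V) :
    LinearMap.trace ℝ V f = ∑ i, u.repr (f (u i)) i := by
  classical
  rw [LinearMap.trace_eq_matrix_trace ℝ u, Matrix.trace]
  simp [LinearMap.toMatrix_apply]

theorem trace_diagOp_comp (u : Basis ι ℝ V) (w : ι → ℝ) (f : V →ₗ[ℝ] V) :
    LinearMap.trace ℝ V (diagOp u w ∘ₗ f) = ∑ i, w i * u.repr (f (u i)) i := by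
  rw [trace_eq_sum_repr u]
  simp [repr_diagOp]

/-- `diagOp x (φ ∘ a') - φ t` raises the filtration strictly in degree `t`. -/
theorem diagOp_sub_mem (x : Basis ι ℝ V) (a : ι → ℝ) (φ : ℝ → ℝ) {t : ℝ} {y : V}
    (hy : y ∈ wfilt x a t) : ∃ s, t < s ∧ diagOp x (fun i => φ (a i)) y - φ t • y ∈ wfilt x a s := by
  refine exists_lt_mem_wfilt x a fun i hi => ?_
  rcases hi.lt_or_eq with h | h
  · simp [repr_diagOp, hy i h]
  · simp [repr_diagOp, h]

/-- Weighted traces of a filtration-preserving operator depend only on the filtration. -/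
theorem weighted_trace_eq {κ : Type*} [Fintype κ] (u : Basis ι ℝ V) (x : Basis κ ℝ V) (a : ι → ℝ)
    (a' : κ → ℝ)
    (h : ∀ t, wfilt u a t = wfilt x a' t) (δ : V →ₗ[ℝ] V)
    (hδ : ∀ t, ∀ y ∈ wfilt u a t, δ y ∈ wfilt u a t) (φ : ℝ → ℝ) :
    ∑ i, φ (a i) * u.repr (δ (u i)) i = ∑ i, φ (a' i) * x.repr (δ (x i)) i := by
  rw [← trace_diagOp_comp u (fun i => φ (a i)), ← trace_diagOp_comp x (fun i => φ (a' i)),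
    ← sub_eq_zero, ← map_sub, trace_eq_sum_repr u]
  refine Finset.sum_eq_zero fun i _ => ?_
  have h1 := hδ _ _ (basis_mem_wfilt u a i)
  obtain ⟨s, hs, hs'⟩ := diagOp_sub_mem u a φ h1
  obtain ⟨r, hr, hr'⟩ := diagOp_sub_mem x a' φ (h _ ▸ h1)
  rw [← h] at hr'
  have e1 := repr_eq_zero_of_mem_wfilt_lt hs hs' i le_rfl
  have e2 := repr_eq_zero_of_mem_wfilt_lt hr hr' i le_rfl
  simp only [LinearMap.sub_apply, LinearMap.comp_apply, map_sub, Finsupp.sub_apply] at e1 e2 ⊢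
  linarith

theorem sum_weights_eq {κ : Type*} [Fintype κ] (u : Basis ι ℝ V) (x : Basis κ ℝ V) (a : ι → ℝ)
    (a' : κ → ℝ) (h : ∀ t, wfilt u a t = wfilt x a' t) (φ : ℝ → ℝ) :
    ∑ i, φ (a i) = ∑ i, φ (a' i) := by
  simpa using weighted_trace_eq u x a a' h LinearMap.id (fun _ _ hy => hy) φ

/-- The filtration is multiplicative for the bilinear product `b`. -/
def IsMultFilt (b : V →ₗ[ℝ] V →ₗ[ℝ] V) (u : Basis ι ℝ V) (a : ι → ℝ) : Prop :=
  ∀ s t, ∀ x ∈ wfilt u a s, ∀ y ∈ wfilt u a t, b x y ∈ wfilt u a (s + t)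

theorem isMultFilt_iff (b : V →ₗ[ℝ] V →ₗ[ℝ] V) (u : Basis ι ℝ V) (a : ι → ℝ) :
    IsMultFilt b u a ↔ ∀ i j k, u.repr (b (u i) (u j)) k ≠ 0 → a i + a j ≤ a k := by
  constructor
  · intro h i j k hk
    by_contra hlt
    exact hk (h _ _ _ (basis_mem_wfilt u a i) _ (basis_mem_wfilt u a j) k (not_le.1 hlt))
  · intro h s t x hx y hy k hk
    rw [← u.sum_repr x, ← u.sum_repr y]
    simp only [map_sum, LinearMap.sum_apply, map_smul, LinearMap.smul_apply,
      Finsupp.coe_finsetSum, Finset.sum_apply, Finsupp.smul_apply, smul_eq_mul]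
    refine Finset.sum_eq_zero fun i _ => ?_
    by_cases h2 : a i < t
    · simp [hy i h2]
    rw [Finset.mul_sum]
    refine Finset.sum_eq_zero fun j _ => ?_
    by_cases h1 : a j < s
    · simp [hx j h1]
    by_cases h3 : u.repr (b (u j) (u i)) k = 0
    · simp [h3]
    linarith [h j i k h3]

theorem isMultFilt_congr {κ : Type*} [Fintype κ] {b : V →ₗ[ℝ] V →ₗ[ℝ] V} {u : Basis ι ℝ V}
    {x : Basis κ ℝ V} {a : ι → ℝ} {a' : κ → ℝ} (h : ∀ t, wfilt u a t = wfilt x a' t) :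
    IsMultFilt b u a ↔ IsMultFilt b x a' := by
  simp only [IsMultFilt, h]

end WeightedFiltration

section CommonBasis

set_option linter.unusedSectionVars false

open Module

variable {V : Type*} [AddCommGroup V] [Module ℝ V]

theorem exists_index_of_mem_wfilt {κ : Type*} [Fintype κ] (v : Basis κ ℝ V) (c : κ → ℝ) {y : V}
    (hy : y ≠ 0) : ∃ k, y ∈ wfilt v c (c k) ∧ ∀ t, y ∈ wfilt v c t → t ≤ c k := by
  classical
  have hne : (Finset.univ.filter fun i => v.repr y i ≠ 0).Nonempty := by
    by_contra h
    apply hy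
    apply v.repr.injective
    ext i
    by_contra hi
    exact h ⟨i, by simpa using hi⟩
  obtain ⟨k, hk, hmin⟩ := Finset.exists_min_image _ c hne
  refine ⟨k, fun i hi => ?_, fun t ht => ?_⟩
  · by_contra h
    exact absurd (hmin i (by simpa using h)) (not_le.2 hi)
  · by_contra h
    exact (Finset.mem_filter.1 hk).2 (ht k (not_le.1 h))

variable {N : ℕ}

/-- A basis that is unitriangular with respect to `u`. -/
theorem exists_basis_of_unitriangular (u : Basis (Fin N) ℝ V) (y : Fin N → V)
    (hy : ∀ i, y i - u i ∈ Submodule.span ℝ (u '' Set.Iio i)) :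
    ∃ x : Basis (Fin N) ℝ V, ∀ i, x i = y i := by
  have hspan : ∀ i, u i ∈ Submodule.span ℝ (Set.range y) := by
    intro i
    induction i using WellFoundedLT.induction with
    | ind i ih =>
      have h1 : Submodule.span ℝ (u '' Set.Iio i) ≤ Submodule.span ℝ (Set.range y) := by
        rw [Submodule.span_le]
        rintro _ ⟨j, hj, rfl⟩
        exact ih j hj
      have h2 := Submodule.sub_mem _ (Submodule.subset_span (Set.mem_range_self i)) (h1 (hy i))
      simpa using h2
  have htop : ⊤ ≤ Submodule.span ℝ (Set.range y) := by
    rw [← u.span_eq, Submodule.span_le]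
    rintro _ ⟨i, rfl⟩
    exact hspan i
  have hcard : Fintype.card (Fin N) = finrank ℝ V := by
    rw [finrank_eq_card_basis u]
  exact ⟨basisOfTopLeSpanOfCardEqFinrank y htop hcard, fun i => by simp⟩

theorem wfilt_le_of_basis_mem {κ : Type*} [Fintype κ] {ι : Type*} [Fintype ι] {u : Basis ι ℝ V}
    {a : ι → ℝ} {x : Basis κ ℝ V} {a' : κ → ℝ} (h : ∀ i, u i ∈ wfilt x a' (a i)) (t : ℝ) :
    wfilt u a t ≤ wfilt x a' t := by
  intro z hz
  rw [← u.sum_repr z]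
  refine Submodule.sum_mem _ fun i _ => ?_
  by_cases hi : a i < t
  · rw [hz i hi, zero_smul]
    exact Submodule.zero_mem _
  · exact Submodule.smul_mem _ _ (wfilt_anti x a' (not_lt.1 hi) (h i))

theorem repr_eq_sum_repr {κ : Type*} [Fintype κ] {ι : Type*} (u : Basis ι ℝ V) (x : Basis κ ℝ V)
    (z : V) (j : ι) : u.repr z j = ∑ l, x.repr z l * u.repr (x l) j := by
  conv_lhs => rw [← x.sum_repr z]
  simp only [map_sum, map_smul, Finsupp.coe_finsetSum, Finset.sum_apply, Finsupp.smul_apply,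
    smul_eq_mul]

theorem exists_common_basis (u : Basis (Fin N) ℝ V) (a : Fin N → ℝ) (ha : Antitone a)
    (v : Basis (Fin N) ℝ V) (c : Fin N → ℝ) :
    ∃ (x : Basis (Fin N) ℝ V) (c' : Fin N → ℝ),
      (∀ t, wfilt x a t = wfilt u a t) ∧ ∀ t, wfilt x c' t = wfilt v c t := by
  classical
  have hlow : ∀ (i : Fin N) (z : V), z ∈ Submodule.span ℝ (u '' Set.Iio i) ↔
      ∀ j, i ≤ j → u.repr z j = 0 := by
    intro i z
    rw [u.mem_span_image]
    constructor
    · intro h j hj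
      by_contra hne
      exact absurd (h (by simpa using hne)) (by simpa using hj)
    · intro h j hj
      by_contra hlt
      exact (Finsupp.mem_support_iff.1 hj) (h j (by simpa using hlt))
  have hex : ∀ i : Fin N, ∃ (y : V) (k : Fin N), y - u i ∈ Submodule.span ℝ (u '' Set.Iio i) ∧
      y ∈ wfilt v c (c k) ∧
      ∀ z, z - u i ∈ Submodule.span ℝ (u '' Set.Iio i) → ∀ t, z ∈ wfilt v c t → t ≤ c k := by
    intro i
    have hnz : ∀ z, z - u i ∈ Submodule.span ℝ (u '' Set.Iio i) → z ≠ 0 := by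
      rintro z hz rfl
      have := (hlow i _).1 hz i le_rfl
      simp at this
    obtain ⟨k, hk, hmax⟩ := Finset.exists_max_image
      (Finset.univ.filter fun k => ∃ y, y - u i ∈ Submodule.span ℝ (u '' Set.Iio i) ∧
        y ∈ wfilt v c (c k)) c (by
        obtain ⟨k, hk, -⟩ := exists_index_of_mem_wfilt v c (hnz (u i) (by simp))
        exact ⟨k, by simpa using ⟨u i, by simp, hk⟩⟩)
    obtain ⟨y, hy1, hy2⟩ := (Finset.mem_filter.1 hk).2
    refine ⟨y, k, hy1, hy2, fun z hz t ht => ?_⟩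
    obtain ⟨l, hl, hl'⟩ := exists_index_of_mem_wfilt v c (hnz z hz)
    exact (hl' t ht).trans (hmax l (by simpa using ⟨z, hz, hl⟩))
  choose y k hy hyk hmax using hex
  obtain ⟨x, hx⟩ := exists_basis_of_unitriangular u y hy
  have hxu : ∀ i, x i - u i ∈ Submodule.span ℝ (u '' Set.Iio i) := fun i => hx i ▸ hy i
  refine ⟨x, fun i => c (k i), fun t => ?_, fun t => ?_⟩
  · have h1 : ∀ i, x i ∈ wfilt u a (a i) := by
      intro i
      have h2 : x i - u i ∈ wfilt u a (a i) :=
        fun j hj => (hlow i _).1 (hxu i) j (by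
          by_contra hlt
          exact absurd (ha (not_le.1 hlt).le) (not_le.2 hj))
      simpa using Submodule.add_mem _ h2 (basis_mem_wfilt u a i)
    have h3 : ∀ i, u i ∈ wfilt x a (a i) := by
      intro i
      induction i using WellFoundedLT.induction with
      | ind i ih =>
        have h4 : Submodule.span ℝ (u '' Set.Iio i) ≤ wfilt x a (a i) := by
          rw [Submodule.span_le]
          rintro _ ⟨j, hj, rfl⟩
          exact wfilt_anti x a (ha (le_of_lt hj)) (ih j hj)
        simpa using Submodule.sub_mem _ (basis_mem_wfilt x a i) (h4 (hxu i))
    exact le_antisymm (wfilt_le_of_basis_mem h1 t) (wfilt_le_of_basis_mem h3 t)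
  · have hxk : ∀ i, x i ∈ wfilt v c (c (k i)) := fun i => by rw [hx]; exact hyk i
    refine le_antisymm (wfilt_le_of_basis_mem hxk t) ?_
    have hxr : ∀ l j, l ≤ j → u.repr (x l) j = if l = j then 1 else 0 := by
      intro l j hlj
      have := (hlow l _).1 (hxu l) j hlj
      simp only [map_sub, Finsupp.sub_apply, Basis.repr_self, Finsupp.single_apply] at this
      linarith
    have key : ∀ m : ℕ, ∀ z, (∀ i : Fin N, m ≤ i → x.repr z i = 0) → z ∈ wfilt v c t →
        z ∈ wfilt x (fun i => c (k i)) t := by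
      intro m
      induction m with
      | zero =>
        intro z hz _ i _
        exact hz i (Nat.zero_le _)
      | succ m ih =>
        intro z hz hzt
        by_cases hm : m < N
        · set i : Fin N := ⟨m, hm⟩ with hi
          by_cases hr : x.repr z i = 0
          · refine ih z (fun j hj => ?_) hzt
            rcases hj.eq_or_lt with h | h
            · have : j = i := Fin.ext h.symm
              rw [this, hr]
            · exact hz j h
          · have hlowz : (x.repr z i)⁻¹ • z - u i ∈ Submodule.span ℝ (u '' Set.Iio i) := by
              rw [hlow]
              intro j hj
              have hzj : u.repr z j = ∑ l, x.repr z l * u.repr (x l) j := repr_eq_sum_repr u x z j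
              rw [Finset.sum_eq_single i] at hzj
              · rw [map_sub, map_smul, Finsupp.sub_apply, Finsupp.smul_apply, hzj, hxr i j hj,
                  u.repr_self, Finsupp.single_apply, smul_eq_mul, inv_mul_cancel_left₀ hr, sub_self]
              · intro l _ hl
                by_cases hlt : m + 1 ≤ l
                · rw [hz l hlt, zero_mul]
                · have hli : l < i := by
                    rw [Fin.lt_def]
                    have : (l : ℕ) ≠ m := fun h => hl (Fin.ext h)
                    simp only [hi]
                    omega
                  rw [hxr l j (hli.le.trans hj), if_neg (hli.trans_le hj).ne, mul_zero]
              · simp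
            have htk := hmax i _ hlowz t (Submodule.smul_mem _ _ hzt)
            have h1 := ih (z - x.repr z i • x i) (fun j hj => ?_)
              (Submodule.sub_mem _ hzt (Submodule.smul_mem _ _ (wfilt_anti v c htk (hxk i))))
            · have h2 := Submodule.add_mem _ h1 (Submodule.smul_mem _ (x.repr z i)
                (wfilt_anti x (fun i => c (k i)) htk (basis_mem_wfilt x (fun i => c (k i)) i)))
              simpa using h2
            · rw [map_sub, map_smul, Finsupp.sub_apply, Finsupp.smul_apply, x.repr_self,
                Finsupp.single_apply]
              split_ifs with h
              · rw [← h]; simp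
              · rw [smul_eq_mul, mul_zero, sub_zero]
                refine hz j ?_
                have : (j : ℕ) ≠ m := fun h' => h (Fin.ext h'.symm)
                omega
        · refine ih z (fun j hj => absurd j.2 (by omega)) hzt
    exact fun z hz => key N z (fun i hi => absurd i.2 (by omega)) hz

end CommonBasis

section Optimal

set_option linter.unusedSectionVars false

open Module

variable {V : Type*} [AddCommGroup V] [Module ℝ V] {N : ℕ}

/-- An optimal multiplicative filtration: its weights are as close to `1` as possible. -/
structure IsOptimal (b : V →ₗ[ℝ] V →ₗ[ℝ] V) (u : Basis (Fin N) ℝ V) (a : Fin N → ℝ) : Prop where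
  anti : Antitone a
  mult : IsMultFilt b u a
  min : ∀ (v : Basis (Fin N) ℝ V) (c : Fin N → ℝ), IsMultFilt b v c →
    ∑ i, (a i - 1) ^ 2 ≤ ∑ i, (c i - 1) ^ 2

theorem exists_isOptimal (b : V →ₗ[ℝ] V →ₗ[ℝ] V) (u₀ : Basis (Fin N) ℝ V) :
    ∃ u a, IsOptimal b (u : Basis (Fin N) ℝ V) a := by
  classical
  let supp : Basis (Fin N) ℝ V → Set (Fin N × Fin N × Fin N) := fun u =>
    {p | u.repr (b (u p.1) (u p.2.1)) p.2.2 ≠ 0}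
  let cone : Set (Fin N × Fin N × Fin N) → Set (EuclideanSpace ℝ (Fin N)) := fun s =>
    ⋂ p ∈ s, {w | w p.1 + w p.2.1 ≤ w p.2.2}
  have hcone : ∀ (u : Basis (Fin N) ℝ V) (w : EuclideanSpace ℝ (Fin N)),
      w ∈ cone (supp u) ↔ IsMultFilt b u w := by
    intro u w
    rw [isMultFilt_iff]
    simp only [cone, supp, Set.mem_iInter, Set.mem_ofPred_eq, Prod.forall]
  have hclosed : IsClosed (⋃ s ∈ Set.range supp, cone s) := by
    refine Set.Finite.isClosed_biUnion (Set.toFinite _) fun s _ => ?_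
    refine isClosed_biInter fun p _ => ?_
    exact isClosed_le (by fun_prop) (by fun_prop)
  have hne : (⋃ s ∈ Set.range supp, cone s).Nonempty := by
    refine ⟨0, Set.mem_biUnion (Set.mem_range_self u₀) ?_⟩
    rw [hcone, isMultFilt_iff]
    intro i j k _
    simp
  obtain ⟨w, hw, hwmin⟩ := hclosed.exists_infDist_eq_dist hne (WithLp.toLp 2 fun _ => (1 : ℝ))
  simp only [Set.mem_iUnion, Set.mem_range, exists_prop, exists_exists_eq_and] at hw
  obtain ⟨u, hu⟩ := hw
  rw [hcone] at hu
  have hmin : ∀ (v : Basis (Fin N) ℝ V) (c : Fin N → ℝ), IsMultFilt b v c →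
      ∑ i, (w i - 1) ^ 2 ≤ ∑ i, (c i - 1) ^ 2 := by
    intro v c hvc
    have h1 : (WithLp.toLp 2 c : EuclideanSpace ℝ (Fin N)) ∈ ⋃ s ∈ Set.range supp, cone s :=
      Set.mem_biUnion (Set.mem_range_self v) ((hcone v _).2 hvc)
    have h2 := Metric.infDist_le_dist_of_mem (x := (WithLp.toLp 2 fun _ => (1 : ℝ))) h1
    rw [hwmin, EuclideanSpace.dist_eq, EuclideanSpace.dist_eq] at h2
    have h3 := (Real.sqrt_le_sqrt_iff (Finset.sum_nonneg fun _ _ => sq_nonneg _)).1 h2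
    simpa [Real.dist_eq, sq_abs, sub_sq_comm (1 : ℝ)] using h3
  let σ := Tuple.sort fun i => - w i
  have hσ : Antitone (w ∘ σ) := by
    intro i j hij
    have := Tuple.monotone_sort (fun i => - w i) hij
    simpa using this
  refine ⟨u.reindex σ.symm, w ∘ σ, hσ, ?_, ?_⟩
  · refine (isMultFilt_congr fun t => le_antisymm ?_ ?_).1 hu
    · refine wfilt_le_of_basis_mem (fun i => ?_) t
      simpa using basis_mem_wfilt (u.reindex σ.symm) (w ∘ σ) (σ.symm i)
    · refine wfilt_le_of_basis_mem (fun i => ?_) t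
      simpa using basis_mem_wfilt u w (σ i)
  · intro v c hvc
    refine le_trans (le_of_eq ?_) (hmin v c hvc)
    exact Equiv.sum_comp σ (fun i => (w i - 1) ^ 2)

namespace IsOptimal

variable {b : V →ₗ[ℝ] V →ₗ[ℝ] V} {u : Basis (Fin N) ℝ V} {a : Fin N → ℝ}

theorem nonneg_of_forall_sq {α β : ℝ} (h : ∀ s : ℝ, 0 ≤ s → 0 ≤ 2 * s * α + s ^ 2 * β) : 0 ≤ α := by
  by_contra hα
  push Not at hα
  have hβ := h 1 zero_le_one
  have hb : 0 < β := by nlinarith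
  have := h (-α / β) (by have := neg_pos.2 hα; positivity)
  have e : 2 * (-α / β) * α + (-α / β) ^ 2 * β = - α ^ 2 / β := by field_simp; ring
  rw [e, le_div_iff₀ hb] at this
  nlinarith [sq_pos_of_neg hα]

theorem exists_common (h : IsOptimal b u a) {v : Basis (Fin N) ℝ V} {c : Fin N → ℝ}
    (hc : IsMultFilt b v c) : ∃ (x : Basis (Fin N) ℝ V) (c' : Fin N → ℝ),
      (∀ t, wfilt x a t = wfilt u a t) ∧ (∀ t, wfilt x c' t = wfilt v c t) ∧
      0 ≤ ∑ i, (a i - 1) * c' i := by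
  obtain ⟨x, c', hxa, hxc⟩ := exists_common_basis u a h.anti v c
  refine ⟨x, c', hxa, hxc, ?_⟩
  have h1 := (isMultFilt_iff b x a).1 ((isMultFilt_congr hxa).2 h.mult)
  have h2 := (isMultFilt_iff b x c').1 ((isMultFilt_congr hxc).2 hc)
  refine nonneg_of_forall_sq (β := ∑ i, c' i ^ 2) fun s hs => ?_
  have h3 := h.min x (fun i => a i + s * c' i) ((isMultFilt_iff _ _ _).2 fun i j k hk => by
    have := h1 i j k hk
    have := mul_le_mul_of_nonneg_left (h2 i j k hk) hs
    linarith)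
  have h4 : ∑ i, (a i + s * c' i - 1) ^ 2 = ∑ i, (a i - 1) ^ 2 +
      (2 * s * ∑ i, (a i - 1) * c' i + s ^ 2 * ∑ i, c' i ^ 2) := by
    rw [Finset.mul_sum, Finset.mul_sum, ← Finset.sum_add_distrib, ← Finset.sum_add_distrib]
    exact Finset.sum_congr rfl fun i _ => by ring
  linarith

theorem sum_sq (h : IsOptimal b u a) : ∑ i, a i ^ 2 = ∑ i, a i := by
  have h1 := (isMultFilt_iff b u a).1 h.mult
  have key : ∀ r : ℝ, 0 ≤ r → ∑ i, (a i - 1) ^ 2 ≤ ∑ i, (r * a i - 1) ^ 2 := fun r hr =>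
    h.min u (fun i => r * a i) ((isMultFilt_iff _ _ _).2 fun i j k hk => by
      have := mul_le_mul_of_nonneg_left (h1 i j k hk) hr
      linarith)
  have h4 : ∀ r : ℝ, ∑ i, (r * a i - 1) ^ 2 = r ^ 2 * ∑ i, a i ^ 2 - 2 * r * ∑ i, a i + ∑ i : Fin N, 1
      := by
    intro r
    rw [Finset.mul_sum, Finset.mul_sum, ← Finset.sum_sub_distrib, ← Finset.sum_add_distrib]
    exact Finset.sum_congr rfl fun i _ => by ring
  have h5 : ∀ r : ℝ, 0 ≤ r → 0 ≤ (r ^ 2 - 1) * ∑ i, a i ^ 2 - 2 * (r - 1) * ∑ i, a i := by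
    intro r hr
    have h6 := key r hr
    have h7 := h4 r
    have h8 := h4 1
    simp only [one_mul] at h8
    linarith
  set S := ∑ i, a i ^ 2
  set T := ∑ i, a i
  have hge : 0 ≤ S - T := nonneg_of_forall_sq (β := S) fun s hs => by
    have := h5 (1 + s) (by linarith)
    linarith
  have hle : 0 ≤ T - S := nonneg_of_forall_sq (β := S) fun s hs => by
    by_cases hs1 : s ≤ 1
    · have := h5 (1 - s) (by linarith)
      linarith
    · have hS : 0 ≤ S := Finset.sum_nonneg fun _ _ => sq_nonneg _
      have e1 := mul_nonneg hs (h5 0 le_rfl)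
      have e2 := mul_nonneg (mul_nonneg hs (sub_nonneg.2 (not_le.1 hs1).le)) hS
      linarith
  linarith

end IsOptimal

end Optimal

section OptimalInvariance

set_option linter.unusedSectionVars false

open Module

namespace IsOptimal

theorem mem_wfilt_of_automorphism {V : Type*} [AddCommGroup V] [Module ℝ V] {N : ℕ}
    {b : V →ₗ[ℝ] V →ₗ[ℝ] V} {u : Basis (Fin N) ℝ V} {a : Fin N → ℝ} (h : IsOptimal b u a)
    (φ : V ≃ₗ[ℝ] V) (hφ : ∀ x y, φ (b x y) = b (φ x) (φ y)) {t : ℝ} {y : V}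
    (hy : y ∈ wfilt u a t) : φ y ∈ wfilt u a t := by
  have hv : ∀ s z, z ∈ wfilt (u.map φ) a s ↔ φ.symm z ∈ wfilt u a s := fun s z => by
    simp [mem_wfilt]
  have hmult : IsMultFilt b (u.map φ) a := by
    intro s t x hx y hy
    rw [hv] at hx hy ⊢
    have e : φ.symm (b x y) = b (φ.symm x) (φ.symm y) := by
      rw [LinearEquiv.symm_apply_eq, hφ]; simp
    rw [e]
    exact h.mult _ _ _ hx _ hy
  obtain ⟨x, c', hxa, hxc, hnn⟩ := h.exists_common hmult
  have e1 := sum_weights_eq _ _ _ _ hxc (fun r => r)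
  have e2 := sum_weights_eq _ _ _ _ hxc (fun r => r ^ 2)
  have e3 := h.sum_sq
  have e4 : ∑ i, (a i - c' i) ^ 2 = ∑ i, c' i ^ 2 + ∑ i, a i ^ 2 - 2 * ∑ i, c' i -
      2 * ∑ i, (a i - 1) * c' i := by
    rw [Finset.mul_sum, Finset.mul_sum, ← Finset.sum_add_distrib, ← Finset.sum_sub_distrib,
      ← Finset.sum_sub_distrib]
    exact Finset.sum_congr rfl fun i _ => by ring
  have e5 : ∑ i, (a i - c' i) ^ 2 = 0 :=
    le_antisymm (by linarith) (Finset.sum_nonneg fun _ _ => sq_nonneg _)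
  have e6 : c' = a := by
    funext i
    have := (Finset.sum_eq_zero_iff_of_nonneg fun _ _ => sq_nonneg _).1 e5 i (Finset.mem_univ i)
    have := pow_eq_zero_iff two_ne_zero |>.1 this
    linarith
  rw [← hxa, ← e6, hxc, hv]
  simpa using hy

end IsOptimal

variable {V : Type*} [NormedAddCommGroup V] [NormedSpace ℝ V] [FiniteDimensional ℝ V]

/-- The exponential of an endomorphism of a finite-dimensional space. -/
def expEnd (δ : V →ₗ[ℝ] V) (s : ℝ) : V →L[ℝ] V :=
  NormedSpace.exp (s • LinearMap.toContinuousLinearMap δ)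

theorem hasDerivAt_expEnd (δ : V →ₗ[ℝ] V) (s : ℝ) :
    HasDerivAt (expEnd δ) (LinearMap.toContinuousLinearMap δ * expEnd δ s) s := by
  have : CompleteSpace V := FiniteDimensional.complete ℝ V
  exact hasDerivAt_exp_smul_const' (LinearMap.toContinuousLinearMap δ) s

theorem hasDerivAt_expEnd_apply (δ : V →ₗ[ℝ] V) (x : V) (s : ℝ) :
    HasDerivAt (fun r => expEnd δ r x) (δ (expEnd δ s x)) s := by
  have := (hasDerivAt_expEnd δ s).clm_apply (hasDerivAt_const s x)
  simpa using this

theorem expEnd_zero (δ : V →ₗ[ℝ] V) : expEnd δ 0 = 1 := by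
  simp [expEnd, NormedSpace.exp_zero]

theorem expEnd_mul_neg (δ : V →ₗ[ℝ] V) (s : ℝ) : expEnd δ s * expEnd δ (-s) = 1 := by
  have : CompleteSpace V := FiniteDimensional.complete ℝ V
  let _ : NormedAlgebra ℚ (V →L[ℝ] V) := NormedAlgebra.restrictScalars ℚ ℝ _
  rw [expEnd, expEnd, ← NormedSpace.exp_add_of_commute]
  · simp [NormedSpace.exp_zero]
  · rw [neg_smul]
    exact (Commute.refl _).neg_right

/-- The exponential of an endomorphism as a linear automorphism. -/
def expEquiv (δ : V →ₗ[ℝ] V) (s : ℝ) : V ≃ₗ[ℝ] V :=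
  LinearEquiv.ofLinearMap (expEnd δ s).toLinearMap (expEnd δ (-s)).toLinearMap
    (by
      ext x
      exact congrArg (fun f : V →L[ℝ] V => f x) (expEnd_mul_neg δ s))
    (by
      ext x
      have := congrArg (fun f : V →L[ℝ] V => f x) (expEnd_mul_neg δ (-s))
      simpa using this)

theorem hasDerivAt_bilin (b : V →ₗ[ℝ] V →ₗ[ℝ] V) {f g : ℝ → V} {f' g' : V} {s : ℝ}
    (hf : HasDerivAt f f' s) (hg : HasDerivAt g g' s) :
    HasDerivAt (fun r => b (f r) (g r)) (b f' (g s) + b (f s) g') s := by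
  let bc : V →L[ℝ] V →L[ℝ] V := LinearMap.toContinuousLinearMap
    ((LinearMap.toContinuousLinearMap : (V →ₗ[ℝ] V) ≃ₗ[ℝ] (V →L[ℝ] V)).toLinearMap ∘ₗ b)
  have h1 := (bc.hasFDerivAt.comp_hasDerivAt s hf).clm_apply hg
  exact h1

theorem expEnd_map_bilin {b : V →ₗ[ℝ] V →ₗ[ℝ] V} {δ : V →ₗ[ℝ] V} (hδ : IsDeriv b δ) (s : ℝ)
    (x y : V) : expEnd δ s (b x y) = b (expEnd δ s x) (expEnd δ s y) := by
  have hcomm : ∀ r z, expEnd δ r (δ z) = δ (expEnd δ r z) := by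
    intro r z
    have h1 : Commute (LinearMap.toContinuousLinearMap δ) (expEnd δ r) := by
      have : CompleteSpace V := FiniteDimensional.complete ℝ V
      let _ : NormedAlgebra ℚ (V →L[ℝ] V) := NormedAlgebra.restrictScalars ℚ ℝ _
      exact ((Commute.refl _).smul_right r).exp_right
    exact (congrArg (fun f : V →L[ℝ] V => f z) h1.eq).symm
  have hder : ∀ r, HasDerivAt
      (fun r => expEnd δ (-r) (b (expEnd δ r x) (expEnd δ r y))) 0 r := by
    intro r
    have h1 := hasDerivAt_bilin b (hasDerivAt_expEnd_apply δ x r) (hasDerivAt_expEnd_apply δ y r)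
    have h2 : HasDerivAt (fun r => expEnd δ (-r))
        (-(LinearMap.toContinuousLinearMap δ * expEnd δ (-r))) r := by
      have h := (hasDerivAt_expEnd δ (-r)).scomp r (hasDerivAt_neg r)
      rw [neg_one_smul] at h
      exact h
    have h3 := h2.clm_apply h1
    convert h3 using 1
    rw [← hδ]
    simp [hcomm]
  have hconst := is_const_of_deriv_eq_zero (fun r => (hder r).differentiableAt)
    (fun r => (hder r).deriv) s 0
  simp only [neg_zero, expEnd_zero, one_apply_eq_self] at hconst
  rw [← hconst]
  exact congrArg (fun f : V →L[ℝ] V => f _) (expEnd_mul_neg δ s)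

theorem IsOptimal.mem_wfilt_of_isDeriv {N : ℕ} {b : V →ₗ[ℝ] V →ₗ[ℝ] V} {u : Basis (Fin N) ℝ V}
    {a : Fin N → ℝ} (h : IsOptimal b u a) {δ : V →ₗ[ℝ] V} (hδ : IsDeriv b δ) (t : ℝ) (y : V)
    (hy : y ∈ wfilt u a t) : δ y ∈ wfilt u a t := by
  intro i hi
  have h1 : ∀ s, u.coord i (expEnd δ s y) = 0 := fun s =>
    h.mem_wfilt_of_automorphism (expEquiv δ s) (fun x z => expEnd_map_bilin hδ s x z) hy i hi
  have h2 := (LinearMap.toContinuousLinearMap (u.coord i)).hasFDerivAt.comp_hasDerivAt (0 : ℝ)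
    (hasDerivAt_expEnd_apply δ y 0)
  have h3 : (⇑(LinearMap.toContinuousLinearMap (u.coord i)) ∘ fun r => expEnd δ r y) =
      fun _ => (0 : ℝ) := by
    funext r
    exact h1 r
  rw [h3] at h2
  have h4 := h2.unique (hasDerivAt_const (0 : ℝ) (0 : ℝ))
  simpa [expEnd_zero] using h4

end OptimalInvariance

section RealPart

open Module Polynomial TensorProduct

theorem exists_polynomial_dvd_sub (s : Finset ℂ) (m : ℕ) (r : ℂ → ℂ) :
    ∃ q : ℂ[X], ∀ z ∈ s, (X - C z) ^ m ∣ q - C (r z) := by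
  obtain ⟨q, hq⟩ := IsDedekindDomain.exists_forall_sub_mem_ideal (s := s)
    (fun z : ℂ => Ideal.span {(X - C z : ℂ[X])}) (fun _ => m)
    (fun z _ => Ideal.prime_of_isPrime (by
        rw [Ne, Ideal.span_singleton_eq_bot]; exact X_sub_C_ne_zero z)
      ((Ideal.span_singleton_prime (X_sub_C_ne_zero z)).2 (prime_X_sub_C z)))
    (fun z _ w _ hzw h => hzw (by
        have h1 := (Ideal.span_singleton_le_span_singleton (x := (X - C z : ℂ[X]))
          (y := X - C w)).1 h.le
        have h2 := dvd_iff_isRoot.1 h1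
        simpa [sub_eq_zero, eq_comm] using h2)) (fun z => C (r z))
  refine ⟨q, fun z hz => ?_⟩
  have := hq z hz
  rwa [Ideal.span_singleton_pow, Ideal.mem_span_singleton] at this

/-- A real polynomial interpolating `Re` to high order along a conjugation-stable finite set. -/
theorem exists_real_polynomial_dvd_sub (s : Finset ℂ) (hs : ∀ z ∈ s, (starRingEnd ℂ) z ∈ s) (m : ℕ) :
    ∃ q : ℝ[X], ∀ z ∈ s, (X - C z) ^ m ∣ q.map (algebraMap ℝ ℂ) - C (z.re : ℂ) := by
  obtain ⟨q, hq⟩ := exists_polynomial_dvd_sub s m fun z => (z.re : ℂ)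
  have hq' : ∀ z ∈ s, (X - C z) ^ m ∣ q.map (starRingEnd ℂ) - C (z.re : ℂ) := by
    intro z hz
    have := map_dvd (mapRingHom (starRingEnd ℂ)) (hq _ (hs z hz))
    simpa using this
  have hlift : C (1 / 2 : ℂ) * (q + q.map (starRingEnd ℂ)) ∈ lifts (algebraMap ℝ ℂ) := by
    rw [lifts_iff_coeff_lifts]
    intro n
    refine ⟨(q.coeff n).re, ?_⟩
    rw [coeff_C_mul, coeff_add, coeff_map]
    apply Complex.ext <;> simp
    ring
  obtain ⟨p, hp⟩ := hlift
  refine ⟨p, fun z hz => ?_⟩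
  have e : p.map (algebraMap ℝ ℂ) - C (z.re : ℂ) = C (1 / 2 : ℂ) * (q - C (z.re : ℂ)) +
      C (1 / 2 : ℂ) * (q.map (starRingEnd ℂ) - C (z.re : ℂ)) := by
    have h1 : p.map (algebraMap ℝ ℂ) = C (1 / 2 : ℂ) * (q + q.map (starRingEnd ℂ)) := hp
    have h2 : (C (1 / 2 : ℂ) : ℂ[X]) + C (1 / 2 : ℂ) = 1 := by
      rw [← C_add]; norm_num
    rw [h1]
    linear_combination (C (z.re : ℂ)) * h2
  rw [e]
  exact dvd_add ((hq z hz).mul_left _) ((hq' z hz).mul_left _)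

/-- Derivations are additive on generalized eigenspaces. -/
theorem bilin_mem_maxGenEigenspace {K W : Type*} [Field K] [AddCommGroup W] [Module K W]
    (b : W →ₗ[K] W →ₗ[K] W) (δ : Module.End K W)
    (hδ : ∀ x y, δ (b x y) = b (δ x) y + b x (δ y)) {α β : K} {x y : W}
    (hx : x ∈ δ.maxGenEigenspace α) (hy : y ∈ δ.maxGenEigenspace β) :
    b x y ∈ δ.maxGenEigenspace (α + β) := by
  rw [End.mem_maxGenEigenspace] at *
  obtain ⟨k, hk⟩ := hx
  obtain ⟨l, hl⟩ := hy
  have key : ∀ n i j : ℕ, i + j = n → ∀ x y, ((δ - α • (1 : Module.End K W)) ^ i) x = 0 →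
      ((δ - β • (1 : Module.End K W)) ^ j) y = 0 →
      ((δ - (α + β) • (1 : Module.End K W)) ^ n) (b x y) = 0 := by
    intro n
    induction n with
    | zero =>
      intro i j hij x y hx _
      obtain rfl : i = 0 := by omega
      have : x = 0 := by simpa using hx
      simp [this]
    | succ n ih =>
      intro i j hij x y hx hy
      rcases i with _ | i
      · have : x = 0 := by simpa using hx
        simp [this]
      rcases j with _ | j
      · have : y = 0 := by simpa using hy
        simp [this]
      have e : (δ - (α + β) • (1 : Module.End K W)) (b x y) =
          b ((δ - α • (1 : Module.End K W)) x) y + b x ((δ - β • (1 : Module.End K W)) y) := by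
        simp only [LinearMap.sub_apply, LinearMap.smul_apply, End.one_apply, hδ, map_sub, map_smul,
          add_smul, LinearMap.add_apply]
        abel
      rw [pow_succ, End.mul_apply, e, map_add, ih i (j + 1) (by omega) _ _ _ hy,
        ih (i + 1) j (by omega) _ _ hx, add_zero]
      · rw [pow_succ, End.mul_apply] at hy; exact hy
      · rw [pow_succ, End.mul_apply] at hx; exact hx
  exact ⟨k + l, key _ k l rfl x y hk hl⟩

theorem ker_aeval_prod_le_iSup_eigenspace {K W : Type*} [Field K] [AddCommGroup W] [Module K W]
    (P : Module.End K W) (s : Finset K) :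
    LinearMap.ker (aeval P (∏ r ∈ s, (X - C r))) ≤ ⨆ r : K, P.eigenspace r := by
  classical
  induction s using Finset.induction_on with
  | empty =>
    intro x hx
    have : x = 0 := by simpa using hx
    rw [this]
    exact Submodule.zero_mem _
  | insert r s hr ih =>
    rw [Finset.prod_insert hr, ← sup_ker_aeval_eq_ker_aeval_mul_of_coprime]
    · refine sup_le ?_ ih
      refine le_trans (le_of_eq ?_) (le_iSup _ r)
      rw [End.eigenspace_def]
      simp [Algebra.algebraMap_eq_smul_one]
    · refine IsCoprime.prod_right fun t ht => isCoprime_X_sub_C_of_isUnit_sub ?_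
      exact (sub_ne_zero.2 (by rintro rfl; exact hr ht)).isUnit

theorem exists_eigenbasis {K W : Type*} [Field K] [AddCommGroup W] [Module K W] {N : ℕ}
    (u₀ : Basis (Fin N) K W) (P : Module.End K W) (h : ⨆ r : K, P.eigenspace r = ⊤) :
    ∃ (v : Basis (Fin N) K W) (c : Fin N → K), ∀ i, P (v i) = c i • v i := by
  classical
  have hs : ⊤ ≤ Submodule.span K {x : W | ∃ r : K, P x = r • x} := by
    rw [← h]
    refine iSup_le fun r x hx => Submodule.subset_span ⟨r, End.mem_eigenspace_iff.1 hx⟩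
  let B := Basis.ofSpan hs
  let e := B.indexEquiv u₀
  have hB : ∀ i, ∃ r : K, P (B i) = r • B i := fun i => Basis.ofSpan_subset hs ⟨i, rfl⟩
  choose c hc using hB
  exact ⟨B.reindex e, fun i => c (e.symm i), fun i => by simpa using hc _⟩

theorem exists_eigenvector_imaginary {W : Type*} [AddCommGroup W] [Module ℂ W]
    [FiniteDimensional ℂ W] (δ : Module.End ℂ W) (q : ℂ[X])
    (hq : ∀ z, δ.HasEigenvalue z → q.eval z = z.re) {κ : ℂ}
    (hκ : (δ - aeval δ q).HasEigenvalue κ) : κ.re = 0 := by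
  have hJ : δ - aeval δ q = aeval δ (X - q) := by simp
  rw [hJ, End.hasEigenvalue_iff_mem_spectrum] at hκ
  have hnt : Nontrivial (Module.End ℂ W) := by
    by_contra hnt
    rw [not_nontrivial_iff_subsingleton] at hnt
    exact hκ (isUnit_of_subsingleton _)
  rw [spectrum.map_polynomial_aeval_of_nonempty _ _
    (spectrum.nonempty_of_isAlgClosed_of_finiteDimensional ℂ δ)] at hκ
  obtain ⟨z, hz, rfl⟩ := hκ
  have := hq z (End.hasEigenvalue_iff_mem_spectrum.2 hz)
  simp [this]

theorem baseChange_aeval {V : Type*} [AddCommGroup V] [Module ℝ V] (δ : Module.End ℝ V)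
    (q : ℝ[X]) : (LinearMap.baseChange ℂ (aeval δ q : Module.End ℝ V)) =
      aeval (LinearMap.baseChange ℂ δ : Module.End ℂ (ℂ ⊗[ℝ] V)) (q.map (algebraMap ℝ ℂ)) := by
  rw [aeval_map_algebraMap]
  exact (aeval_algHom_apply (End.baseChangeHom ℝ ℂ V) δ q).symm

theorem trace_eq_zero_of_imaginary {V : Type*} [AddCommGroup V] [Module ℝ V]
    [FiniteDimensional ℝ V] (f : Module.End ℝ V)
    (h : ∀ κ, End.HasEigenvalue (LinearMap.baseChange ℂ f : Module.End ℂ (ℂ ⊗[ℝ] V)) κ →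
      κ.re = 0) : LinearMap.trace ℝ V f = 0 := by
  have h1 := LinearMap.trace_baseChange f ℂ
  rw [End.trace_eq_sum_roots_charpoly_of_splits (IsAlgClosed.splits _)] at h1
  have h2 := congrArg Complex.re h1
  have h3 : ∀ s : Multiset ℂ, (∀ z ∈ s, z.re = 0) → s.sum.re = 0 := by
    intro s
    induction s using Multiset.induction_on with
    | empty => simp
    | cons z s ih =>
      intro hs
      simp [hs z (Multiset.mem_cons_self z s), ih fun w hw => hs w (Multiset.mem_cons_of_mem hw)]
  rw [h3 _ fun z hz => h z ((End.hasEigenvalue_iff_isRoot_charpoly _ _).2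
    (isRoot_of_mem_roots hz))] at h2
  simpa using h2.symm

/-- The real part of the semisimple part of a derivation: a diagonalizable derivation with the same
traces on invariant subspaces. -/
theorem exists_realPart_isDeriv {V : Type*} [AddCommGroup V] [Module ℝ V] {N : ℕ}
    (u₀ : Basis (Fin N) ℝ V) (b : V →ₗ[ℝ] V →ₗ[ℝ] V) (δ : V →ₗ[ℝ] V) (hδ : IsDeriv b δ) :
    ∃ P : V →ₗ[ℝ] V, IsDeriv b P ∧
      (∃ (v : Basis (Fin N) ℝ V) (c : Fin N → ℝ), ∀ i, P (v i) = c i • v i) ∧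
      ∀ Q : V →ₗ[ℝ] V, Q ∘ₗ Q = Q → Q ∘ₗ (δ - P) ∘ₗ Q = (δ - P) ∘ₗ Q →
        LinearMap.trace ℝ V ((δ - P) ∘ₗ Q) = 0 := by
  classical
  have : FiniteDimensional ℝ V := u₀.finiteDimensional_of_finite
  let δc : Module.End ℂ (ℂ ⊗[ℝ] V) := LinearMap.baseChange ℂ δ
  let s : Finset ℂ := δc.charpoly.roots.toFinset ∪
    δc.charpoly.roots.toFinset.image (starRingEnd ℂ)
  have hs : ∀ z ∈ s, (starRingEnd ℂ) z ∈ s := by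
    intro z hz
    rcases Finset.mem_union.1 hz with h | h
    · exact Finset.mem_union_right _ (Finset.mem_image_of_mem _ h)
    · obtain ⟨w, hw, rfl⟩ := Finset.mem_image.1 h
      rw [Complex.conj_conj]
      exact Finset.mem_union_left _ hw
  have hmem : ∀ z, δc.HasEigenvalue z → z ∈ s := fun z hz =>
    Finset.mem_union_left _ (by
      rw [Multiset.mem_toFinset, mem_roots (LinearMap.charpoly_monic _).ne_zero]
      exact (End.hasEigenvalue_iff_isRoot_charpoly _ _).1 hz)
  obtain ⟨q, hq⟩ := exists_real_polynomial_dvd_sub s hs (finrank ℂ (ℂ ⊗[ℝ] V) + 1)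
  set P : Module.End ℝ V := aeval δ q with hP
  let Pc : Module.End ℂ (ℂ ⊗[ℝ] V) := LinearMap.baseChange ℂ P
  have hPc : Pc = aeval δc (q.map (algebraMap ℝ ℂ)) := baseChange_aeval δ q
  have hPgen : ∀ z, ∀ x ∈ δc.maxGenEigenspace z, Pc x = (z.re : ℂ) • x := by
    intro z x hx
    by_cases hx0 : x = 0
    · simp [hx0]
    have hz : δc.HasEigenvalue z := by
      refine End.hasEigenvalue_of_hasGenEigenvalue
        (k := finrank ℂ (ℂ ⊗[ℝ] V)) ?_
      rw [End.maxGenEigenspace_eq_genEigenspace_finrank] at hx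
      exact fun h => hx0 (by rw [h] at hx; simpa using hx)
    rw [End.maxGenEigenspace_eq_genEigenspace_finrank, End.mem_genEigenspace_nat,
      LinearMap.mem_ker] at hx
    obtain ⟨p, hp⟩ := hq z (hmem z hz)
    have h1 : q.map (algebraMap ℝ ℂ) = C (z.re : ℂ) + p * (X - C z) * (X - C z) ^
        (finrank ℂ (ℂ ⊗[ℝ] V)) := by
      rw [← sub_eq_iff_eq_add', hp]; ring
    have h2 : aeval δc ((X - C z) ^ (finrank ℂ (ℂ ⊗[ℝ] V))) x = 0 := by
      rw [map_pow, map_sub, aeval_X, aeval_C, Algebra.algebraMap_eq_smul_one]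
      exact hx
    rw [hPc, h1, map_add, map_mul, LinearMap.add_apply, End.mul_apply, h2, map_zero, add_zero,
      aeval_C, Algebra.algebraMap_eq_smul_one, LinearMap.smul_apply, End.one_apply]
  have htop := End.iSup_maxGenEigenspace_eq_top δc
  have hinj : ∀ x y : V, (1 : ℂ) ⊗ₜ[ℝ] x = (1 : ℂ) ⊗ₜ[ℝ] y → x = y := fun x y h =>
    Module.Flat.tensorProduct_mk_injective ℝ V ℂ h
  refine ⟨P, ?_, ?_, ?_⟩
  · let bc : (ℂ ⊗[ℝ] V) →ₗ[ℂ] (ℂ ⊗[ℝ] V) →ₗ[ℂ] (ℂ ⊗[ℝ] V) := LinearMap.BilinMap.baseChange ℂ b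
    have hδc : ∀ x y, δc (bc x y) = bc (δc x) y + bc x (δc y) := by
      intro x y
      induction x using TensorProduct.induction_on with
      | zero => simp
      | add x x' hx hx' => simp only [map_add, LinearMap.add_apply, hx, hx']; abel
      | tmul r x =>
        induction y using TensorProduct.induction_on with
        | zero => simp
        | add y y' hy hy' => simp only [map_add, hy, hy']; abel
        | tmul t y =>
          simp only [δc, bc, LinearMap.BilinMap.baseChange_tmul, LinearMap.baseChange_tmul, hδ x y,
            TensorProduct.tmul_add]
    have hPder : ∀ x y, Pc (bc x y) = bc (Pc x) y + bc x (Pc y) := by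
      intro x y
      have hx : x ∈ ⨆ z, δc.maxGenEigenspace z := htop ▸ Submodule.mem_top
      have hy : y ∈ ⨆ z, δc.maxGenEigenspace z := htop ▸ Submodule.mem_top
      induction hx using Submodule.iSup_induction' with
      | zero => simp
      | add x x' _ _ hx hx' => simp only [map_add, LinearMap.add_apply, hx, hx']; abel
      | mem z x hx =>
        induction hy using Submodule.iSup_induction' with
        | zero => simp
        | add y y' _ _ hy hy' => simp only [map_add, hy, hy']; abel
        | mem w y hy =>
          rw [hPgen _ _ (bilin_mem_maxGenEigenspace bc δc hδc hx hy), hPgen _ _ hx, hPgen _ _ hy]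
          rw [map_smul, map_smul, LinearMap.smul_apply, ← add_smul, Complex.add_re,
            Complex.ofReal_add]
    intro x y
    apply hinj
    have := hPder (1 ⊗ₜ x) (1 ⊗ₜ y)
    simpa [Pc, bc, TensorProduct.tmul_add] using this
  · refine exists_eigenbasis u₀ P (top_le_iff.1 ?_)
    refine le_trans ?_ (ker_aeval_prod_le_iSup_eigenspace P (s.image Complex.re))
    have hzero : aeval Pc ((∏ r ∈ s.image Complex.re, (X - C r)).map (algebraMap ℝ ℂ)) = 0 := by
      refine LinearMap.ext fun x => ?_
      have hx : x ∈ ⨆ z, δc.maxGenEigenspace z := htop ▸ Submodule.mem_top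
      induction hx using Submodule.iSup_induction' with
      | zero => simp
      | add x x' _ _ hx hx' => rw [map_add, hx, hx']; simp
      | mem z x hx =>
        by_cases hx0 : x = 0
        · simp [hx0]
        have hz : δc.HasEigenvalue z := by
          refine End.hasEigenvalue_of_hasGenEigenvalue
            (k := finrank ℂ (ℂ ⊗[ℝ] V)) ?_
          rw [End.maxGenEigenspace_eq_genEigenspace_finrank] at hx
          exact fun h => hx0 (by rw [h] at hx; simpa using hx)
        rw [← Finset.prod_erase_mul _ _ (Finset.mem_image_of_mem Complex.re (hmem z hz)),
          Polynomial.map_mul, map_mul, End.mul_apply]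
        have : aeval Pc ((X - C z.re).map (algebraMap ℝ ℂ)) x = 0 := by
          rw [Polynomial.map_sub, map_X, map_C, map_sub, aeval_X, aeval_C, LinearMap.sub_apply,
            hPgen z x hx, Module.algebraMap_end_apply]
          exact sub_self ((z.re : ℂ) • x)
        rw [this, map_zero, LinearMap.zero_apply]
    intro x _
    rw [LinearMap.mem_ker]
    apply hinj
    have h1 := baseChange_aeval P (∏ r ∈ s.image Complex.re, (X - C r))
    rw [show (LinearMap.baseChange ℂ P : Module.End ℂ (ℂ ⊗[ℝ] V)) = Pc from rfl, hzero] at h1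
    have h2 := LinearMap.congr_fun h1 (1 ⊗ₜ x)
    rw [LinearMap.baseChange_tmul] at h2
    rw [h2, LinearMap.zero_apply, TensorProduct.tmul_zero]
  · intro Q hQ hQJ
    refine trace_eq_zero_of_imaginary _ fun κ hκ => ?_
    by_cases hκ0 : κ = 0
    · simp [hκ0]
    obtain ⟨x, hx, hx0⟩ := hκ.exists_hasEigenvector
    rw [End.mem_eigenspace_iff] at hx
    have e1 : LinearMap.baseChange ℂ ((δ - P) ∘ₗ Q) =
        (δc - Pc) ∘ₗ LinearMap.baseChange ℂ Q := by
      rw [LinearMap.baseChange_comp, LinearMap.baseChange_sub]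
    have e2 : LinearMap.baseChange ℂ Q ∘ₗ LinearMap.baseChange ℂ ((δ - P) ∘ₗ Q) =
        LinearMap.baseChange ℂ ((δ - P) ∘ₗ Q) := by
      rw [← LinearMap.baseChange_comp, hQJ]
    have h1 := LinearMap.congr_fun e2 x
    rw [LinearMap.comp_apply, hx, map_smul] at h1
    have h2 : LinearMap.baseChange ℂ Q x = x := smul_right_injective _ hκ0 h1
    rw [e1, LinearMap.comp_apply, h2, hPc] at hx
    refine exists_eigenvector_imaginary δc (q.map (algebraMap ℝ ℂ)) (fun z hz => ?_)
      (End.hasEigenvalue_of_hasEigenvector ⟨End.mem_eigenspace_iff.2 hx, hx0⟩)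
    obtain ⟨p, hp⟩ := hq z (hmem z hz)
    rw [sub_eq_iff_eq_add.1 hp]
    simp

end RealPart

section OptimalTrace

open Module

variable {V : Type*} [NormedAddCommGroup V] [NormedSpace ℝ V] [FiniteDimensional ℝ V]

theorem sum_mul_eq_zero_of_isUpperSet {N : ℕ} (a d : Fin N → ℝ)
    (h : ∀ S : Set ℝ, IsUpperSet S → ∀ [DecidablePred (· ∈ S)],
      ∑ i, (if a i ∈ S then (1 : ℝ) else 0) * d i = 0) :
    ∑ i, a i * d i = 0 := by
  classical
  have h1 : ∀ t : ℝ, ∑ i with a i = t, d i = 0 := by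
    intro t
    have e1 := h (Set.Ici t) (isUpperSet_Ici t)
    have e2 := h (Set.Ioi t) (isUpperSet_Ioi t)
    rw [← sub_eq_zero.2 (e1.trans e2.symm), ← Finset.sum_sub_distrib, Finset.sum_filter]
    refine Finset.sum_congr rfl fun i _ => ?_
    simp only [Set.mem_Ici, Set.mem_Ioi]
    rcases lt_trichotomy (a i) t with hlt | heq | hgt
    · simp [hlt.ne, not_le.2 hlt, not_lt.2 hlt.le]
    · simp [heq]
    · simp [hgt.ne', hgt.le, hgt]
  rw [← Finset.sum_fiberwise_of_maps_to (s := Finset.univ) (t := Finset.univ.image a) (g := a)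
    (fun i _ => Finset.mem_image_of_mem _ (Finset.mem_univ i))]
  refine Finset.sum_eq_zero fun t _ => ?_
  rw [← mul_zero t, ← h1 t, Finset.mul_sum]
  refine Finset.sum_congr rfl fun i hi => ?_
  rw [(Finset.mem_filter.1 hi).2]

/-- The weights of an optimal filtration pair non-negatively with every derivation. -/
theorem IsOptimal.sum_mul_repr_nonneg {N : ℕ} {b : V →ₗ[ℝ] V →ₗ[ℝ] V} {u : Basis (Fin N) ℝ V}
    {a : Fin N → ℝ} (h : IsOptimal b u a) {δ : V →ₗ[ℝ] V} (hδ : IsDeriv b δ) :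
    0 ≤ ∑ i, (a i - 1) * u.repr (δ (u i)) i := by
  classical
  obtain ⟨P, hP, ⟨v, c, hv⟩, hJ⟩ := exists_realPart_isDeriv u b δ hδ
  have hPv : P = diagOp v c := v.ext fun i => by rw [hv, diagOp_basis]
  have hmult : IsMultFilt b v c := by
    refine (isMultFilt_iff b v c).2 fun i j k hk => ?_
    have e := congrArg (fun z => v.repr z k) (hP (v i) (v j))
    simp only [hv, map_smul, LinearMap.smul_apply, map_add, Finsupp.add_apply, Finsupp.smul_apply,
      smul_eq_mul] at e
    rw [hPv, repr_diagOp, ← add_mul] at e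
    exact (mul_right_cancel₀ hk e).symm.le
  obtain ⟨x, c', hxa, hxc, hpos⟩ := h.exists_common hmult
  have hP1 : ∀ i, x.repr (P (x i)) i = c' i := by
    intro i
    have h1 := basis_mem_wfilt x c' i
    rw [hxc] at h1
    obtain ⟨s, hs, h2⟩ := diagOp_sub_mem v c id h1
    rw [← hxc] at h2
    have h3 := h2 i hs
    rw [map_sub, Finsupp.sub_apply, sub_eq_zero] at h3
    rw [hPv]
    simpa using h3
  have hpres : ∀ t y, y ∈ wfilt x a t → (δ - P) y ∈ wfilt x a t := by
    intro t y hy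
    rw [hxa] at hy ⊢
    exact Submodule.sub_mem _ (h.mem_wfilt_of_isDeriv hδ t y hy) (h.mem_wfilt_of_isDeriv hP t y hy)
  have hS : ∀ S : Set ℝ, IsUpperSet S → ∀ [DecidablePred (· ∈ S)],
      ∑ i, (if a i ∈ S then (1 : ℝ) else 0) * x.repr ((δ - P) (x i)) i = 0 := by
    intro S hS _
    have := hJ (diagOp x fun i => if a i ∈ S then 1 else 0) ?_ ?_
    · rw [← trace_diagOp_comp, LinearMap.trace_comp_comm']
      exact this
    · refine x.ext fun i => ?_
      simp only [LinearMap.comp_apply, diagOp_basis, map_smul]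
      split_ifs <;> simp
    · refine x.ext fun i => x.ext_elem fun k => ?_
      simp only [LinearMap.comp_apply]
      rw [diagOp_basis, repr_diagOp]
      by_cases hi : a i ∈ S
      · by_cases hk : a k ∈ S
        · rw [if_pos hi, if_pos hk, one_smul, one_mul]
        · have := hpres _ _ (basis_mem_wfilt x a i) k (not_le.1 fun hle => hk (hS hle hi))
          rw [if_pos hi, if_neg hk, one_smul, this, zero_mul]
      · rw [if_neg hi, zero_smul, map_zero, map_zero, Finsupp.zero_apply, mul_zero]
  have hJ0 : ∑ i, (a i - 1) * x.repr ((δ - P) (x i)) i = 0 := by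
    simp only [sub_mul, Finset.sum_sub_distrib, sum_mul_eq_zero_of_isUpperSet a _ hS, one_mul]
    have := hS Set.univ isUpperSet_univ
    simp only [Set.mem_univ, if_true, one_mul] at this
    rw [this, sub_zero]
  rw [weighted_trace_eq u x a a (fun t => (hxa t).symm) δ
    (fun t y hy => h.mem_wfilt_of_isDeriv hδ t y hy) (fun r => r - 1)]
  have e : ∀ i, (a i - 1) * x.repr (δ (x i)) i =
      (a i - 1) * x.repr ((δ - P) (x i)) i + (a i - 1) * c' i := by
    intro i
    rw [← hP1 i, LinearMap.sub_apply, map_sub, Finsupp.sub_apply]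
    ring
  rw [Finset.sum_congr rfl fun i _ => e i, Finset.sum_add_distrib, hJ0, zero_add]
  exact hpos

/-- The weights of an optimal filtration of a Lie algebra are non-negative. -/
theorem IsOptimal.nonneg {N : ℕ} {b : V →ₗ[ℝ] V →ₗ[ℝ] V} {u : Basis (Fin N) ℝ V}
    {a : Fin N → ℝ} (h : IsOptimal b u a) (hb : ∀ x, IsDeriv b (b x))
    (hanti : ∀ x y, b x y = - b y x) (i : Fin N) : 0 ≤ a i := by
  by_contra hi
  push Not at hi
  have h1 : ∑ i, (a i - 1) ^ 2 ≤ ∑ i, (max (a i) 0 - 1) ^ 2 := by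
    refine h.min u _ ((isMultFilt_iff b u _).2 fun i j k hk => ?_)
    have e1 : a i + a j ≤ a k := (isMultFilt_iff b u a).1 h.mult i j k hk
    have e2 : a j ≤ a k := not_lt.1 fun hlt =>
      hk (h.mem_wfilt_of_isDeriv (hb (u i)) _ _ (basis_mem_wfilt u a j) k hlt)
    have e3 : a i ≤ a k := not_lt.1 fun hlt => hk (by
      have := h.mem_wfilt_of_isDeriv (hb (u j)) _ _ (basis_mem_wfilt u a i) k hlt
      rw [hanti, map_neg, Finsupp.neg_apply, this, neg_zero])
    rcases max_cases (a i) 0 with h4 | h4 <;> rcases max_cases (a j) 0 with h5 | h5 <;>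
      rcases max_cases (a k) 0 with h6 | h6 <;> linarith
  refine absurd h1 (not_le.2 (Finset.sum_lt_sum (fun j _ => ?_) ⟨i, Finset.mem_univ i, ?_⟩))
  · rcases max_cases (a j) 0 with h4 | h4
    · rw [h4.1]
    · rw [h4.1]; nlinarith
  · rw [max_eq_right hi.le]; nlinarith

end OptimalTrace

section OrthonormalWeights

open Module

variable {W : Type*} [NormedAddCommGroup W] [InnerProductSpace ℝ W] [FiniteDimensional ℝ W]

theorem exists_orthonormalBasis_wfilt_eq {N : ℕ} (u : Basis (Fin N) ℝ W) {a : Fin N → ℝ}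
    (ha : Antitone a) : ∃ v : OrthonormalBasis (Fin N) ℝ W,
      ∀ t, wfilt v.toBasis a t = wfilt u a t := by
  have hN : finrank ℝ W = Fintype.card (Fin N) := finrank_eq_card_basis u
  let v := InnerProductSpace.gramSchmidtOrthonormalBasis hN u
  have hspan : ∀ i, Submodule.span ℝ (v '' Set.Iic i) = Submodule.span ℝ (u '' Set.Iic i) := by
    intro i
    have e : ∀ j, v j = InnerProductSpace.gramSchmidtNormed ℝ u j := fun j =>
      InnerProductSpace.gramSchmidtOrthonormalBasis_apply hN
        (norm_ne_zero_iff.1 (by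
          rw [InnerProductSpace.gramSchmidtNormed_unit_length j u.linearIndependent]
          exact one_ne_zero))
    rw [show (v : Fin N → W) = InnerProductSpace.gramSchmidtNormed ℝ u from funext e,
      InnerProductSpace.span_gramSchmidtNormed, InnerProductSpace.span_gramSchmidt_Iic]
  refine ⟨v, fun t => le_antisymm (wfilt_le_of_basis_mem (fun i => ?_) t)
    (wfilt_le_of_basis_mem (fun i => ?_) t)⟩
  · have h1 : v i ∈ Submodule.span ℝ (u '' Set.Iic i) := by
      rw [← hspan]
      exact Submodule.subset_span ⟨i, le_refl i, rfl⟩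
    rw [v.coe_toBasis]
    refine (Submodule.span_le.2 ?_) h1
    rintro _ ⟨j, hj, rfl⟩
    exact wfilt_anti u a (ha hj) (basis_mem_wfilt u a j)
  · have h1 : u i ∈ Submodule.span ℝ (v '' Set.Iic i) := by
      rw [hspan]
      exact Submodule.subset_span ⟨i, le_refl i, rfl⟩
    refine (Submodule.span_le.2 ?_) h1
    rintro _ ⟨j, hj, rfl⟩
    have := basis_mem_wfilt v.toBasis a j
    rw [v.coe_toBasis] at this
    exact wfilt_anti v.toBasis a (ha hj) this

/-- A metric Lie algebra carries an orthonormal basis with non-negative weights for which brackets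
and derivations are upper triangular and every derivation has non-negative trace defect. -/
theorem exists_orthonormal_weights (b : W →ₗ[ℝ] W →ₗ[ℝ] W) (hb : ∀ x, IsDeriv b (b x))
    (hanti : ∀ x y, b x y = - b y x) :
    ∃ (N : ℕ) (v : OrthonormalBasis (Fin N) ℝ W) (w : Fin N → ℝ), (∀ i, 0 ≤ w i) ∧
      (∀ i j k, ⟪v k, b (v i) (v j)⟫ ≠ 0 → w i + w j ≤ w k) ∧
      (∀ δ, IsDeriv b δ → (∀ i j, ⟪v j, δ (v i)⟫ ≠ 0 → w i ≤ w j) ∧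
        ∑ i, ⟪v i, δ (v i)⟫ ≤ ∑ i, w i * ⟪v i, δ (v i)⟫) ∧
      ∑ i, w i ^ 2 = ∑ i, w i := by
  obtain ⟨u, a, h⟩ := exists_isOptimal b (finBasis ℝ W)
  obtain ⟨v, hv⟩ := exists_orthonormalBasis_wfilt_eq u h.anti
  have hr : ∀ x i, v.toBasis.repr x i = ⟪v i, x⟫ := fun x i => by
    rw [v.coe_toBasis_repr_apply, v.repr_apply_apply]
  refine ⟨_, v, a, h.nonneg hb hanti, fun i j k hk => ?_, fun δ hδ => ⟨fun i j hij => ?_, ?_⟩,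
    h.sum_sq⟩
  · have := (isMultFilt_iff b v.toBasis a).1 ((isMultFilt_congr hv).2 h.mult) i j k
    rw [hr, v.coe_toBasis] at this
    exact this hk
  · have h1 := basis_mem_wfilt v.toBasis a i
    rw [hv] at h1
    have h2 := h.mem_wfilt_of_isDeriv hδ _ _ h1
    rw [← hv, v.coe_toBasis] at h2
    by_contra hlt
    exact hij (by rw [← hr]; exact h2 j (not_le.1 hlt))
  · have h1 := h.sum_mul_repr_nonneg hδ
    rw [weighted_trace_eq u v.toBasis a a (fun t => (hv t).symm) δ
      (fun t y hy => h.mem_wfilt_of_isDeriv hδ t y hy) (fun r => r - 1)] at h1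
    simp only [hr, v.coe_toBasis, sub_mul, one_mul, Finset.sum_sub_distrib] at h1
    linarith

end OrthonormalWeights

section SolvableAction

open Module Polynomial

theorem isNilpotent_of_trace_mul_eq_zero {V : Type*} [AddCommGroup V] [Module ℝ V]
    [FiniteDimensional ℝ V] (f : Module.End ℝ V)
    (h : ∀ p : ℝ[X], LinearMap.trace ℝ V (aeval f p * f) = 0) : IsNilpotent f := by
  obtain ⟨g, hg, hnd⟩ := exists_eq_pow_rootMultiplicity_mul_and_not_dvd (minpoly ℝ f)
    (minpoly.ne_zero (Algebra.IsIntegral.isIntegral f)) 0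
  set r := rootMultiplicity 0 (minpoly ℝ f)
  rw [C_0, sub_zero] at hg hnd
  have hcop : IsCoprime (X ^ (r + 1)) g :=
    IsCoprime.pow_left ((Irreducible.coprime_iff_not_dvd irreducible_X).2 hnd)
  obtain ⟨a, b, hab⟩ := hcop
  have hmin : aeval f (X ^ r * g) = 0 := by rw [← hg]; exact minpoly.aeval ℝ f
  have e1 : aeval f (a * X ^ (r + 1)) + aeval f (b * g) = 1 := by
    rw [← map_add, hab, map_one]
  have e2 : aeval f (a * X ^ (r + 1)) * aeval f (b * g) = 0 := by
    rw [← map_mul, show a * X ^ (r + 1) * (b * g) = (a * X * b) * (X ^ r * g) by ring, map_mul, hmin,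
      mul_zero]
  have hid : IsIdempotentElem (aeval f (a * X ^ (r + 1))) := by
    have := congrArg (fun z => aeval f (a * X ^ (r + 1)) * z) e1
    simp only [mul_add, e2, add_zero, mul_one] at this
    exact this
  have htr : LinearMap.trace ℝ V (aeval f (a * X ^ (r + 1))) = 0 := by
    rw [show a * X ^ (r + 1) = (a * X ^ r) * X by ring, map_mul, aeval_X]
    exact h _
  have h0 := (LinearMap.IsIdempotentElem.trace_eq_zero_iff hid).1 htr
  rw [h0, zero_add] at e1
  refine ⟨r, ?_⟩
  have e3 : f ^ r = aeval f (X ^ r : ℝ[X]) := by rw [map_pow, aeval_X]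
  rw [← mul_one (f ^ r), ← e1, e3, ← map_mul,
    show X ^ r * (b * g) = b * (X ^ r * g) by ring, map_mul, hmin, mul_zero]

theorem commute_aeval {R : Type*} [Ring R] [Algebra ℝ R] {f g : R} (h : Commute f g) (p : ℝ[X]) :
    Commute (aeval f p) g := by
  induction p using Polynomial.induction_on' with
  | add p q hp hq => rw [map_add]; exact hp.add_left hq
  | monomial n a =>
    rw [aeval_monomial]
    exact (Algebra.commute_algebraMap_left a g).mul_left (h.pow_left n)

theorem exists_mem_ker_of_isNilpotent {V : Type*} [AddCommGroup V] [Module ℝ V]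
    {f : Module.End ℝ V} (hf : IsNilpotent f) {p : Submodule ℝ V} (hp : p ≠ ⊥)
    (hinv : ∀ v ∈ p, f v ∈ p) : ∃ v ∈ p, v ≠ 0 ∧ f v = 0 := by
  by_contra hcon
  push Not at hcon
  obtain ⟨v, hv, hv0⟩ := Submodule.exists_mem_ne_zero_of_ne_bot hp
  have : ∀ n, (f ^ n) v ∈ p ∧ (f ^ n) v ≠ 0 := by
    intro n
    induction n with
    | zero => exact ⟨hv, hv0⟩
    | succ n ih =>
      rw [pow_succ', End.mul_apply]
      exact ⟨hinv _ ih.1, hcon _ ih.1 ih.2⟩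
  obtain ⟨n, hn⟩ := hf
  exact (this n).2 (by rw [hn, LinearMap.zero_apply])

theorem exists_minimal_invariant {V : Type*} [AddCommGroup V] [Module ℝ V]
    [FiniteDimensional ℝ V] (S : Set (Module.End ℝ V)) (q : Submodule ℝ V) (hq : q ≠ ⊥)
    (hinv : ∀ f ∈ S, ∀ v ∈ q, f v ∈ q) :
    ∃ p : Submodule ℝ V, p ≠ ⊥ ∧ p ≤ q ∧ (∀ f ∈ S, ∀ v ∈ p, f v ∈ p) ∧
      ∀ p' : Submodule ℝ V, p' ≤ p → (∀ f ∈ S, ∀ v ∈ p', f v ∈ p') → p' = ⊥ ∨ p' = p := by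
  obtain ⟨p, hp, hmin⟩ := WellFounded.has_min (wellFounded_lt (α := Submodule ℝ V))
    {p | p ≠ ⊥ ∧ p ≤ q ∧ ∀ f ∈ S, ∀ v ∈ p, f v ∈ p} ⟨q, hq, le_rfl, hinv⟩
  refine ⟨p, hp.1, hp.2.1, hp.2.2, fun p' hp' hinv' => ?_⟩
  by_contra hcon
  push Not at hcon
  exact hmin p' ⟨hcon.1, hp'.trans hp.2.1, hinv'⟩ (lt_of_le_of_ne hp' hcon.2)

/-- Operators representing a solvable bracket commute on an irreducible space. -/
theorem commute_of_irreducible {V : Type*} [AddCommGroup V] [Module ℝ V] [FiniteDimensional ℝ V]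
    {G : Type*} (ρ : G → Module.End ℝ V) (β : G → G → G)
    (hρ : ∀ x y, ρ (β x y) = ρ x * ρ y - ρ y * ρ x) (A : ℕ → Set G)
    (h0 : ∀ x, x ∈ A 0) (h1 : ∀ i, ∀ x ∈ A i, ∀ y ∈ A i, β x y ∈ A (i + 1))
    (h2 : ∀ i x, ∀ y ∈ A i, β x y ∈ A i) (k : ℕ) (hk : ∀ x ∈ A k, ρ x = 0)
    (hirr : ∀ p : Submodule ℝ V, (∀ x, ∀ v ∈ p, ρ x v ∈ p) → p = ⊥ ∨ p = ⊤) (x y : G) :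
    Commute (ρ x) (ρ y) := by
  rcases subsingleton_or_nontrivial V with hV | hV
  · exact Subsingleton.elim _ _
  suffices key : ∀ j i, i + j = k → ∀ x, ∀ a ∈ A i, Commute (ρ x) (ρ a) from
    key k 0 (zero_add k) x y (h0 y)
  intro j
  induction j with
  | zero =>
    intro i hi x a ha
    rw [add_zero] at hi
    subst hi
    rw [hk a ha]
    exact Commute.zero_right _
  | succ j ih =>
    intro i hi
    have hc := ih (i + 1) (by omega)
    have htr : ∀ x a, ∀ g : Module.End ℝ V, Commute g (ρ a) →
        LinearMap.trace ℝ V (g * (ρ x * ρ a - ρ a * ρ x)) = 0 := by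
      intro x a g hg
      rw [mul_sub, map_sub, sub_eq_zero, ← mul_assoc, LinearMap.trace_mul_comm, ← mul_assoc,
        ← mul_assoc, hg.eq]
    have hab : ∀ a ∈ A i, ∀ a' ∈ A i, Commute (ρ a) (ρ a') := by
      intro a ha a' ha'
      have hw : ∀ z, Commute (ρ a * ρ a' - ρ a' * ρ a) (ρ z) := fun z => by
        rw [← hρ]
        exact (hc z _ (h1 i a ha a' ha')).symm
      have hnil : IsNilpotent (ρ a * ρ a' - ρ a' * ρ a) :=
        isNilpotent_of_trace_mul_eq_zero _ fun p => htr _ _ _ (commute_aeval (hw a') p)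
      obtain ⟨v, -, hv0, hv⟩ := exists_mem_ker_of_isNilpotent hnil (p := ⊤) top_ne_bot
        fun _ _ => Submodule.mem_top
      rcases hirr (LinearMap.ker (ρ a * ρ a' - ρ a' * ρ a)) (fun z v hv => by
        rw [LinearMap.mem_ker] at hv ⊢
        rw [← End.mul_apply, (hw z).eq, End.mul_apply, hv, map_zero]) with h | h
      · exact absurd ((Submodule.mem_bot ℝ).1 (h ▸ LinearMap.mem_ker.2 hv)) hv0
      · exact sub_eq_zero.1 (LinearMap.ker_eq_top.1 h)
    let B : Submodule ℝ (Module.End ℝ V) :=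
      Submodule.span ℝ {f | ∃ x, ∃ a ∈ A i, f = ρ x * ρ a - ρ a * ρ x}
    have hB1 : ∀ f ∈ B, ∀ a ∈ A i, Commute f (ρ a) := by
      intro f hf a ha
      induction hf using Submodule.span_induction with
      | zero => exact Commute.zero_left _
      | add f g _ _ hf hg => exact hf.add_left hg
      | smul r f _ hf => exact hf.smul_left r
      | mem f hf =>
        obtain ⟨x, a', ha', rfl⟩ := hf
        rw [← hρ]
        exact hab _ (h2 i x a' ha') _ ha
    have hB2 : ∀ f ∈ B, ∀ g : Module.End ℝ V, (∀ a ∈ A i, Commute g (ρ a)) →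
        LinearMap.trace ℝ V (g * f) = 0 := by
      intro f hf g hg
      induction hf using Submodule.span_induction with
      | zero => rw [mul_zero, map_zero]
      | add f f' _ _ hf hf' => rw [mul_add, map_add, hf, hf', add_zero]
      | smul r f _ hf => rw [mul_smul_comm, map_smul, hf, smul_zero]
      | mem f hf =>
        obtain ⟨x, a', ha', rfl⟩ := hf
        exact htr _ _ _ (hg _ ha')
    have hB3 : ∀ f ∈ B, IsNilpotent f := fun f hf =>
      isNilpotent_of_trace_mul_eq_zero f fun p => hB2 f hf _ fun a ha =>
        commute_aeval (hB1 f hf a ha) p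
    have hB4 : ∀ f ∈ B, ∀ x, f * ρ x - ρ x * f ∈ B := by
      intro f hf x
      induction hf using Submodule.span_induction with
      | zero => simp
      | add f f' _ _ hf hf' =>
        rw [show (f + f') * ρ x - ρ x * (f + f') = (f * ρ x - ρ x * f) + (f' * ρ x - ρ x * f') by
          noncomm_ring]
        exact B.add_mem hf hf'
      | smul r f _ hf =>
        rw [smul_mul_assoc, mul_smul_comm, ← smul_sub]
        exact B.smul_mem r hf
      | mem f hf =>
        obtain ⟨y, a, ha, rfl⟩ := hf
        rw [← hρ, ← neg_sub]
        exact B.neg_mem (Submodule.subset_span ⟨x, _, h2 i y a ha, rfl⟩)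
    obtain ⟨p, hp, -, hpinv, hpmin⟩ := exists_minimal_invariant (ρ '' A i) ⊤ top_ne_bot
      fun _ _ _ _ => Submodule.mem_top
    have hBp : ∀ f ∈ B, ∀ v ∈ p, f v ∈ p := by
      intro f hf v hv
      induction hf using Submodule.span_induction with
      | zero => exact p.zero_mem
      | add f f' _ _ hf hf' => exact p.add_mem hf hf'
      | smul r f _ hf => exact p.smul_mem r hf
      | mem f hf =>
        obtain ⟨y, a, ha, rfl⟩ := hf
        rw [← hρ]
        exact hpinv _ ⟨_, h2 i y a ha, rfl⟩ v hv
    have hker : ∀ f ∈ B, ∀ v ∈ p, f v = 0 := by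
      intro f hf
      obtain ⟨v, hv, hv0, hfv⟩ := exists_mem_ker_of_isNilpotent (hB3 f hf) hp (hBp f hf)
      rcases hpmin (p ⊓ LinearMap.ker f) inf_le_left (by
        rintro _ ⟨a, ha, rfl⟩ v ⟨hv, hv'⟩
        refine ⟨hpinv _ ⟨a, ha, rfl⟩ v hv, ?_⟩
        rw [SetLike.mem_coe, LinearMap.mem_ker] at hv' ⊢
        rw [← End.mul_apply, (hB1 f hf a ha).eq, End.mul_apply, hv', map_zero]) with h | h
      · exact absurd ((Submodule.mem_bot ℝ).1 (h ▸ ⟨hv, LinearMap.mem_ker.2 hfv⟩)) hv0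
      · exact fun v hv => LinearMap.mem_ker.1 (h.symm.le hv).2
    let K : Submodule ℝ V := ⨅ f ∈ B, LinearMap.ker f
    have hK : ∀ v, v ∈ K ↔ ∀ f ∈ B, f v = 0 := fun v => by simp [K]
    have hKtop : K = ⊤ := by
      refine (hirr K fun x v hv => (hK _).2 fun f hf => ?_).resolve_left fun h => ?_
      · have h3 := (hK v).1 hv _ (hB4 f hf x)
        rwa [LinearMap.sub_apply, End.mul_apply, End.mul_apply, (hK v).1 hv f hf, map_zero,
          sub_zero] at h3
      · exact hp (le_bot_iff.1 (h ▸ fun v hv => (hK v).2 fun f hf => hker f hf v hv))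
    intro x a ha
    refine sub_eq_zero.1 (LinearMap.ext fun v => ?_)
    exact (hK v).1 (hKtop ▸ Submodule.mem_top) _ (Submodule.subset_span ⟨x, a, ha, rfl⟩)

/-- The decreasing chain of subspaces obtained by applying a set of operators repeatedly. -/
def actSeries {V : Type*} [AddCommGroup V] [Module ℝ V] (S : Set (Module.End ℝ V)) :
    ℕ → Submodule ℝ V
  | 0 => ⊤
  | k + 1 => Submodule.span ℝ {z | ∃ f ∈ S, ∃ v ∈ actSeries S k, f v = z}

/-- Commutators of operators representing a solvable bracket act nilpotently. -/
theorem exists_actSeries_eq_bot {G : Type*} (β : G → G → G) (A : ℕ → Set G)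
    (h0 : ∀ x, x ∈ A 0) (h1 : ∀ i, ∀ x ∈ A i, ∀ y ∈ A i, β x y ∈ A (i + 1))
    (h2 : ∀ i x, ∀ y ∈ A i, β x y ∈ A i) (k : ℕ) (n : ℕ) :
    ∀ {V : Type*} [AddCommGroup V] [Module ℝ V] [FiniteDimensional ℝ V]
    (ρ : G → Module.End ℝ V) (_ : ∀ x y, ρ (β x y) = ρ x * ρ y - ρ y * ρ x)
    (_ : ∀ x ∈ A k, ρ x = 0), finrank ℝ V = n →
    ∃ m, actSeries {f | ∃ x y, f = ρ (β x y)} m = ⊥ := by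
  induction n using Nat.strong_induction_on with
  | _ n ih =>
  intro V _ _ _ ρ hρ hk hn
  rcases subsingleton_or_nontrivial V with hV | hV
  · exact ⟨0, Subsingleton.elim _ _⟩
  obtain ⟨p, hp, -, hpinv, hpmin⟩ := exists_minimal_invariant (Set.range ρ) ⊤ top_ne_bot
    fun _ _ _ _ => Submodule.mem_top
  have hinv : ∀ x, p ≤ p.comap (ρ x) := fun x v hv => hpinv _ ⟨x, rfl⟩ v hv
  let ρ₁ : G → Module.End ℝ p := fun x => (ρ x).restrict (hinv x)
  let ρ₂ : G → Module.End ℝ (V ⧸ p) := fun x => p.mapQ p (ρ x) (hinv x)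
  have hfr : finrank ℝ (V ⧸ p) < n := by
    have e1 := p.finrank_quotient_add_finrank
    have e2 := Submodule.one_le_finrank_iff.2 hp
    omega
  obtain ⟨m, hm⟩ := ih _ hfr ρ₂ (fun x y => by
      refine LinearMap.ext fun v => ?_
      obtain ⟨v, rfl⟩ := p.mkQ_surjective v
      simp [ρ₂, hρ]) (fun x hx => by
      refine LinearMap.ext fun v => ?_
      obtain ⟨v, rfl⟩ := p.mkQ_surjective v
      simp [ρ₂, hk x hx]) rfl
  have hcomm : ∀ x y, Commute (ρ₁ x) (ρ₁ y) := by
    refine commute_of_irreducible ρ₁ β (fun x y => ?_) A h0 h1 h2 k (fun x hx => ?_) ?_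
    · refine LinearMap.ext fun v => Subtype.ext ?_
      simp [ρ₁, hρ]
    · refine LinearMap.ext fun v => Subtype.ext ?_
      simp [ρ₁, hk x hx]
    · intro q hq
      rcases hpmin (q.map p.subtype) (Submodule.map_subtype_le p q) (by
        rintro _ ⟨x, rfl⟩ _ ⟨v, hv, rfl⟩
        exact ⟨ρ₁ x v, hq x v hv, rfl⟩) with h | h
      · left; exact Submodule.map_injective_of_injective p.injective_subtype (by rw [h, Submodule.map_bot])
      · right
        refine Submodule.map_injective_of_injective p.injective_subtype ?_
        rw [h, Submodule.map_top, Submodule.range_subtype]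
  have hzero : ∀ x y, ∀ v ∈ p, ρ (β x y) v = 0 := by
    intro x y v hv
    have := congrArg Subtype.val (LinearMap.congr_fun (sub_eq_zero.2 (hcomm x y).eq) ⟨v, hv⟩)
    rw [hρ]
    simpa [ρ₁] using this
  have hquot : ∀ i, ∀ v ∈ actSeries {f | ∃ x y, f = ρ (β x y)} i,
      p.mkQ v ∈ actSeries {f | ∃ x y, f = ρ₂ (β x y)} i := by
    intro i
    induction i with
    | zero => exact fun _ _ => Submodule.mem_top
    | succ i ih =>
      intro v hv
      refine (Submodule.span_le (p := (actSeries {f | ∃ x y, f = ρ₂ (β x y)} (i + 1)).comap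
        p.mkQ)).2 ?_ hv
      rintro _ ⟨_, ⟨x, y, rfl⟩, w, hw, rfl⟩
      exact Submodule.subset_span ⟨_, ⟨x, y, rfl⟩, _, ih w hw, rfl⟩
  refine ⟨m + 1, le_bot_iff.1 (Submodule.span_le.2 ?_)⟩
  rintro _ ⟨_, ⟨x, y, rfl⟩, w, hw, rfl⟩
  have h3 := hquot m w hw
  rw [hm, Submodule.mem_bot, Submodule.mkQ_apply, Submodule.Quotient.mk_eq_zero] at h3
  exact hzero x y w h3

end SolvableAction

section NilradicalContains

variable {E : Type*} [AddCommGroup E] [Module ℝ E] {μ : E →ₗ[ℝ] E →ₗ[ℝ] E}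

theorem IsLieBracket.antisymm (h : IsLieBracket μ) (x y : E) : μ x y = -μ y x := by
  have := h.1 (x + y)
  simp only [map_add, LinearMap.add_apply, h.1, zero_add, add_zero] at this
  rw [eq_neg_iff_add_eq_zero, add_comm]
  exact this

theorem IsLieBracket.isDeriv (h : IsLieBracket μ) (x : E) : IsDeriv μ (μ x) := h.2 x

theorem IsDeriv.apply_mem_derSeries {D : E →ₗ[ℝ] E} (hD : IsDeriv μ D) (i : ℕ) :
    ∀ x ∈ derSeries μ i, D x ∈ derSeries μ i := by
  induction i with
  | zero => exact fun _ _ => Submodule.mem_top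
  | succ i ih =>
    intro x hx
    refine (Submodule.span_le (p := (derSeries μ (i + 1)).comap D)).2 ?_ hx
    rintro _ ⟨a, ha, b, hb, rfl⟩
    change D (μ a b) ∈ derSeries μ (i + 1)
    rw [hD]
    exact Submodule.add_mem _ (Submodule.subset_span ⟨_, ih a ha, b, hb, rfl⟩)
      (Submodule.subset_span ⟨a, ha, _, ih b hb, rfl⟩)

theorem IsDeriv.apply_mem_lcsOn {D : E →ₗ[ℝ] E} (hD : IsDeriv μ D) {p : Submodule ℝ E}
    (hp : ∀ x ∈ p, D x ∈ p) (i : ℕ) : ∀ x ∈ lcsOn μ p i, D x ∈ lcsOn μ p i := by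
  induction i with
  | zero => exact hp
  | succ i ih =>
    intro x hx
    refine (Submodule.span_le (p := (lcsOn μ p (i + 1)).comap D)).2 ?_ hx
    rintro _ ⟨a, ha, b, hb, rfl⟩
    change D (μ a b) ∈ lcsOn μ p (i + 1)
    rw [hD]
    exact Submodule.add_mem _ (Submodule.subset_span ⟨_, hp a ha, b, hb, rfl⟩)
      (Submodule.subset_span ⟨a, ha, _, ih b hb, rfl⟩)

/-- If `X` lies in the nilpotent ideal `n ⊇ [E, E]` and `f` preserves the lower central series of
`n`, then `f ∘ ad X` has trace zero. -/
theorem trace_comp_eq_zero_of_mem {n : Submodule ℝ E} (hnil : IsNilpotentOn μ n)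
    (hbr : ∀ x y, μ x y ∈ n) {f : E →ₗ[ℝ] E} (hf : ∀ i, ∀ x ∈ lcsOn μ n i, f x ∈ lcsOn μ n i)
    {X : E} (hX : X ∈ n) : LinearMap.trace ℝ E (f ∘ₗ μ X) = 0 := by
  obtain ⟨k, hk⟩ := hnil
  have h : ∀ i v, ((f ∘ₗ μ X) ^ (i + 1)) v ∈ lcsOn μ n i := by
    intro i v
    induction i with
    | zero => simpa using hf 0 _ (hbr X v)
    | succ i ih =>
      rw [pow_succ', Module.End.mul_apply]
      exact hf _ _ (Submodule.subset_span ⟨X, hX, _, ih, rfl⟩)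
  refine IsNilpotent.eq_zero (LinearMap.isNilpotent_trace_of_isNilpotent ⟨k + 1, ?_⟩)
  refine LinearMap.ext fun v => ?_
  have := h k v
  rwa [hk, Submodule.mem_bot] at this

variable [FiniteDimensional ℝ E]

/-- Every derivation of a solvable Lie algebra takes values in the nilradical. -/
theorem IsNilradical.deriv_mem (hLie : IsLieBracket μ) (hsolv : IsSolvableB μ)
    {n : Submodule ℝ E} (hn : IsNilradical μ n) {D : E →ₗ[ℝ] E} (hD : IsDeriv μ D) (x : E) :
    D x ∈ n := by
  obtain ⟨k, hk⟩ := hsolv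
  let β : E × ℝ → E × ℝ → E × ℝ := fun g h => (μ g.1 h.1 + g.2 • D h.1 - h.2 • D g.1, 0)
  let ρ : E × ℝ → Module.End ℝ E := fun g => μ g.1 + g.2 • D
  let A : ℕ → Set (E × ℝ) := fun i =>
    match i with
    | 0 => Set.univ
    | i + 1 => {g | g.1 ∈ derSeries μ i ∧ g.2 = 0}
  have hρ : ∀ g h, ρ (β g h) = ρ g * ρ h - ρ h * ρ g := by
    intro g h
    refine LinearMap.ext fun v => ?_
    simp only [ρ, β, map_add, map_sub, map_smul, LinearMap.add_apply, LinearMap.sub_apply,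
      LinearMap.smul_apply, Module.End.mul_apply, zero_smul, add_zero, hD _ _, hLie.2 g.1 h.1 v,
      smul_add, smul_comm g.2 h.2]
    abel
  obtain ⟨m, hm⟩ := exists_actSeries_eq_bot β A (fun _ => Set.mem_univ _) (by
    rintro (_ | i) g hg h hh
    · exact ⟨Submodule.mem_top, rfl⟩
    · refine ⟨?_, rfl⟩
      simp only [β, hg.2, hh.2, zero_smul, add_zero, sub_zero]
      exact Submodule.subset_span ⟨_, hg.1, _, hh.1, rfl⟩) (by
    rintro (_ | i) g h hh
    · exact Set.mem_univ _
    · refine ⟨?_, rfl⟩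
      simp only [β, hh.2, zero_smul, sub_zero]
      exact Submodule.add_mem _ ((hLie.isDeriv _).apply_mem_derSeries i _ hh.1)
        (Submodule.smul_mem _ _ (hD.apply_mem_derSeries i _ hh.1))) (k + 1) _ ρ hρ (by
    rintro g ⟨hg, hg'⟩
    rw [hk, Submodule.mem_bot] at hg
    simp only [ρ, hg, hg', map_zero, zero_smul, add_zero]) rfl
  let J : Submodule ℝ E := Submodule.span ℝ {z | ∃ g h, (β g h).1 = z}
  have hJ : IsIdeal μ J := by
    intro X Y hY
    exact Submodule.subset_span ⟨(X, 0), (Y, 0), by simp [β]⟩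
  have hle : ∀ i, lcsOn μ J i ≤ actSeries {f | ∃ x y, f = ρ (β x y)} i := by
    intro i
    induction i with
    | zero => exact le_top
    | succ i ih =>
      refine Submodule.span_le.2 ?_
      rintro _ ⟨x, hx, y, hy, rfl⟩
      refine (Submodule.span_le (p := (actSeries {f | ∃ x y, f = ρ (β x y)} (i + 1)).comap
        (μ.flip y))).2 ?_ hx
      rintro _ ⟨g, h, rfl⟩
      refine Submodule.subset_span ⟨_, ⟨g, h, rfl⟩, y, ih hy, ?_⟩
      simp [ρ, β]
  refine hn.2.2 J hJ ⟨m, le_bot_iff.1 (hm ▸ hle m)⟩ (Submodule.subset_span ⟨(0, 1), (x, 0), ?_⟩)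
  simp [β]

/-- The derived algebra of a solvable Lie algebra lies in the nilradical. -/
theorem IsNilradical.bracket_mem (hLie : IsLieBracket μ) (hsolv : IsSolvableB μ)
    {n : Submodule ℝ E} (hn : IsNilradical μ n) (x y : E) : μ x y ∈ n :=
  hn.deriv_mem hLie hsolv (hLie.isDeriv x) y

end NilradicalContains

section Contraction

open Module

variable {E : Type*} [NormedAddCommGroup E] [InnerProductSpace ℝ E]
  {F : Type*} [NormedAddCommGroup F] [InnerProductSpace ℝ F]
  {ι κ : Type*} [Fintype ι] [Fintype κ]

/-- Contracting a bilinear form with an orthonormal family amounts to contracting its restriction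
to the spanned subspace with an orthonormal basis of the whole space. -/
theorem Orthonormal.sum_inner_map_proj {u : κ → E} (hu : Orthonormal ℝ u)
    (v : OrthonormalBasis ι ℝ E) (f g : E →ₗ[ℝ] F) :
    ∑ j, ⟪f (∑ i, ⟪u i, v j⟫ • u i), g (∑ i, ⟪u i, v j⟫ • u i)⟫ = ∑ i, ⟪f (u i), g (u i)⟫ := by
  classical
  simp only [map_sum, map_smul, sum_inner, inner_sum, real_inner_smul_left, real_inner_smul_right]
  rw [Finset.sum_comm]
  refine Finset.sum_congr rfl fun i _ => ?_
  rw [Finset.sum_comm]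
  have h : ∀ k, ∑ j, ⟪u i, v j⟫ * (⟪u k, v j⟫ * ⟪f (u k), g (u i)⟫) =
      (if k = i then 1 else 0) * ⟪f (u k), g (u i)⟫ := by
    intro k
    rw [← orthonormal_iff_ite.1 hu k i, ← v.sum_inner_mul_inner, Finset.sum_mul]
    refine Finset.sum_congr rfl fun j _ => ?_
    rw [real_inner_comm (u i)]
    ring
  simp [h]

theorem OrthonormalBasis.sum_inner_map_eq (u : OrthonormalBasis κ ℝ E)
    (v : OrthonormalBasis ι ℝ E) (f g : E →ₗ[ℝ] F) :
    ∑ i, ⟪f (u i), g (u i)⟫ = ∑ j, ⟪f (v j), g (v j)⟫ := by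
  rw [← u.orthonormal.sum_inner_map_proj v]
  simp only [u.sum_repr']

variable [FiniteDimensional ℝ E]

theorem inner_transp_left (f : E →ₗ[ℝ] E) (x y : E) : ⟪transp f x, y⟫ = ⟪x, f y⟫ :=
  LinearMap.adjoint_inner_left f y x

theorem inner_transp_right (f : E →ₗ[ℝ] E) (x y : E) : ⟪x, transp f y⟫ = ⟪f x, y⟫ :=
  LinearMap.adjoint_inner_right f x y

theorem eq_transp_iff {f g : E →ₗ[ℝ] E} : f = transp g ↔ ∀ x y, ⟪f x, y⟫ = ⟪x, g y⟫ :=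
  LinearMap.eq_adjoint_iff f g

@[simp] theorem transp_transp (f : E →ₗ[ℝ] E) : transp (transp f) = f :=
  LinearMap.adjoint_adjoint f

theorem transp_comp (f g : E →ₗ[ℝ] E) : transp (f ∘ₗ g) = transp g ∘ₗ transp f :=
  LinearMap.adjoint_comp f g

@[simp] theorem transp_add (f g : E →ₗ[ℝ] E) : transp (f + g) = transp f + transp g :=
  map_add LinearMap.adjoint f g

@[simp] theorem transp_smul (c : ℝ) (f : E →ₗ[ℝ] E) : transp (c • f) = c • transp f := by
  simp [transp]

theorem transp_eq_self_iff {f : E →ₗ[ℝ] E} : transp f = f ↔ ∀ x y, ⟪f x, y⟫ = ⟪x, f y⟫ := by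
  rw [eq_comm, eq_transp_iff]

theorem trace_transp (f : E →ₗ[ℝ] E) :
    LinearMap.trace ℝ E (transp f) = LinearMap.trace ℝ E f := by
  rw [LinearMap.trace_eq_sum_inner _ (stdONB E), LinearMap.trace_eq_sum_inner _ (stdONB E)]
  exact Finset.sum_congr rfl fun i _ => by rw [inner_transp_right, real_inner_comm]

theorem trace_transp_comp (f g : E →ₗ[ℝ] E) :
    LinearMap.trace ℝ E (transp f ∘ₗ g) = ∑ i, ⟪f (stdONB E i), g (stdONB E i)⟫ := by
  rw [LinearMap.trace_eq_sum_inner _ (stdONB E)]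
  exact Finset.sum_congr rfl fun i _ => by rw [LinearMap.comp_apply, inner_transp_right]

theorem trace_transp_comp_self_nonneg (f : E →ₗ[ℝ] E) :
    0 ≤ LinearMap.trace ℝ E (transp f ∘ₗ f) := by
  rw [trace_transp_comp]
  exact Finset.sum_nonneg fun i _ => real_inner_self_nonneg

theorem eq_zero_of_trace_transp_comp_self {f : E →ₗ[ℝ] E}
    (h : LinearMap.trace ℝ E (transp f ∘ₗ f) = 0) : f = 0 := by
  rw [trace_transp_comp, Finset.sum_eq_zero_iff_of_nonneg fun i _ => real_inner_self_nonneg] at h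
  exact (stdONB E).toBasis.ext fun i => by
    simpa using h i (Finset.mem_univ i)

theorem sum_inner_map_transp (f g : E →ₗ[ℝ] F) (h : E →ₗ[ℝ] E) :
    ∑ i, ⟪f (h (stdONB E i)), g (stdONB E i)⟫ =
      ∑ i, ⟪f (stdONB E i), g (transp h (stdONB E i))⟫ := by
  have h1 : ∀ i, h (stdONB E i) = ∑ j, ⟪stdONB E j, h (stdONB E i)⟫ • stdONB E j := fun i =>
    ((stdONB E).sum_repr' _).symm
  have h2 : ∀ i, transp h (stdONB E i) = ∑ j, ⟪h (stdONB E j), stdONB E i⟫ • stdONB E j :=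
    fun i => by
      conv_lhs => rw [← (stdONB E).sum_repr' (transp h (stdONB E i))]
      simp only [inner_transp_right]
  refine (Finset.sum_congr rfl fun i _ => by rw [h1 i]).trans
    (Eq.trans ?_ (Finset.sum_congr rfl fun i _ => by rw [h2 i]))
  simp only [map_sum, map_smul, sum_inner, inner_sum, real_inner_smul_left, real_inner_smul_right]
  rw [Finset.sum_comm]
  exact Finset.sum_congr rfl fun i _ => Finset.sum_congr rfl fun j _ => by
    rw [real_inner_comm]

theorem projL_apply (p : Submodule ℝ E) (x : E) : projL p x = p.starProjection x := rfl

theorem projL_mem (p : Submodule ℝ E) (x : E) : projL p x ∈ p := by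
  rw [projL_apply]; exact Submodule.starProjection_apply_mem p x

theorem projL_of_mem {p : Submodule ℝ E} {x : E} (hx : x ∈ p) : projL p x = x := by
  rw [projL_apply]; exact Submodule.starProjection_eq_self_iff.2 hx

theorem projL_of_mem_orthogonal {p : Submodule ℝ E} {x : E} (hx : x ∈ pᗮ) : projL p x = 0 := by
  rw [projL_apply]; exact (Submodule.starProjection_apply_eq_zero_iff p).2 hx

theorem projL_add_projL_orthogonal (p : Submodule ℝ E) (x : E) :
    projL p x + projL pᗮ x = x := by
  simp only [projL_apply]; exact p.starProjection_add_starProjection_orthogonal x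

theorem inner_projL (p : Submodule ℝ E) (x y : E) : ⟪projL p x, y⟫ = ⟪x, projL p y⟫ := by
  simp only [projL_apply]; exact Submodule.inner_starProjection_left_eq_right p x y

@[simp] theorem transp_projL (p : Submodule ℝ E) : transp (projL p) = projL p :=
  transp_eq_self_iff.2 (inner_projL p)

theorem projL_comp_self (p : Submodule ℝ E) : projL p ∘ₗ projL p = projL p :=
  LinearMap.ext fun _ => projL_of_mem (projL_mem _ _)

theorem sum_inner_smul_of_orthonormalBasis {p : Submodule ℝ E} (u : OrthonormalBasis κ ℝ p)
    (x : E) : ∑ i, ⟪(u i : E), x⟫ • (u i : E) = projL p x := by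
  have := congrArg Subtype.val (u.sum_repr' (Submodule.orthogonalProjectionOnto p x))
  simp only [Submodule.coe_sum, Submodule.coe_smul, Submodule.coe_inner] at this
  rw [projL_apply, Submodule.starProjection_apply, ← this]
  refine Finset.sum_congr rfl fun i _ => ?_
  congr 1
  rw [← Submodule.starProjection_apply, ← projL_apply, ← inner_projL, projL_of_mem (u i).2]

theorem sum_inner_map_of_orthonormalBasis {p : Submodule ℝ E} (u : OrthonormalBasis κ ℝ p)
    (f g : E →ₗ[ℝ] F) : ∑ i, ⟪f (u i : E), g (u i : E)⟫ =
      ∑ i, ⟪f (projL p (stdONB E i)), g (projL p (stdONB E i))⟫ := by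
  refine ((u.orthonormal.comp_linearIsometry p.subtypeₗᵢ).sum_inner_map_proj (stdONB E)
    f g).symm.trans ?_
  refine Finset.sum_congr rfl fun j _ => ?_
  rw [← sum_inner_smul_of_orthonormalBasis u]
  rfl

theorem sum_inner_map_onbOf (p : Submodule ℝ E) (f g : E →ₗ[ℝ] F) :
    ∑ i, ⟪f (onbOf p i), g (onbOf p i)⟫ =
      ∑ i, ⟪f (projL p (stdONB E i)), g (projL p (stdONB E i))⟫ :=
  sum_inner_map_of_orthonormalBasis _ f g

theorem sum_inner_map_split (p : Submodule ℝ E) (f g : E →ₗ[ℝ] F) :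
    ∑ i, ⟪f (stdONB E i), g (stdONB E i)⟫ =
      ∑ i, ⟪f (projL p (stdONB E i)), g (projL p (stdONB E i))⟫ +
      ∑ i, ⟪f (projL pᗮ (stdONB E i)), g (projL pᗮ (stdONB E i))⟫ := by
  have h : ∀ q : Submodule ℝ E, ∑ i, ⟪f (projL q (stdONB E i)), g (projL q (stdONB E i))⟫ =
      ∑ i, ⟪f (projL q (stdONB E i)), g (stdONB E i)⟫ := by
    intro q
    refine (sum_inner_map_transp f (g ∘ₗ projL q) (projL q)).trans ?_
    refine Eq.trans ?_ (sum_inner_map_transp f g (projL q)).symm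
    refine Finset.sum_congr rfl fun i _ => ?_
    rw [transp_projL, LinearMap.comp_apply, projL_of_mem (projL_mem _ _)]
  rw [h, h, ← Finset.sum_add_distrib]
  refine Finset.sum_congr rfl fun i _ => ?_
  rw [← inner_add_left, ← map_add, projL_add_projL_orthogonal]

theorem inner_split (p : Submodule ℝ E) (x y : E) :
    ⟪x, y⟫ = ⟪projL p x, projL p y⟫ + ⟪projL pᗮ x, projL pᗮ y⟫ := by
  rw [inner_projL, inner_projL, projL_of_mem (projL_mem _ _), projL_of_mem (projL_mem _ _),
    ← inner_add_right, projL_add_projL_orthogonal]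

end Contraction

section RicciAlgebra

open Module

variable {E : Type*} [NormedAddCommGroup E] [InnerProductSpace ℝ E] [FiniteDimensional ℝ E]

/-- The linear map `X ↦ (ad X)ᵗ x`. -/
def coad (μ : E →ₗ[ℝ] E →ₗ[ℝ] E) (x : E) : E →ₗ[ℝ] E where
  toFun X := transp (μ X) x
  map_add' X Y := by simp
  map_smul' c X := by simp

variable (μ : E →ₗ[ℝ] E →ₗ[ℝ] E)

theorem inner_Rop (x y : E) : ⟪Rop μ x, y⟫ =
    -(1 / 2) * ∑ i, ⟪μ (stdONB E i) x, μ (stdONB E i) y⟫ +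
      (1 / 4) * ∑ i, ⟪transp (μ (stdONB E i)) x, transp (μ (stdONB E i)) y⟫ := by
  simp only [Rop, LinearMap.add_apply, LinearMap.smul_apply, LinearMap.sum_apply,
    LinearMap.comp_apply, inner_add_left, real_inner_smul_left, sum_inner, inner_transp_left,
    inner_transp_right]

theorem transp_Rop : transp (Rop μ) = Rop μ := by
  refine transp_eq_self_iff.2 fun x y => ?_
  rw [real_inner_comm (Rop μ y) x, inner_Rop, inner_Rop]
  simp only [real_inner_comm]

theorem inner_Bop (x y : E) : ⟪Bop μ x, y⟫ = LinearMap.trace ℝ E (μ x ∘ₗ μ y) := by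
  let L : E →ₗ[ℝ] ℝ := LinearMap.trace ℝ E ∘ₗ LinearMap.llcomp ℝ E E E (μ x) ∘ₗ μ
  change _ = L y
  conv_rhs => rw [← (stdONB E).sum_repr' y, map_sum]
  rw [Bop, LinearMap.sum_apply, sum_inner]
  refine Finset.sum_congr rfl fun i _ => ?_
  rw [map_smul, LinearMap.smulRight_apply, real_inner_smul_left, smul_eq_mul, mul_comm]
  rfl

theorem transp_Bop : transp (Bop μ) = Bop μ := by
  refine transp_eq_self_iff.2 fun x y => ?_
  rw [real_inner_comm (Bop μ y) x, inner_Bop, inner_Bop, LinearMap.trace_comp_comm']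

theorem inner_meanCurv (x : E) : ⟪meanCurv μ, x⟫ = LinearMap.trace ℝ E (μ x) := by
  conv_rhs => rw [← (stdONB E).sum_repr' x, map_sum, map_sum]
  rw [meanCurv, sum_inner]
  refine Finset.sum_congr rfl fun i _ => ?_
  rw [real_inner_smul_left, map_smul, map_smul, smul_eq_mul, mul_comm]

theorem transp_symPart (f : E →ₗ[ℝ] E) : transp (symPart f) = symPart f := by
  simp [symPart, add_comm]

omit [FiniteDimensional ℝ E] in
theorem piAct_apply (f : E →ₗ[ℝ] E) (x y : E) :
    piAct f μ x y = f (μ x y) - μ (f x) y - μ x (f y) := rfl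

omit [FiniteDimensional ℝ E] in
theorem isDeriv_iff_piAct_eq_zero {f : E →ₗ[ℝ] E} : IsDeriv μ f ↔ piAct f μ = 0 := by
  simp only [IsDeriv, LinearMap.ext_iff, piAct_apply, LinearMap.zero_apply, sub_sub, sub_eq_zero]

omit [FiniteDimensional ℝ E] in
theorem piAct_commutator (f g : E →ₗ[ℝ] E) :
    piAct (f ∘ₗ g - g ∘ₗ f) μ = piAct f (piAct g μ) - piAct g (piAct f μ) := by
  ext x y
  simp only [piAct_apply, LinearMap.sub_apply, LinearMap.comp_apply, map_sub]
  abel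

theorem binner_eq_sum {ι : Type*} [Fintype ι] (v : OrthonormalBasis ι ℝ E)
    (ν : E →ₗ[ℝ] E →ₗ[ℝ] E) : binner μ ν = ∑ i, ∑ j, ⟪μ (v i) (v j), ν (v i) (v j)⟫ := by
  rw [binner]
  simp only [fun i => (stdONB E).sum_inner_map_eq v (μ (stdONB E i)) (ν (stdONB E i))]
  rw [Finset.sum_comm]
  conv_rhs => rw [Finset.sum_comm]
  exact Finset.sum_congr rfl fun j _ =>
    (stdONB E).sum_inner_map_eq v (μ.flip (v j)) (ν.flip (v j))

theorem binner_self_nonneg : 0 ≤ binner μ μ :=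
  Finset.sum_nonneg fun _ _ => Finset.sum_nonneg fun _ _ => real_inner_self_nonneg

theorem eq_zero_of_binner_self (h : binner μ μ = 0) : μ = 0 := by
  rw [binner, Finset.sum_eq_zero_iff_of_nonneg fun _ _ =>
    Finset.sum_nonneg fun _ _ => real_inner_self_nonneg] at h
  refine (stdONB E).toBasis.ext fun i => (stdONB E).toBasis.ext fun j => ?_
  have := h i (Finset.mem_univ i)
  rw [Finset.sum_eq_zero_iff_of_nonneg fun _ _ => real_inner_self_nonneg] at this
  simpa using this j (Finset.mem_univ j)

theorem binner_piAct_left (f : E →ₗ[ℝ] E) (ν : E →ₗ[ℝ] E →ₗ[ℝ] E) :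
    binner (piAct f μ) ν = binner μ (piAct (transp f) ν) := by
  simp only [binner, piAct_apply, inner_sub_left, inner_sub_right, Finset.sum_sub_distrib,
    inner_transp_right]
  congr 1
  · congr 1
    rw [Finset.sum_comm]
    conv_rhs => rw [Finset.sum_comm]
    exact Finset.sum_congr rfl fun j _ =>
      sum_inner_map_transp (μ.flip (stdONB E j)) (ν.flip (stdONB E j)) f
  · exact Finset.sum_congr rfl fun i _ =>
      sum_inner_map_transp (μ (stdONB E i)) (ν (stdONB E i)) f

variable {μ}

omit [FiniteDimensional ℝ E] in
theorem trace_sum_comp {ι : Type*} [Fintype ι] (a : ι → E →ₗ[ℝ] E) (f : E →ₗ[ℝ] E) :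
    LinearMap.trace ℝ E ((∑ i, a i) ∘ₗ f) = ∑ i, LinearMap.trace ℝ E (a i ∘ₗ f) := by
  rw [← map_sum]
  congr 1
  ext x
  simp

theorem trace_Rop_comp (hμ : ∀ x y, μ x y = -μ y x) (f : E →ₗ[ℝ] E) :
    LinearMap.trace ℝ E (Rop μ ∘ₗ f) = (1 / 4) * binner (piAct f μ) μ := by
  have h1 : LinearMap.trace ℝ E (Rop μ ∘ₗ f) = -(1 / 2) * ∑ i, ∑ j,
      ⟪μ (stdONB E i) (f (stdONB E j)), μ (stdONB E i) (stdONB E j)⟫ +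
      (1 / 4) * ∑ i, ∑ j, ⟪f (μ (stdONB E i) (stdONB E j)), μ (stdONB E i) (stdONB E j)⟫ := by
    simp only [Rop, LinearMap.add_comp, LinearMap.smul_comp, trace_sum_comp, map_add,
      map_smul, smul_eq_mul]
    congr 2
    · refine Finset.sum_congr rfl fun i _ => ?_
      rw [LinearMap.comp_assoc, trace_transp_comp]
      exact Finset.sum_congr rfl fun j _ => real_inner_comm _ _
    · refine Finset.sum_congr rfl fun i _ => ?_
      rw [LinearMap.comp_assoc, LinearMap.trace_comp_comm', LinearMap.comp_assoc,
        trace_transp_comp]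
      exact Finset.sum_congr rfl fun j _ => real_inner_comm _ _
  have h2 : ∑ i, ∑ j, ⟪μ (f (stdONB E i)) (stdONB E j), μ (stdONB E i) (stdONB E j)⟫ =
      ∑ i, ∑ j, ⟪μ (stdONB E i) (f (stdONB E j)), μ (stdONB E i) (stdONB E j)⟫ := by
    rw [Finset.sum_comm]
    refine Finset.sum_congr rfl fun i _ => Finset.sum_congr rfl fun j _ => ?_
    rw [hμ (f _), hμ (stdONB E j), inner_neg_neg]
  rw [h1]
  simp only [binner, piAct_apply, inner_sub_left, Finset.sum_sub_distrib, h2]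
  ring

theorem trace_Rop_comp_of_isDeriv (hμ : ∀ x y, μ x y = -μ y x) {f : E →ₗ[ℝ] E}
    (hf : IsDeriv μ f) : LinearMap.trace ℝ E (Rop μ ∘ₗ f) = 0 := by
  rw [trace_Rop_comp hμ, (isDeriv_iff_piAct_eq_zero μ).1 hf]
  simp [binner]

theorem trace_Rop_comp_commutator (hμ : ∀ x y, μ x y = -μ y x) {f : E →ₗ[ℝ] E}
    (hf : IsDeriv μ f) (g : E →ₗ[ℝ] E) :
    LinearMap.trace ℝ E (Rop μ ∘ₗ (f ∘ₗ g - g ∘ₗ f)) =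
      (1 / 4) * binner (piAct g μ) (piAct (transp f) μ) := by
  have h0 : piAct g (0 : E →ₗ[ℝ] E →ₗ[ℝ] E) = 0 := by
    ext x y; simp [piAct_apply]
  rw [trace_Rop_comp hμ, piAct_commutator, (isDeriv_iff_piAct_eq_zero μ).1 hf, h0, sub_zero,
    binner_piAct_left]

theorem trace_Rop_comp_normal (hμ : ∀ x y, μ x y = -μ y x) {f : E →ₗ[ℝ] E}
    (hf : IsDeriv μ f) : 0 ≤
    LinearMap.trace ℝ E (Rop μ ∘ₗ (f ∘ₗ transp f - transp f ∘ₗ f)) := by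
  rw [trace_Rop_comp_commutator hμ hf]
  have := binner_self_nonneg (piAct (transp f) μ)
  positivity

end RicciAlgebra

section IdealDecomposition

open Module

variable {E : Type*} [NormedAddCommGroup E] [InnerProductSpace ℝ E] [FiniteDimensional ℝ E]

/-- The bracket restricted to `p`, extended by zero on `pᗮ`. -/
def restrictB (μ : E →ₗ[ℝ] E →ₗ[ℝ] E) (p : Submodule ℝ E) : E →ₗ[ℝ] E →ₗ[ℝ] E :=
  μ.compl₁₂ (projL p) (projL p)

/-- The operators `ad Xᵢ|ₚ`, where the `Xᵢ` are the projections to `pᗮ` of an orthonormal basis. -/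
def crossAd (μ : E →ₗ[ℝ] E →ₗ[ℝ] E) (p : Submodule ℝ E) (i : Fin (finrank ℝ E)) : E →ₗ[ℝ] E :=
  adOn μ p (projL pᗮ (stdONB E i))

/-- `∑ᵢ [Tᵢ, Tᵢᵗ]` for the operators `Tᵢ = ad Xᵢ|ₚ` with `Xᵢ ∈ pᗮ`. -/
def normalityDefect (μ : E →ₗ[ℝ] E →ₗ[ℝ] E) (p : Submodule ℝ E) : E →ₗ[ℝ] E :=
  ∑ i, (crossAd μ p i ∘ₗ transp (crossAd μ p i) - transp (crossAd μ p i) ∘ₗ crossAd μ p i)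

variable {μ : E →ₗ[ℝ] E →ₗ[ℝ] E}

theorem restrictB_apply (p : Submodule ℝ E) (x y : E) :
    restrictB μ p x y = μ (projL p x) (projL p y) := rfl

theorem restrictB_antisymm (hμ : ∀ x y, μ x y = -μ y x) (p : Submodule ℝ E) (x y : E) :
    restrictB μ p x y = -restrictB μ p y x := hμ _ _

theorem RopOn_eq (p : Submodule ℝ E) : RopOn μ p = Rop (restrictB μ p) := by
  refine LinearMap.ext fun x => ext_inner_right ℝ fun y => ?_
  have h1 := sum_inner_map_onbOf p (μ.flip (projL p x)) (μ.flip (projL p y))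
  have h2 := sum_inner_map_onbOf p (coad ((LinearMap.lcomp ℝ E (projL p)) ∘ₗ μ) x)
    (coad ((LinearMap.lcomp ℝ E (projL p)) ∘ₗ μ) y)
  rw [inner_Rop]
  simp only [RopOn, LinearMap.add_apply, LinearMap.smul_apply, LinearMap.sum_apply,
    LinearMap.comp_apply, inner_add_left, real_inner_smul_left, sum_inner]
  congr 1
  · refine congrArg _ (Eq.trans ?_ h1)
    exact Finset.sum_congr rfl fun i _ => inner_transp_left (adOn μ p (onbOf p i)) _ y
  · refine congrArg _ (Eq.trans ?_ h2)
    exact Finset.sum_congr rfl fun i _ => (inner_transp_right (adOn μ p (onbOf p i)) _ y).symm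

theorem sum_inner_transp_swap (hμ : ∀ x y, μ x y = -μ y x) (a b : E →ₗ[ℝ] E) (x y : E) :
    ∑ i, ⟪transp (μ (a (stdONB E i)) ∘ₗ b) x, transp (μ (a (stdONB E i)) ∘ₗ b) y⟫ =
      ∑ i, ⟪transp (μ (b (stdONB E i)) ∘ₗ a) x, transp (μ (b (stdONB E i)) ∘ₗ a) y⟫ := by
  have h : ∀ a b : E →ₗ[ℝ] E,
      ∑ i, ⟪transp (μ (a (stdONB E i)) ∘ₗ b) x, transp (μ (a (stdONB E i)) ∘ₗ b) y⟫ =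
      ∑ i, ∑ j, ⟪x, μ (a (stdONB E i)) (b (stdONB E j))⟫ *
        ⟪y, μ (a (stdONB E i)) (b (stdONB E j))⟫ := by
    intro a b
    refine Finset.sum_congr rfl fun i _ => ?_
    rw [← (stdONB E).sum_inner_mul_inner]
    refine Finset.sum_congr rfl fun j _ => ?_
    rw [inner_transp_right, inner_transp_left, LinearMap.comp_apply, real_inner_comm y]
  rw [h, h, Finset.sum_comm]
  refine Finset.sum_congr rfl fun i _ => Finset.sum_congr rfl fun j _ => ?_
  rw [hμ, inner_neg_right, inner_neg_right, neg_mul_neg]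

/-- The operator `R` on a subspace `p`, in terms of the bracket restricted to `p`. -/
theorem inner_Rop_of_mem (hμ : ∀ x y, μ x y = -μ y x) {p : Submodule ℝ E} {x y : E} (hx : x ∈ p)
    (hy : y ∈ p) : ⟪Rop μ x, y⟫ = ⟪Rop (restrictB μ p) x, y⟫ +
      (1 / 2) * ⟪normalityDefect μ p x, y⟫ +
      (1 / 4) * ∑ i, ⟪transp (adOn μ pᗮ (projL pᗮ (stdONB E i))) x,
        transp (adOn μ pᗮ (projL pᗮ (stdONB E i))) y⟫ := by
  have h1 := sum_inner_map_split p (μ.flip x) (μ.flip y)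
  have h2 := sum_inner_map_split p (coad μ x) (coad μ y)
  have h3 : ∀ q : Submodule ℝ E, ∀ X z, projL q (coad μ z X) = transp (μ X ∘ₗ projL q) z := by
    intro q X z
    rw [transp_comp, transp_projL]; rfl
  simp only [inner_split p (coad μ x _), h3, Finset.sum_add_distrib] at h2
  rw [sum_inner_transp_swap hμ (projL p) (projL pᗮ)] at h2
  have h4 : ∑ i, ⟪transp (μ (stdONB E i)) x, transp (μ (stdONB E i)) y⟫ =
      ∑ i, ⟪coad μ x (stdONB E i), coad μ y (stdONB E i)⟫ := rfl
  simp only [inner_split p (coad μ x _), h3, Finset.sum_add_distrib] at h4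
  simp only [LinearMap.flip_apply] at h1
  rw [inner_Rop, h1, h4, h2, inner_Rop]
  simp only [normalityDefect, LinearMap.sum_apply, sum_inner, LinearMap.sub_apply, inner_sub_left,
    Finset.sum_sub_distrib]
  have h5 : ∑ i, ⟪(crossAd μ p i ∘ₗ transp (crossAd μ p i)) x, y⟫ =
      ∑ i, ⟪transp (crossAd μ p i) x, transp (crossAd μ p i) y⟫ :=
    Finset.sum_congr rfl fun i _ => (inner_transp_right (crossAd μ p i) _ y).symm
  have h8 : ∑ i, ⟪(transp (crossAd μ p i) ∘ₗ crossAd μ p i) x, y⟫ =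
      ∑ i, ⟪crossAd μ p i x, crossAd μ p i y⟫ :=
    Finset.sum_congr rfl fun i _ => inner_transp_left (crossAd μ p i) (crossAd μ p i x) y
  rw [h5, h8]
  have h6 : ∀ X, ∀ z ∈ p, μ X z = adOn μ p X z := fun X z hz => by
    rw [adOn, LinearMap.comp_apply, projL_of_mem hz]
  simp only [h6 _ x hx, h6 _ y hy]
  have h7 : ∀ X, restrictB μ p X = adOn μ p (projL p X) := fun _ => rfl
  simp only [h7, crossAd]
  simp only [adOn]
  ring

end IdealDecomposition

section NormalityDefect

open Module

variable {E : Type*} [NormedAddCommGroup E] [InnerProductSpace ℝ E] [FiniteDimensional ℝ E]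

theorem trace_comp_commutator_eq_zero {g f h : E →ₗ[ℝ] E} (hg : g ∘ₗ f = f ∘ₗ g) :
    LinearMap.trace ℝ E (g ∘ₗ (f ∘ₗ h - h ∘ₗ f)) = 0 := by
  rw [LinearMap.comp_sub, map_sub, ← LinearMap.comp_assoc, hg, LinearMap.comp_assoc,
    LinearMap.trace_comp_comm', LinearMap.comp_assoc, sub_self]

/-- For an invariant subspace `W` of `f`, the trace of the compression to `W` of `[f, fᵗ]` is the
squared norm of the off-diagonal block of `f`. -/
theorem trace_projL_comp_commutator {W : Submodule ℝ E} {f : E →ₗ[ℝ] E}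
    (hW : ∀ x ∈ W, f x ∈ W) :
    LinearMap.trace ℝ E (projL W ∘ₗ (f ∘ₗ transp f - transp f ∘ₗ f)) =
      LinearMap.trace ℝ E (transp (projL Wᗮ ∘ₗ transp f ∘ₗ projL W) ∘ₗ
        (projL Wᗮ ∘ₗ transp f ∘ₗ projL W)) := by
  have hQ : projL Wᗮ = LinearMap.id - projL W := by
    ext x
    rw [LinearMap.sub_apply, LinearMap.id_apply, eq_sub_iff_add_eq, add_comm,
      projL_add_projL_orthogonal]
  have h1 : projL W ∘ₗ f ∘ₗ projL W = f ∘ₗ projL W :=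
    LinearMap.ext fun x => projL_of_mem (hW _ (projL_mem _ _))
  have h2 : transp (projL Wᗮ ∘ₗ transp f ∘ₗ projL W) ∘ₗ (projL Wᗮ ∘ₗ transp f ∘ₗ projL W) =
      (projL W ∘ₗ f ∘ₗ projL Wᗮ ∘ₗ transp f) ∘ₗ projL W := by
    simp only [transp_comp, transp_projL, transp_transp]
    ext x
    simp only [LinearMap.comp_apply, projL_of_mem (projL_mem Wᗮ _)]
  rw [h2, hQ]
  have h3 := projL_comp_self W
  simp only [← Module.End.mul_eq_comp, ← Module.End.one_eq_id] at h1 h3 ⊢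
  generalize transp f = g at *
  generalize projL W = P at *
  have h4 : P * (f * ((1 - P) * g)) * P = P * (f * g) * P - (P * (f * P)) * g * P := by noncomm_ring
  have h5 : P * (f * g - g * f) = P * (f * g) - P * (g * f) := mul_sub _ _ _
  rw [h4, h5, h1, map_sub, map_sub]
  congr 1
  · rw [LinearMap.trace_mul_comm ℝ (P * (f * g)) P, ← mul_assoc P P, h3]
  · rw [LinearMap.trace_mul_comm ℝ P, mul_assoc g f P, mul_assoc (f * P) g P,
      LinearMap.trace_mul_comm ℝ (f * P), mul_assoc g P, h1]

theorem map_orthogonal_mem_of_trace {W : Submodule ℝ E} {f : E →ₗ[ℝ] E}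
    (h : projL Wᗮ ∘ₗ transp f ∘ₗ projL W = 0) : ∀ x ∈ Wᗮ, f x ∈ Wᗮ := by
  intro x hx
  rw [Submodule.mem_orthogonal]
  intro y hy
  have h1 := LinearMap.congr_fun h y
  simp only [LinearMap.comp_apply, projL_of_mem hy, LinearMap.zero_apply] at h1
  rw [← inner_transp_left, ← projL_add_projL_orthogonal W (transp f y), h1, add_zero]
  exact (Submodule.mem_orthogonal _ _).1 hx _ (projL_mem _ _)

variable (μ : E →ₗ[ℝ] E →ₗ[ℝ] E)

theorem transp_normalityDefect (p : Submodule ℝ E) :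
    transp (normalityDefect μ p) = normalityDefect μ p := by
  have h : ∀ f : E →ₗ[ℝ] E,
      transp (f ∘ₗ transp f - transp f ∘ₗ f) = f ∘ₗ transp f - transp f ∘ₗ f := by
    intro f
    rw [transp, map_sub]
    change transp _ - transp _ = _
    rw [transp_comp, transp_comp, transp_transp]
  rw [normalityDefect, transp, map_sum]
  exact Finset.sum_congr rfl fun i _ => h _

theorem trace_comp_normalityDefect (g : E →ₗ[ℝ] E) (p : Submodule ℝ E) :
    LinearMap.trace ℝ E (g ∘ₗ normalityDefect μ p) = ∑ i, LinearMap.trace ℝ E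
      (g ∘ₗ (crossAd μ p i ∘ₗ transp (crossAd μ p i) -
        transp (crossAd μ p i) ∘ₗ crossAd μ p i)) := by
  rw [LinearMap.trace_comp_comm', normalityDefect, trace_sum_comp]
  exact Finset.sum_congr rfl fun i _ => LinearMap.trace_comp_comm' _ _

variable {μ}

theorem trace_projL_comp_normalityDefect_nonneg {p W : Submodule ℝ E}
    (hW : ∀ i, ∀ x ∈ W, crossAd μ p i x ∈ W) :
    0 ≤ LinearMap.trace ℝ E (projL W ∘ₗ normalityDefect μ p) := by
  rw [trace_comp_normalityDefect]
  refine Finset.sum_nonneg fun i _ => ?_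
  rw [trace_projL_comp_commutator (hW i)]
  exact trace_transp_comp_self_nonneg _

/-- If the normality defect vanishes, invariant subspaces have invariant complements. -/
theorem crossAd_mem_orthogonal {p W : Submodule ℝ E} (h : normalityDefect μ p = 0)
    (hW : ∀ i, ∀ x ∈ W, crossAd μ p i x ∈ W) (i : Fin (finrank ℝ E)) :
    ∀ x ∈ Wᗮ, crossAd μ p i x ∈ Wᗮ := by
  have h1 := trace_comp_normalityDefect μ (projL W) p
  rw [h, LinearMap.comp_zero, map_zero, eq_comm, Finset.sum_eq_zero_iff_of_nonneg] at h1
  · have h2 := h1 i (Finset.mem_univ i)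
    rw [trace_projL_comp_commutator (hW i)] at h2
    exact map_orthogonal_mem_of_trace (eq_zero_of_trace_transp_comp_self h2)
  · intro i _
    rw [trace_projL_comp_commutator (hW i)]
    exact trace_transp_comp_self_nonneg _

/-- Every `ad Y|ₚ` with `Y ∈ pᗮ` is a combination of the operators `crossAd μ p i`. -/
theorem adOn_eq_sum_crossAd {p : Submodule ℝ E} {Y : E} (hY : Y ∈ pᗮ) (x : E) :
    adOn μ p Y x = ∑ i, ⟪stdONB E i, Y⟫ • crossAd μ p i x := by
  conv_lhs => rw [← projL_of_mem hY, ← (stdONB E).sum_repr' Y]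
  simp [adOn, crossAd]

theorem adOn_mem_of_crossAd_mem {p W : Submodule ℝ E} (hW : ∀ i, ∀ x ∈ W, crossAd μ p i x ∈ W)
    {Y : E} (hY : Y ∈ pᗮ) {x : E} (hx : x ∈ W) : adOn μ p Y x ∈ W := by
  rw [adOn_eq_sum_crossAd hY]
  exact Submodule.sum_mem _ fun i _ => Submodule.smul_mem _ _ (hW i x hx)

theorem isDeriv_restrictB_adOn (hLie : IsLieBracket μ) {p : Submodule ℝ E} (hp : IsIdeal μ p)
    (X : E) : IsDeriv (restrictB μ p) (adOn μ p X) := by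
  intro x y
  simp only [restrictB_apply, adOn, LinearMap.comp_apply]
  rw [projL_of_mem (hp _ _ (projL_mem p y)), projL_of_mem (hp X _ (projL_mem p x)),
    projL_of_mem (hp X _ (projL_mem p y)), hLie.2]

/-- If `p` is an ideal with `[pᗮ, pᗮ] ⊆ pᗮ` and `R` has trace zero against the normality defect,
then the normality defect vanishes. -/
theorem normalityDefect_eq_zero (hLie : IsLieBracket μ) {p : Submodule ℝ E} (hp : IsIdeal μ p)
    (hp' : ∀ x ∈ pᗮ, ∀ y ∈ pᗮ, μ x y ∈ pᗮ)
    (h : LinearMap.trace ℝ E (Rop μ ∘ₗ normalityDefect μ p) = 0) : normalityDefect μ p = 0 := by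
  set M := normalityDefect μ p with hM
  have hPT : ∀ i, projL p ∘ₗ crossAd μ p i = crossAd μ p i := fun i =>
    LinearMap.ext fun x => projL_of_mem (hp _ _ (projL_mem _ _))
  have hPT' : ∀ i, projL p ∘ₗ transp (crossAd μ p i) = transp (crossAd μ p i) := fun i => by
    rw [← transp_projL, ← transp_comp, crossAd, adOn, LinearMap.comp_assoc, projL_comp_self]
  have hPM : projL p ∘ₗ M = M := by
    refine LinearMap.ext fun x => projL_of_mem ?_
    rw [hM, normalityDefect, LinearMap.sum_apply]
    refine Submodule.sum_mem _ fun i _ => Submodule.sub_mem _ ?_ ?_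
    · rw [← hPT]; exact projL_mem _ _
    · rw [← hPT']; exact projL_mem _ _
  have hMP : M ∘ₗ projL p = M := by
    rw [← transp_projL, hM, ← transp_normalityDefect, ← transp_comp, ← hM, hPM]
  have hR : projL p ∘ₗ Rop μ ∘ₗ projL p =
      projL p ∘ₗ (Rop (restrictB μ p) + (1 / 2 : ℝ) • M) ∘ₗ projL p := by
    refine LinearMap.ext fun x => ext_inner_right ℝ fun y => ?_
    simp only [LinearMap.comp_apply, inner_projL]
    rw [inner_Rop_of_mem hLie.antisymm (projL_mem _ _) (projL_mem _ _), LinearMap.add_apply,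
      inner_add_left, LinearMap.smul_apply, real_inner_smul_left, ← hM, add_eq_left]
    refine mul_eq_zero_of_right _ (Finset.sum_eq_zero fun i _ => ?_)
    have : transp (adOn μ pᗮ (projL pᗮ (stdONB E i))) (projL p x) = 0 := by
      refine ext_inner_right ℝ fun z => ?_
      rw [inner_transp_left, inner_zero_left]
      exact (Submodule.mem_orthogonal _ _).1 (hp' _ (projL_mem _ _) _ (projL_mem _ _)) _
        (projL_mem _ _)
    rw [this, inner_zero_left]
  have hT : LinearMap.trace ℝ E ((projL p ∘ₗ Rop μ ∘ₗ projL p) ∘ₗ M) = 0 := by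
    rw [LinearMap.comp_assoc, LinearMap.trace_comp_comm', LinearMap.comp_assoc,
      LinearMap.comp_assoc, hMP, hPM, h]
  rw [hR, LinearMap.comp_assoc, LinearMap.trace_comp_comm', LinearMap.comp_assoc,
      LinearMap.comp_assoc, hMP, hPM, LinearMap.add_comp, map_add, LinearMap.smul_comp,
      map_smul, smul_eq_mul] at hT
  have h1 : 0 ≤ LinearMap.trace ℝ E (Rop (restrictB μ p) ∘ₗ M) := by
    rw [hM, trace_comp_normalityDefect]
    exact Finset.sum_nonneg fun i _ => trace_Rop_comp_normal
      (restrictB_antisymm hLie.antisymm p) (isDeriv_restrictB_adOn hLie hp _)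
  have h2 := trace_transp_comp_self_nonneg M
  refine eq_zero_of_trace_transp_comp_self (le_antisymm ?_ h2)
  rw [hM, transp_normalityDefect, ← hM]
  linarith

end NormalityDefect

section SolvableMetric

open Module

variable {E : Type*} [NormedAddCommGroup E] [InnerProductSpace ℝ E] [FiniteDimensional ℝ E]
  {μ : E →ₗ[ℝ] E →ₗ[ℝ] E} {n : Submodule ℝ E}

theorem transp_apply_eq_zero {f : E →ₗ[ℝ] E} (hf : ∀ x, f x ∈ n) {A : E} (hA : A ∈ nᗮ) :
    transp f A = 0 :=
  ext_inner_right ℝ fun y => by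
    rw [inner_transp_left, inner_zero_left]
    exact Submodule.inner_left_of_mem_orthogonal (hf y) hA

theorem eq_of_inner_mem {x y : E} (h1 : ∀ z ∈ n, ⟪x, z⟫ = ⟪y, z⟫)
    (h2 : ∀ z ∈ nᗮ, ⟪x, z⟫ = ⟪y, z⟫) : x = y :=
  ext_inner_right ℝ fun z => by
    rw [← projL_add_projL_orthogonal n z, inner_add_right, inner_add_right,
      h1 _ (projL_mem _ _), h2 _ (projL_mem _ _)]

theorem Rop_restrictB_of_mem_orthogonal (hn : IsIdeal μ n) {A : E} (hA : A ∈ nᗮ) :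
    Rop (restrictB μ n) A = 0 := by
  refine ext_inner_right ℝ fun y => ?_
  rw [inner_Rop, inner_zero_left]
  have h1 : ∀ i, restrictB μ n (stdONB E i) A = 0 := fun i => by
    rw [restrictB_apply, projL_of_mem_orthogonal hA, map_zero]
  have h2 : ∀ i, transp (restrictB μ n (stdONB E i)) A = 0 := fun i =>
    transp_apply_eq_zero (f := restrictB μ n (stdONB E i))
      (fun x => hn (projL n (stdONB E i)) _ (projL_mem n x)) hA
  simp [h1, h2]

theorem inner_Rop_of_mem_orthogonal (hμ : ∀ x y, μ x y = -μ y x) (hbr : ∀ x y, μ x y ∈ n)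
    {A : E} (hA : A ∈ nᗮ) (y : E) :
    ⟪Rop μ A, y⟫ = -(1 / 2) * LinearMap.trace ℝ E (transp (μ A) ∘ₗ μ y) := by
  rw [inner_Rop, trace_transp_comp]
  simp only [transp_apply_eq_zero (hbr _) hA, inner_zero_left, Finset.sum_const_zero, mul_zero,
    add_zero]
  congr 1
  refine Finset.sum_congr rfl fun i _ => ?_
  rw [hμ, hμ _ y, inner_neg_neg]

theorem inner_Rop_sub_Bop_self (hμ : ∀ x y, μ x y = -μ y x) (hbr : ∀ x y, μ x y ∈ n)
    {A : E} (hA : A ∈ nᗮ) : ⟪Rop μ A, A⟫ - (1 / 2) * ⟪Bop μ A, A⟫ =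
      -LinearMap.trace ℝ E (symPart (μ A) ∘ₗ symPart (μ A)) := by
  have h1 : LinearMap.trace ℝ E (transp (μ A) ∘ₗ transp (μ A)) =
      LinearMap.trace ℝ E (μ A ∘ₗ μ A) := by rw [← transp_comp, trace_transp]
  rw [inner_Rop_of_mem_orthogonal hμ hbr hA, inner_Bop]
  simp only [symPart, LinearMap.comp_smul, LinearMap.smul_comp, LinearMap.comp_add,
    LinearMap.add_comp, map_smul, map_add, smul_eq_mul, h1,
    LinearMap.trace_comp_comm' (μ A) (transp (μ A))]
  ring

theorem trace_comp_ad_eq_zero (hLie : IsLieBracket μ) (hsolv : IsSolvableB μ)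
    (hn : IsNilradical μ n) {D : E →ₗ[ℝ] E} (hD : IsDeriv μ D) {x : E} (hx : x ∈ n) :
    LinearMap.trace ℝ E (D ∘ₗ μ x) = 0 :=
  trace_comp_eq_zero_of_mem hn.2.1 (hn.bracket_mem hLie hsolv)
    (hD.apply_mem_lcsOn fun y _ => hn.deriv_mem hLie hsolv hD y) hx

theorem Bop_of_mem (hLie : IsLieBracket μ) (hsolv : IsSolvableB μ)
    (hn : IsNilradical μ n) {x : E} (hx : x ∈ n) : Bop μ x = 0 := by
  refine ext_inner_right ℝ fun y => ?_
  rw [inner_Bop, inner_zero_left, LinearMap.trace_comp_comm',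
    trace_comp_ad_eq_zero hLie hsolv hn (hLie.isDeriv y) hx]

theorem meanCurv_mem (hLie : IsLieBracket μ) (hsolv : IsSolvableB μ)
    (hn : IsNilradical μ n) : meanCurv μ ∈ nᗮ := by
  refine (Submodule.mem_orthogonal' _ _).2 fun x hx => ?_
  rw [inner_meanCurv]
  exact trace_comp_eq_zero_of_mem (f := LinearMap.id) hn.2.1 (hn.bracket_mem hLie hsolv)
    (fun _ _ h => h) hx

/-- If `(ad A)ᵗ` is a derivation, then `ad A` is normal. -/
theorem transp_ad_comp_ad (hbr : ∀ x y, μ x y ∈ n) {A : E} (hA : A ∈ nᗮ)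
    (h : IsDeriv μ (transp (μ A))) : transp (μ A) ∘ₗ μ A = μ A ∘ₗ transp (μ A) := by
  refine LinearMap.ext fun x => ?_
  rw [LinearMap.comp_apply, h, transp_apply_eq_zero (hbr _) hA, map_zero, LinearMap.zero_apply,
    zero_add, LinearMap.comp_apply]

end SolvableMetric

section Reverse

open Module

variable {E : Type*} [NormedAddCommGroup E] [InnerProductSpace ℝ E] [FiniteDimensional ℝ E]
  {μ : E →ₗ[ℝ] E →ₗ[ℝ] E} {n : Submodule ℝ E}

omit [FiniteDimensional ℝ E] in
theorem IsDeriv.add {f g : E →ₗ[ℝ] E} (hf : IsDeriv μ f) (hg : IsDeriv μ g) :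
    IsDeriv μ (f + g) := fun x y => by
  simp only [LinearMap.add_apply, hf x y, hg x y, map_add]
  abel

omit [FiniteDimensional ℝ E] in
theorem IsDeriv.smul {f : E →ₗ[ℝ] E} (hf : IsDeriv μ f) (c : ℝ) : IsDeriv μ (c • f) :=
  fun x y => by simp only [LinearMap.smul_apply, hf x y, map_smul, smul_add]

theorem commute_of_trace {R f : E →ₗ[ℝ] E}
    (h : ∀ g, LinearMap.trace ℝ E (R ∘ₗ (f ∘ₗ g - g ∘ₗ f)) = 0) : R ∘ₗ f = f ∘ₗ R := by
  have h1 : ∀ g, LinearMap.trace ℝ E ((R ∘ₗ f - f ∘ₗ R) ∘ₗ g) = 0 := by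
    intro g
    rw [← h g, LinearMap.comp_sub, LinearMap.sub_comp, map_sub, map_sub, LinearMap.comp_assoc,
      LinearMap.comp_assoc, LinearMap.trace_comp_comm' (R ∘ₗ g) f, LinearMap.comp_assoc]
  have h2 := h1 (transp (R ∘ₗ f - f ∘ₗ R))
  rw [LinearMap.trace_comp_comm'] at h2
  exact sub_eq_zero.1 (eq_zero_of_trace_transp_comp_self h2)

theorem adOn_of_mem_orthogonal (hii : ∀ A ∈ nᗮ, ∀ A' ∈ nᗮ, μ A A' = 0) {A : E} (hA : A ∈ nᗮ) :
    adOn μ n A = μ A := by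
  refine LinearMap.ext fun x => ?_
  conv_rhs => rw [← projL_add_projL_orthogonal n x, map_add, hii A hA _ (projL_mem _ _), add_zero]
  rfl

theorem isDeriv_comp_projL (hLie : IsLieBracket μ) (hbr : ∀ x y, μ x y ∈ n)
    (hii : ∀ A ∈ nᗮ, ∀ A' ∈ nᗮ, μ A A' = 0) {D : E →ₗ[ℝ] E}
    (hD : ∀ x ∈ n, ∀ y ∈ n, D (μ x y) = μ (D x) y + μ x (D y))
    (hcomm : ∀ A ∈ nᗮ, ∀ x ∈ n, D (μ A x) = μ A (D x)) : IsDeriv μ (D ∘ₗ projL n) := by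
  intro x y
  simp only [LinearMap.comp_apply, projL_of_mem (hbr x y)]
  have hx := projL_add_projL_orthogonal n x
  have hy := projL_add_projL_orthogonal n y
  set x₁ := projL n x
  set y₁ := projL n y
  set x₂ := projL nᗮ x
  set y₂ := projL nᗮ y
  have hx₁ : x₁ ∈ n := projL_mem _ _
  have hy₁ : y₁ ∈ n := projL_mem _ _
  have hx₂ : x₂ ∈ nᗮ := projL_mem _ _
  have hy₂ : y₂ ∈ nᗮ := projL_mem _ _
  rw [← hx, ← hy]
  simp only [map_add, LinearMap.add_apply, hii x₂ hx₂ y₂ hy₂, hD x₁ hx₁ y₁ hy₁, add_zero,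
    hcomm x₂ hx₂ y₁ hy₁]
  rw [hLie.antisymm x₁ y₂, map_neg, hcomm y₂ hy₂ x₁ hx₁, hLie.antisymm (D x₁) y₂]
  abel

theorem normalityDefect_eq_zero_of_transp (hbr : ∀ x y, μ x y ∈ n)
    (hii : ∀ A ∈ nᗮ, ∀ A' ∈ nᗮ, μ A A' = 0)
    (hiii : ∀ A ∈ nᗮ, IsDeriv μ (transp (μ A))) : normalityDefect μ n = 0 := by
  refine Finset.sum_eq_zero fun i _ => ?_
  have h := projL_mem nᗮ (stdONB E i)
  rw [crossAd, adOn_of_mem_orthogonal hii h, transp_ad_comp_ad hbr h (hiii _ h), sub_self]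

theorem adOn_orthogonal_eq_zero (hii : ∀ A ∈ nᗮ, ∀ A' ∈ nᗮ, μ A A' = 0) {A : E} (hA : A ∈ nᗮ) :
    adOn μ nᗮ A = 0 :=
  LinearMap.ext fun _ => hii A hA _ (projL_mem _ _)

theorem Rop_restrictB_mem (hn : IsIdeal μ n) (x : E) : Rop (restrictB μ n) x ∈ n := by
  suffices h : Rop (restrictB μ n) x ∈ nᗮᗮ by rwa [Submodule.orthogonal_orthogonal] at h
  refine (Submodule.mem_orthogonal' _ _).2 fun y hy => ?_
  rw [← inner_transp_right, transp_Rop, Rop_restrictB_of_mem_orthogonal hn hy, inner_zero_right]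

/-- Under the structural conditions, `R` restricts on the nilradical to its own Ricci operator. -/
theorem Rop_of_mem (hLie : IsLieBracket μ) (hsolv : IsSolvableB μ) (hn : IsNilradical μ n)
    (hii : ∀ A ∈ nᗮ, ∀ A' ∈ nᗮ, μ A A' = 0)
    (hiii : ∀ A ∈ nᗮ, IsDeriv μ (transp (μ A))) {x : E} (hx : x ∈ n) :
    Rop μ x = RopOn μ n x := by
  have hbr := hn.bracket_mem hLie hsolv
  rw [RopOn_eq]
  refine eq_of_inner_mem (n := n) (fun y hy => ?_) fun y hy => ?_
  · rw [inner_Rop_of_mem hLie.antisymm hx hy, normalityDefect_eq_zero_of_transp hbr hii hiii]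
    simp [adOn_orthogonal_eq_zero hii (projL_mem _ _), transp]
  · rw [Submodule.inner_right_of_mem_orthogonal (Rop_restrictB_mem hn.1 x) hy,
      ← transp_Rop, inner_transp_left, real_inner_comm,
      inner_Rop_of_mem_orthogonal hLie.antisymm hbr hy,
      trace_comp_ad_eq_zero hLie hsolv hn (hiii y hy) hx, mul_zero]

theorem exists_isDeriv_of_structure (hLie : IsLieBracket μ) (hsolv : IsSolvableB μ)
    (hn : IsNilradical μ n) {c : ℝ} (hc : c < 0) {D₁ : E →ₗ[ℝ] E}
    (hi : IsNilsolitonOn μ n c D₁) (hii : ∀ A ∈ nᗮ, ∀ A' ∈ nᗮ, μ A A' = 0)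
    (hiii : ∀ A ∈ nᗮ, IsDeriv μ (transp (μ A)))
    (hiv : ∀ A ∈ nᗮ, ⟪A, A⟫ =
      -(1 / c) * LinearMap.trace ℝ E (symPart (μ A) ∘ₗ symPart (μ A))) :
    ∃ D : E →ₗ[ℝ] E, IsDeriv μ D ∧ Ric μ = c • LinearMap.id + D := by
  have hbr := hn.bracket_mem hLie hsolv
  have hH := meanCurv_mem hLie hsolv hn
  have hS : IsDeriv μ (symPart (μ (meanCurv μ))) :=
    ((hLie.isDeriv _).add (hiii _ hH)).smul _
  have hcomm : ∀ A ∈ nᗮ, ∀ x ∈ n, D₁ (μ A x) = μ A (D₁ x) := by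
    intro A hA x hx
    have hderiv : IsDeriv (restrictB μ n) (μ A) := by
      rw [← adOn_of_mem_orthogonal hii hA]
      exact isDeriv_restrictB_adOn hLie hn.1 A
    have hmem := hn.deriv_mem hLie hsolv (hiii A hA)
    have hderiv' : IsDeriv (restrictB μ n) (transp (μ A)) := by
      intro x y
      have h : ∀ z, transp (μ A) (projL n z) = projL n (transp (μ A) z) := by
        intro z
        rw [projL_of_mem (hmem z)]
        conv_rhs => rw [← projL_add_projL_orthogonal n z, map_add,
          transp_apply_eq_zero (hbr A) (projL_mem nᗮ z), add_zero]
      simp only [restrictB_apply, hiii A hA _ _, h]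
    have h1 := commute_of_trace (R := Rop (restrictB μ n)) (f := μ A) fun g => by
      rw [trace_Rop_comp_commutator (restrictB_antisymm hLie.antisymm n) hderiv,
        (isDeriv_iff_piAct_eq_zero _).1 hderiv']
      simp [binner]
    have h2 := LinearMap.congr_fun h1 x
    rw [LinearMap.comp_apply, LinearMap.comp_apply, ← RopOn_eq, hi.2.2 _ (hbr A x), hi.2.2 x hx,
      map_add, map_smul] at h2
    exact add_left_cancel h2
  refine ⟨D₁ ∘ₗ projL n + (-1 : ℝ) • symPart (μ (meanCurv μ)),
    (isDeriv_comp_projL hLie hbr hii hi.2.1 hcomm).add (hS.smul _), ?_⟩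
  suffices h : ∀ x, Rop μ x - (1 / 2 : ℝ) • Bop μ x = c • x + D₁ (projL n x) by
    refine LinearMap.ext fun x => ?_
    simp only [Ric, LinearMap.sub_apply, LinearMap.smul_apply, LinearMap.add_apply,
      LinearMap.id_apply, LinearMap.comp_apply, h]
    module
  have hsymm : ∀ x y, ⟪Rop μ x - (1 / 2 : ℝ) • Bop μ x, y⟫ =
      ⟪x, Rop μ y - (1 / 2 : ℝ) • Bop μ y⟫ := by
    intro x y
    rw [inner_sub_left, inner_sub_right, ← inner_transp_right, transp_Rop, real_inner_smul_left,
      real_inner_smul_right, ← inner_transp_right, transp_Bop]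
  have hN : ∀ x ∈ n, Rop μ x - (1 / 2 : ℝ) • Bop μ x = c • x + D₁ x := by
    intro x hx
    rw [Bop_of_mem hLie hsolv hn hx, smul_zero, sub_zero, Rop_of_mem hLie hsolv hn hii hiii hx,
      hi.2.2 x hx]
  have hA : ∀ A ∈ nᗮ, ⟪Rop μ A - (1 / 2 : ℝ) • Bop μ A, A⟫ = c * ⟪A, A⟫ := by
    intro A hA
    rw [inner_sub_left, real_inner_smul_left, inner_Rop_sub_Bop_self hLie.antisymm hbr hA, hiv A hA]
    have := hc.ne
    field_simp
  have hAA : ∀ A ∈ nᗮ, Rop μ A - (1 / 2 : ℝ) • Bop μ A = c • A := by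
    intro A hA'
    refine eq_of_inner_mem (n := n) (fun y hy => ?_) fun y hy => ?_
    · rw [hsymm, hN y hy, real_inner_smul_left, Submodule.inner_left_of_mem_orthogonal hy hA',
        mul_zero]
      exact Submodule.inner_left_of_mem_orthogonal
        (n.add_mem (n.smul_mem _ hy) (hi.1 y hy)) hA'
    · have h1 := hA _ hA'
      have h2 := hA _ hy
      have h3 := hA _ (nᗮ.add_mem hA' hy)
      have h4 := hsymm y A
      have h5 : ∀ a b : E, Rop μ (a + b) - (1 / 2 : ℝ) • Bop μ (a + b) =
          (Rop μ a - (1 / 2 : ℝ) • Bop μ a) + (Rop μ b - (1 / 2 : ℝ) • Bop μ b) := by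
        intro a b; simp only [map_add]; module
      rw [h5] at h3
      rw [real_inner_comm (Rop μ A - (1 / 2 : ℝ) • Bop μ A) y] at h4
      simp only [inner_add_left, inner_add_right, h4, h1, h2, real_inner_comm A y] at h3
      rw [real_inner_smul_left]
      linarith [real_inner_comm A y]
  intro x
  calc Rop μ x - (1 / 2 : ℝ) • Bop μ x
      = (Rop μ (projL n x) - (1 / 2 : ℝ) • Bop μ (projL n x)) +
        (Rop μ (projL nᗮ x) - (1 / 2 : ℝ) • Bop μ (projL nᗮ x)) := by
        conv_lhs => rw [← projL_add_projL_orthogonal n x, map_add, map_add]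
        module
    _ = c • (projL n x + projL nᗮ x) + D₁ (projL n x) := by
        rw [hN _ (projL_mem n x), hAA _ (projL_mem nᗮ x)]
        module
    _ = c • x + D₁ (projL n x) := by rw [projL_add_projL_orthogonal]

end Reverse

section WeightOperator

open Module

variable {E : Type*} [NormedAddCommGroup E] [InnerProductSpace ℝ E] [FiniteDimensional ℝ E]
  {μ : E →ₗ[ℝ] E →ₗ[ℝ] E} {n : Submodule ℝ E} {ι : Type*} [Fintype ι]

/-- The operator with eigenbasis `v` and eigenvalues `w`. -/
def weightOp (v : OrthonormalBasis ι ℝ E) (w : ι → ℝ) : E →ₗ[ℝ] E :=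
  v.toBasis.constr ℝ fun i => w i • v i

variable (v : OrthonormalBasis ι ℝ E) (w : ι → ℝ)

omit [FiniteDimensional ℝ E] in
theorem weightOp_apply_basis (i : ι) : weightOp v w (v i) = w i • v i := by
  have h := v.toBasis.constr_basis ℝ (fun i => w i • v i) i
  rwa [v.coe_toBasis] at h

omit [FiniteDimensional ℝ E] in
theorem inner_weightOp_basis (i : ι) (x : E) : ⟪v i, weightOp v w x⟫ = w i * ⟪v i, x⟫ := by
  classical
  conv_lhs => rw [← v.sum_repr x]
  simp only [map_sum, map_smul, weightOp_apply_basis, inner_sum, real_inner_smul_right,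
    OrthonormalBasis.inner_eq_ite, v.repr_apply_apply]
  simp [mul_comm]

theorem transp_weightOp : transp (weightOp v w) = weightOp v w := by
  refine transp_eq_self_iff.2 fun x y => ?_
  rw [← v.sum_inner_mul_inner, ← v.sum_inner_mul_inner x]
  refine Finset.sum_congr rfl fun i _ => ?_
  rw [inner_weightOp_basis, real_inner_comm, inner_weightOp_basis, real_inner_comm x]
  ring

omit [FiniteDimensional ℝ E] in
theorem trace_comp_weightOp (f : E →ₗ[ℝ] E) :
    LinearMap.trace ℝ E (f ∘ₗ weightOp v w) = ∑ i, w i * ⟪v i, f (v i)⟫ := by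
  rw [LinearMap.trace_eq_sum_inner _ v]
  refine Finset.sum_congr rfl fun i _ => ?_
  rw [LinearMap.comp_apply, weightOp_apply_basis, map_smul, real_inner_smul_right]

variable {v w}

omit [FiniteDimensional ℝ E] in
theorem inner_piAct_weightOp (i j k : ι) : ⟪v k, piAct (weightOp v w) μ (v i) (v j)⟫ =
    (w k - w i - w j) * ⟪v k, μ (v i) (v j)⟫ := by
  simp only [piAct_apply, inner_sub_right, inner_weightOp_basis, weightOp_apply_basis, map_smul,
    LinearMap.smul_apply, real_inner_smul_right]
  ring

theorem binner_piAct_weightOp : binner (piAct (weightOp v w) μ) μ =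
    ∑ i, ∑ j, ∑ k, (w k - w i - w j) * ⟪v k, μ (v i) (v j)⟫ ^ 2 := by
  rw [binner_eq_sum _ v]
  refine Finset.sum_congr rfl fun i _ => Finset.sum_congr rfl fun j _ => ?_
  rw [← v.sum_inner_mul_inner]
  refine Finset.sum_congr rfl fun k _ => ?_
  rw [real_inner_comm, inner_piAct_weightOp]
  ring

omit [FiniteDimensional ℝ E] in
theorem weight_term_nonneg (h : ∀ i j k, ⟪v k, μ (v i) (v j)⟫ ≠ 0 → w i + w j ≤ w k) (i j k : ι) :
    0 ≤ (w k - w i - w j) * ⟪v k, μ (v i) (v j)⟫ ^ 2 := by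
  by_cases h0 : ⟪v k, μ (v i) (v j)⟫ = 0
  · simp [h0]
  · exact mul_nonneg (by linarith [h i j k h0]) (sq_nonneg _)

theorem binner_piAct_weightOp_nonneg
    (h : ∀ i j k, ⟪v k, μ (v i) (v j)⟫ ≠ 0 → w i + w j ≤ w k) :
    0 ≤ binner (piAct (weightOp v w) μ) μ := by
  rw [binner_piAct_weightOp]
  exact Finset.sum_nonneg fun i _ => Finset.sum_nonneg fun j _ => Finset.sum_nonneg fun k _ =>
    weight_term_nonneg h i j k

theorem isDeriv_weightOp (h : ∀ i j k, ⟪v k, μ (v i) (v j)⟫ ≠ 0 → w i + w j ≤ w k)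
    (h0 : binner (piAct (weightOp v w) μ) μ = 0) : IsDeriv μ (weightOp v w) := by
  rw [binner_piAct_weightOp] at h0
  refine (isDeriv_iff_piAct_eq_zero μ).2 (v.toBasis.ext fun i => v.toBasis.ext fun j => ?_)
  rw [v.coe_toBasis]
  refine InnerProductSpace.ext_inner_left_basis v.toBasis fun k => ?_
  have hi := (Finset.sum_eq_zero_iff_of_nonneg fun i _ => Finset.sum_nonneg fun j _ =>
    Finset.sum_nonneg fun k _ => weight_term_nonneg h i j k).1 h0 i (Finset.mem_univ _)
  have hj := (Finset.sum_eq_zero_iff_of_nonneg fun j _ =>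
    Finset.sum_nonneg fun k _ => weight_term_nonneg h i j k).1 hi j (Finset.mem_univ _)
  have hk := (Finset.sum_eq_zero_iff_of_nonneg fun k _ =>
    weight_term_nonneg h i j k).1 hj k (Finset.mem_univ _)
  rw [v.coe_toBasis, inner_piAct_weightOp]
  simp only [LinearMap.zero_apply, inner_zero_right]
  rcases mul_eq_zero.1 hk with h1 | h1
  · rw [h1, zero_mul]
  · rw [pow_eq_zero_iff two_ne_zero |>.1 h1, mul_zero]

/-- The optimal weights of the nilradical, extended by zero to an orthonormal basis of the
whole algebra. -/
theorem exists_weights (hLie : IsLieBracket μ) (hsolv : IsSolvableB μ) (hn : IsNilradical μ n) :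
    ∃ (N M : ℕ) (v : OrthonormalBasis (Fin N ⊕ Fin M) ℝ E) (w : Fin N ⊕ Fin M → ℝ),
      (∀ i, 0 ≤ w i) ∧ (∀ i, w i ≠ 0 → v i ∈ n) ∧
      (∀ i j k, ⟪v k, μ (v i) (v j)⟫ ≠ 0 → w i + w j ≤ w k) ∧
      (∀ f, IsDeriv μ f → LinearMap.trace ℝ E f ≤ ∑ i, w i * ⟪v i, f (v i)⟫) ∧
      ∑ i, w i ^ 2 = ∑ i, w i := by
  have hbr := hn.bracket_mem hLie hsolv
  let b : n →ₗ[ℝ] n →ₗ[ℝ] n := LinearMap.mk₂ ℝ (fun x y => ⟨μ x y, hbr x y⟩)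
    (by intros; ext; simp) (by intros; ext; simp) (by intros; ext; simp) (by intros; ext; simp)
  have hb : ∀ x y : n, (b x y : E) = μ x y := fun _ _ => rfl
  let res : ∀ f : E →ₗ[ℝ] E, (∀ x, f x ∈ n) → n →ₗ[ℝ] n := fun f hf =>
    LinearMap.codRestrict n (f ∘ₗ n.subtype) fun x => hf x
  have hres : ∀ f hf (x : n), (res f hf x : E) = f x := fun _ _ _ => rfl
  have hder : ∀ f (hf : IsDeriv μ f), IsDeriv b (res f (hn.deriv_mem hLie hsolv hf)) := by
    intro f hf x y
    ext
    simp only [Submodule.coe_add, hb, hres]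
    exact hf x y
  obtain ⟨N, v, w, hw0, hwb, hwd, hws⟩ := exists_orthonormal_weights b
    (fun x => hder _ (hLie.isDeriv x))
    fun x y => Subtype.ext <| by rw [Submodule.coe_neg, hb, hb, hLie.antisymm]
  let V : OrthonormalBasis (Fin N ⊕ Fin (finrank ℝ nᗮ)) ℝ E :=
    (v.prod (stdOrthonormalBasis ℝ nᗮ)).map n.orthogonalDecomposition.symm
  have hl : ∀ i, V (Sum.inl i) = v i := fun i => by simp [V]
  have hr : ∀ i, V (Sum.inr i) ∈ nᗮ := fun i => by simp [V]
  have hperp : ∀ i (f : E →ₗ[ℝ] E), (∀ x, f x ∈ n) → ∀ x : E, ⟪V (Sum.inr i), f x⟫ = 0 := fun i f hf x =>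
    Submodule.inner_left_of_mem_orthogonal (hf x) (hr i)
  refine ⟨N, _, V, Sum.elim w 0, ?_, ?_, ?_, ?_, ?_⟩
  · rintro (i | i) <;> simp [hw0]
  · rintro (i | i) <;> simp [hl]
  · have h1 : ∀ i j k, ⟪V (Sum.inl k), μ (V i) (V (Sum.inl j))⟫ ≠ 0 → w j ≤ w k := by
      intro i j k h
      refine (hwd _ (hder _ (hLie.isDeriv (V i)))).1 j k ?_
      rwa [Submodule.coe_inner, hres, ← hl, ← hl]
    rintro i j (k | k) h
    · rcases i with i | i <;> rcases j with j | j
      · refine hwb i j k ?_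
        rwa [Submodule.coe_inner, hb, ← hl, ← hl, ← hl]
      · simp only [Sum.elim_inl, Sum.elim_inr, Pi.zero_apply, add_zero]
        refine h1 (Sum.inr j) i k ?_
        rwa [hLie.antisymm, inner_neg_right, neg_ne_zero] at h
      · simpa using h1 _ j k h
      · simpa using hw0 k
    · exact absurd (Submodule.inner_left_of_mem_orthogonal (hbr _ _) (hr k)) h
  · intro f hf
    have h := (hwd _ (hder f hf)).2
    simp only [Submodule.coe_inner, hres, ← hl] at h
    rw [LinearMap.trace_eq_sum_inner f V]
    simpa [Fintype.sum_sum_type, hperp _ _ (hn.deriv_mem hLie hsolv hf)] using h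
  · simpa [Fintype.sum_sum_type] using hws

end WeightOperator

section Pinching

open Module

variable {E : Type*} [NormedAddCommGroup E] [InnerProductSpace ℝ E] [FiniteDimensional ℝ E]
  {μ : E →ₗ[ℝ] E →ₗ[ℝ] E} {n : Submodule ℝ E}

theorem Bop_comp_eq_zero (hLie : IsLieBracket μ) (hsolv : IsSolvableB μ) (hn : IsNilradical μ n)
    {f : E →ₗ[ℝ] E} (hf : ∀ x, f x ∈ n) : Bop μ ∘ₗ f = 0 :=
  LinearMap.ext fun x => Bop_of_mem hLie hsolv hn (hf x)

/-- For a solsoliton with `c < 0` the operator `c I - Ric - S(ad H)` is `c` times a diagonalizable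
derivation with nonnegative eigenvalues. -/
theorem exists_isDeriv_weightOp (hLie : IsLieBracket μ) (hsolv : IsSolvableB μ)
    (hn : IsNilradical μ n) {c : ℝ} (hc : c < 0) {D : E →ₗ[ℝ] E} (hD : IsDeriv μ D)
    (hRic : Ric μ = c • LinearMap.id + D) :
    ∃ (N M : ℕ) (v : OrthonormalBasis (Fin N ⊕ Fin M) ℝ E) (w : Fin N ⊕ Fin M → ℝ),
      (∀ i, 0 ≤ w i) ∧ IsDeriv μ (weightOp v w) ∧
      Rop μ - (1 / 2 : ℝ) • Bop μ = c • LinearMap.id - c • weightOp v w := by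
  obtain ⟨N, M, v, w, hw0, hwn, hwb, hwd, hws⟩ := exists_weights hLie hsolv hn
  refine ⟨N, M, v, w, hw0, ?_⟩
  set W := weightOp v w with hW
  have hWt : transp W = W := transp_weightOp v w
  set Φ := μ (meanCurv μ) + D with hΦ
  have hΦd : IsDeriv μ Φ := (hLie.isDeriv _).add hD
  have hDt : transp D = D := by
    have h : D = Ric μ - c • LinearMap.id := by rw [hRic]; abel
    have hid : transp (LinearMap.id : E →ₗ[ℝ] E) = LinearMap.id := LinearMap.adjoint_id
    refine transp_eq_self_iff.2 fun x y => ?_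
    have h1 : transp (Ric μ) = Ric μ := by
      rw [Ric, sub_eq_add_neg, sub_eq_add_neg, ← neg_smul, ← neg_one_smul ℝ (symPart _),
        transp_add, transp_add, transp_smul, transp_smul, transp_Rop, transp_Bop, transp_symPart]
    rw [h, LinearMap.sub_apply, LinearMap.sub_apply, inner_sub_left, inner_sub_right,
      transp_eq_self_iff.1 h1]
    simp [real_inner_smul_left, real_inner_smul_right]
  have hF : symPart Φ = Rop μ - (1 / 2 : ℝ) • Bop μ - c • LinearMap.id := by
    have h : symPart Φ = symPart (μ (meanCurv μ)) + D := by
      rw [hΦ, symPart, symPart, transp_add, hDt]; module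
    have h' : D = Ric μ - c • LinearMap.id := by rw [hRic]; abel
    rw [h, h', Ric]; abel
  have htrF : ∀ f : E →ₗ[ℝ] E, (∀ x, f x ∈ n) → LinearMap.trace ℝ E (symPart Φ ∘ₗ f) =
      LinearMap.trace ℝ E (Rop μ ∘ₗ f) - c * LinearMap.trace ℝ E f := by
    intro f hf
    rw [hF, LinearMap.sub_comp, LinearMap.sub_comp, LinearMap.smul_comp,
      Bop_comp_eq_zero hLie hsolv hn hf, LinearMap.smul_comp, LinearMap.id_comp]
    simp
  have htrS : ∀ f : E →ₗ[ℝ] E, transp f = f → LinearMap.trace ℝ E (symPart Φ ∘ₗ f) =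
      LinearMap.trace ℝ E (Φ ∘ₗ f) := by
    intro f hf
    have h : LinearMap.trace ℝ E (transp Φ ∘ₗ f) = LinearMap.trace ℝ E (Φ ∘ₗ f) := by
      conv_lhs => rw [← hf, ← transp_comp, trace_transp, LinearMap.trace_comp_comm']
    rw [symPart, LinearMap.smul_comp, LinearMap.add_comp, map_smul, map_add, h, smul_eq_mul]
    ring
  have hWn : ∀ x, W x ∈ n := by
    intro x
    rw [← v.sum_repr x, map_sum]
    refine n.sum_mem fun i _ => ?_
    rw [map_smul, hW, weightOp_apply_basis]
    refine n.smul_mem _ ?_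
    by_cases h : w i = 0
    · rw [h, zero_smul]; exact n.zero_mem
    · exact n.smul_mem _ (hwn i h)
  have hT : LinearMap.trace ℝ E (Rop μ ∘ₗ W) = (1 / 4) * binner (piAct W μ) μ :=
    trace_Rop_comp hLie.antisymm W
  have hT0 := binner_piAct_weightOp_nonneg (μ := μ) hwb
  have e1 : LinearMap.trace ℝ E (symPart Φ ∘ₗ symPart Φ) = -c * LinearMap.trace ℝ E Φ := by
    rw [htrS _ (transp_symPart Φ), LinearMap.trace_comp_comm',
      htrF _ (hn.deriv_mem hLie hsolv hΦd), trace_Rop_comp_of_isDeriv hLie.antisymm hΦd]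
    ring
  have e2 : LinearMap.trace ℝ E (symPart Φ ∘ₗ W) =
      (1 / 4) * binner (piAct W μ) μ - c * LinearMap.trace ℝ E W := by rw [htrF _ hWn, hT]
  have e3 : LinearMap.trace ℝ E Φ ≤ LinearMap.trace ℝ E (symPart Φ ∘ₗ W) := by
    rw [htrS _ hWt, trace_comp_weightOp]
    exact hwd _ hΦd
  have e4 : LinearMap.trace ℝ E (W ∘ₗ W) = LinearMap.trace ℝ E W := by
    have h1 := trace_comp_weightOp v w LinearMap.id
    rw [LinearMap.id_comp, ← hW] at h1
    rw [h1, hW, trace_comp_weightOp]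
    simp only [weightOp_apply_basis, real_inner_smul_right, real_inner_self_eq_norm_sq,
      v.norm_eq_one, LinearMap.id_apply, one_pow, mul_one, ← sq]
    exact hws
  have e5 : LinearMap.trace ℝ E (transp (symPart Φ + c • W) ∘ₗ (symPart Φ + c • W)) =
      LinearMap.trace ℝ E (symPart Φ ∘ₗ symPart Φ) +
        2 * c * LinearMap.trace ℝ E (symPart Φ ∘ₗ W) + c ^ 2 * LinearMap.trace ℝ E (W ∘ₗ W) := by
    rw [transp_add, transp_smul, transp_symPart, hWt]
    simp only [LinearMap.add_comp, LinearMap.comp_add, LinearMap.smul_comp, LinearMap.comp_smul,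
      map_add, map_smul, smul_eq_mul]
    rw [LinearMap.trace_comp_comm' W]
    ring
  have e6 := trace_transp_comp_self_nonneg (symPart Φ + c • W)
  have e7 : LinearMap.trace ℝ E (transp (symPart Φ + c • W) ∘ₗ (symPart Φ + c • W)) =
      c * (LinearMap.trace ℝ E (symPart Φ ∘ₗ W) - LinearMap.trace ℝ E Φ) +
        c * ((1 / 4) * binner (piAct W μ) μ) := by
    rw [e5, e1, e4]
    linear_combination c * e2
  have e8 : c * (LinearMap.trace ℝ E (symPart Φ ∘ₗ W) - LinearMap.trace ℝ E Φ) ≤ 0 :=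
    mul_nonpos_of_nonpos_of_nonneg hc.le (sub_nonneg.2 e3)
  have e9 : c * ((1 / 4) * binner (piAct W μ) μ) ≤ 0 :=
    mul_nonpos_of_nonpos_of_nonneg hc.le (by positivity)
  refine ⟨isDeriv_weightOp hwb ?_, ?_⟩
  · have h : c * ((1 / 4) * binner (piAct W μ) μ) = 0 := by linarith
    have := (mul_eq_zero.1 h).resolve_left hc.ne
    linarith
  · have h := eq_zero_of_trace_transp_comp_self (f := symPart Φ + c • W) (by linarith)
    rw [hF] at h
    rw [eq_sub_iff_add_eq, ← sub_eq_zero, ← h]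
    abel

end Pinching

section WeightDerivation

open Module

variable {E : Type*} [NormedAddCommGroup E] [InnerProductSpace ℝ E] [FiniteDimensional ℝ E]
  {μ : E →ₗ[ℝ] E →ₗ[ℝ] E} {n : Submodule ℝ E} {ι : Type*} [Fintype ι]
  {v : OrthonormalBasis ι ℝ E} {w : ι → ℝ} {G : E →ₗ[ℝ] E}

theorem mem_range_orthogonal_iff (hG : transp G = G) {x : E} :
    x ∈ (LinearMap.range G)ᗮ ↔ G x = 0 := by
  rw [Submodule.mem_orthogonal']
  refine ⟨fun h => ?_, ?_⟩
  · rw [← inner_self_eq_zero (𝕜 := ℝ), transp_eq_self_iff.1 hG]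
    exact h _ ⟨_, rfl⟩
  · rintro h _ ⟨y, rfl⟩
    rw [← transp_eq_self_iff.1 hG, h, inner_zero_left]

omit [FiniteDimensional ℝ E] in
theorem isIdeal_range_weightOp (hw : ∀ i, 0 ≤ w i) (hd : IsDeriv μ (weightOp v w)) :
    IsIdeal μ (LinearMap.range (weightOp v w)) := by
  have h : ∀ i j, μ (v i) (weightOp v w (v j)) ∈ LinearMap.range (weightOp v w) := by
    intro i j
    rw [weightOp_apply_basis, map_smul]
    rcases (hw j).eq_or_lt with h0 | h0
    · rw [← h0, zero_smul]
      exact Submodule.zero_mem _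
    · refine Submodule.smul_mem _ _ ⟨(w i + w j)⁻¹ • μ (v i) (v j), ?_⟩
      rw [map_smul, hd, weightOp_apply_basis, weightOp_apply_basis, map_smul, map_smul,
        LinearMap.smul_apply, ← add_smul, smul_smul,
        inv_mul_cancel₀ (add_pos_of_nonneg_of_pos (hw i) h0).ne', one_smul]
  rintro x _ ⟨y, rfl⟩
  rw [← v.sum_repr x, ← v.sum_repr y]
  simp only [map_sum, map_smul, LinearMap.sum_apply, LinearMap.smul_apply]
  exact Submodule.sum_mem _ fun i _ => Submodule.smul_mem _ _ <|
    Submodule.sum_mem _ fun j _ => Submodule.smul_mem _ _ (h j i)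

theorem bracket_mem_range_orthogonal (hG : transp G = G) (hd : IsDeriv μ G) {x y : E}
    (hx : x ∈ (LinearMap.range G)ᗮ) (hy : y ∈ (LinearMap.range G)ᗮ) :
    μ x y ∈ (LinearMap.range G)ᗮ := by
  rw [mem_range_orthogonal_iff hG] at *
  rw [hd, hx, hy, map_zero, map_zero, LinearMap.zero_apply, add_zero]

theorem comp_projL_range (hG : transp G = G) (x : E) :
    G (projL (LinearMap.range G) x) = G x := by
  conv_rhs => rw [← projL_add_projL_orthogonal (LinearMap.range G) x, map_add,
    (mem_range_orthogonal_iff hG).1 (projL_mem _ x), add_zero]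

theorem comp_crossAd_range (hG : transp G = G) (hd : IsDeriv μ G) (i : Fin (finrank ℝ E)) :
    G ∘ₗ crossAd μ (LinearMap.range G) i = crossAd μ (LinearMap.range G) i ∘ₗ G := by
  refine LinearMap.ext fun x => ?_
  change G (μ _ (projL _ x)) = μ _ (projL _ (G x))
  rw [hd, (mem_range_orthogonal_iff hG).1 (projL_mem _ _), map_zero, LinearMap.zero_apply,
    zero_add, comp_projL_range hG, projL_of_mem (LinearMap.mem_range_self G x)]

theorem normalityDefect_mem {p : Submodule ℝ E} (hp : IsIdeal μ p) (x : E) :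
    normalityDefect μ p x ∈ p := by
  have h : ∀ i x, crossAd μ p i x ∈ p := fun i x => hp _ _ (projL_mem _ _)
  have h' : ∀ i x, transp (crossAd μ p i) x ∈ p := by
    intro i x
    suffices hx : transp (crossAd μ p i) x ∈ pᗮᗮ by rwa [Submodule.orthogonal_orthogonal] at hx
    refine (Submodule.mem_orthogonal' _ _).2 fun y hy => ?_
    rw [inner_transp_left]
    change ⟪x, μ _ (projL p y)⟫ = 0
    rw [projL_of_mem_orthogonal hy, map_zero, inner_zero_right]
  rw [normalityDefect, LinearMap.sum_apply]
  exact p.sum_mem fun i _ => p.sub_mem (h _ _) (h' _ _)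

theorem normalityDefect_range_eq_zero (hLie : IsLieBracket μ) (hsolv : IsSolvableB μ)
    (hn : IsNilradical μ n) (hG : transp G = G) (hd : IsDeriv μ G)
    (hi : IsIdeal μ (LinearMap.range G)) {c : ℝ}
    (hR : Rop μ - (1 / 2 : ℝ) • Bop μ = c • LinearMap.id - c • G) :
    normalityDefect μ (LinearMap.range G) = 0 := by
  refine normalityDefect_eq_zero hLie hi (fun x hx y hy => bracket_mem_range_orthogonal hG hd hx hy)
    ?_
  set M := normalityDefect μ (LinearMap.range G) with hM
  have hMn : ∀ x, M x ∈ n := by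
    intro x
    obtain ⟨y, hy⟩ := normalityDefect_mem hi x
    rw [hM, ← hy]
    exact hn.deriv_mem hLie hsolv hd y
  have h1 := congrArg (fun f => LinearMap.trace ℝ E (f ∘ₗ M)) hR
  simp only [LinearMap.sub_comp, LinearMap.smul_comp, Bop_comp_eq_zero hLie hsolv hn hMn,
    smul_zero, sub_zero, map_sub, map_smul] at h1
  have h2 : ∀ g : E →ₗ[ℝ] E, (∀ i, g ∘ₗ crossAd μ (LinearMap.range G) i =
      crossAd μ (LinearMap.range G) i ∘ₗ g) → LinearMap.trace ℝ E (g ∘ₗ M) = 0 := by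
    intro g hg
    rw [hM, trace_comp_normalityDefect]
    exact Finset.sum_eq_zero fun i _ => trace_comp_commutator_eq_zero (hg i)
  rw [h1, h2 _ fun i => rfl, h2 _ (comp_crossAd_range hG hd), smul_zero, sub_zero]

end WeightDerivation

section KernelOfWeights

open Module

section Algebraic

variable {E : Type*} [AddCommGroup E] [Module ℝ E] {μ : E →ₗ[ℝ] E →ₗ[ℝ] E}
  {n n₀ U : Submodule ℝ E}

theorem exists_mem_annihilated (hnil : IsNilpotentOn μ n) (hn₀ : n₀ ≤ n) (hU : U ≤ n)
    (hU₀ : U ≠ ⊥) (hinv : ∀ x ∈ n₀, ∀ u ∈ U, μ x u ∈ U) :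
    ∃ u ∈ U, u ≠ 0 ∧ ∀ x ∈ n₀, μ x u = 0 := by
  classical
  have hex : ∃ k, U ⊓ lcsOn μ n k = ⊥ := by
    obtain ⟨k, hk⟩ := hnil
    exact ⟨k, by rw [hk, inf_bot_eq]⟩
  obtain ⟨k, hk⟩ : ∃ k, Nat.find hex = k + 1 := by
    refine Nat.exists_eq_succ_of_ne_zero fun h => hU₀ ?_
    have := Nat.find_spec hex
    rw [h] at this
    rwa [show lcsOn μ n 0 = n from rfl, inf_eq_left.2 hU] at this
  have hbot := Nat.find_spec hex
  rw [hk] at hbot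
  obtain ⟨u, hu, hu0⟩ := Submodule.exists_mem_ne_zero_of_ne_bot
    (Nat.find_min hex (m := k) (by omega))
  refine ⟨u, hu.1, hu0, fun x hx => ?_⟩
  have h : μ x u ∈ U ⊓ lcsOn μ n (k + 1) :=
    ⟨hinv x hx u hu.1, Submodule.subset_span ⟨x, hn₀ hx, u, hu.2, rfl⟩⟩
  rwa [hbot] at h

/-- The elements of `p` annihilated by the bracket with `q`. -/
def annihilatedBy (μ : E →ₗ[ℝ] E →ₗ[ℝ] E) (q p : Submodule ℝ E) : Submodule ℝ E :=
  p ⊓ ⨅ x : q, LinearMap.ker (μ x)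

theorem mem_annihilatedBy {q p : Submodule ℝ E} {u : E} :
    u ∈ annihilatedBy μ q p ↔ u ∈ p ∧ ∀ x ∈ q, μ x u = 0 := by
  simp [annihilatedBy]

theorem bracket_mem_annihilatedBy (hLie : IsLieBracket μ) {q p : Submodule ℝ E} {Y : E}
    (hp : ∀ y ∈ p, μ Y y ∈ p) (hq : ∀ x ∈ q, μ Y x ∈ q) {u : E}
    (hu : u ∈ annihilatedBy μ q p) : μ Y u ∈ annihilatedBy μ q p := by
  rw [mem_annihilatedBy] at *
  refine ⟨hp u hu.1, fun x hx => ?_⟩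
  rw [hLie.2, hu.2 x hx, map_zero, add_zero, hLie.antisymm x Y, map_neg, LinearMap.neg_apply,
    hu.2 _ (hq x hx), neg_zero]

end Algebraic

variable {E : Type*} [NormedAddCommGroup E] [InnerProductSpace ℝ E] [FiniteDimensional ℝ E]
  {μ : E →ₗ[ℝ] E →ₗ[ℝ] E} {n : Submodule ℝ E}

theorem crossAd_mem_annihilatedBy (hLie : IsLieBracket μ) {q p r : Submodule ℝ E} (hr : p ≤ r)
    (hp : ∀ Y ∈ rᗮ, ∀ y ∈ p, μ Y y ∈ p) (hq : ∀ Y ∈ rᗮ, ∀ x ∈ q, μ Y x ∈ q)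
    (i : Fin (finrank ℝ E)) (u : E) (hu : u ∈ annihilatedBy μ q p) :
    crossAd μ r i u ∈ annihilatedBy μ q p := by
  change μ _ (projL r u) ∈ _
  rw [projL_of_mem (hr hu.1)]
  exact bracket_mem_annihilatedBy hLie (hp _ (projL_mem _ _)) (hq _ (projL_mem _ _)) hu

/-- A complementary subalgebra of a normally acted ideal `p` meets the nilradical in elements
that centralize `p`. -/
theorem bracket_eq_zero_of_normalityDefect_eq_zero (hLie : IsLieBracket μ) (hn : IsIdeal μ n)
    (hnil : IsNilpotentOn μ n) {p : Submodule ℝ E} (hp : IsIdeal μ p) (hpn : p ≤ n)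
    (hp' : ∀ x ∈ pᗮ, ∀ y ∈ pᗮ, μ x y ∈ pᗮ) (h0 : normalityDefect μ p = 0) {x y : E}
    (hx : x ∈ n ⊓ pᗮ) (hy : y ∈ p) : μ x y = 0 := by
  set W := annihilatedBy μ (n ⊓ pᗮ) p with hW
  have hWp : W ≤ p := inf_le_left
  have hWinv : ∀ i, ∀ u ∈ W, crossAd μ p i u ∈ W :=
    crossAd_mem_annihilatedBy hLie le_rfl (fun Y _ => hp Y)
      fun Y hY x hx => ⟨hn Y x hx.1, hp' Y hY x hx.2⟩
  have hU : p ⊓ Wᗮ = ⊥ := by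
    by_contra hne
    obtain ⟨u, hu, hu0, hz⟩ := exists_mem_annihilated hnil inf_le_left (inf_le_left.trans hpn) hne
      fun x (hx : x ∈ n ⊓ pᗮ) u hu => ⟨hp x u hu.1, by
        have h := adOn_mem_of_crossAd_mem (crossAd_mem_orthogonal h0 hWinv) hx.2 hu.2
        rw [adOn, LinearMap.comp_apply, projL_of_mem hu.1] at h
        exact h⟩
    have huW : u ∈ W := mem_annihilatedBy.2 ⟨hu.1, hz⟩
    exact hu0 (inner_self_eq_zero.1 (Submodule.inner_right_of_mem_orthogonal huW hu.2))
  have hyW : projL Wᗮ y = 0 := by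
    have h : projL Wᗮ y ∈ p ⊓ Wᗮ := by
      refine ⟨?_, projL_mem _ _⟩
      rw [eq_sub_of_add_eq' (projL_add_projL_orthogonal W y)]
      exact p.sub_mem hy (hWp (projL_mem _ _))
    rwa [hU] at h
  have h := projL_add_projL_orthogonal W y
  rw [hyW, add_zero] at h
  have h1 : y ∈ W := h ▸ projL_mem W y
  exact (mem_annihilatedBy.1 h1).2 x hx

theorem trace_projL_comp (p : Submodule ℝ E) (f : E →ₗ[ℝ] E) :
    LinearMap.trace ℝ E (projL p ∘ₗ f) =
      ∑ i, ⟪projL p (stdONB E i), f (projL p (stdONB E i))⟫ := by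
  have h := trace_transp_comp (projL p) (f ∘ₗ projL p)
  rw [transp_projL, LinearMap.trace_comp_comm', LinearMap.comp_assoc, projL_comp_self,
    LinearMap.trace_comp_comm'] at h
  exact h

/-- A subspace of the center of an ideal `p`, invariant under the complement of `p`, on which
the Ricci operator is a multiple `c` of the identity with `c < 0`, vanishes. -/
theorem eq_bot_of_Rop_neg (hμ : ∀ x y, μ x y = -μ y x) {p z : Submodule ℝ E} (hz : z ≤ p)
    (hcen : ∀ x ∈ p, ∀ u ∈ z, μ x u = 0) (hinv : ∀ i, ∀ u ∈ z, crossAd μ p i u ∈ z)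
    {c : ℝ} (hc : c < 0) (hR : ∀ u ∈ z, ⟪Rop μ u, u⟫ = c * ⟪u, u⟫) : z = ⊥ := by
  have h1 : ∀ u ∈ z, (1 / 2 : ℝ) * ⟪u, normalityDefect μ p u⟫ ≤ c * ⟪u, u⟫ := by
    intro u hu
    rw [← hR u hu, inner_Rop_of_mem hμ (hz hu) (hz hu), inner_Rop, real_inner_comm u]
    have h2 : ∀ i, restrictB μ p (stdONB E i) u = 0 := fun i => by
      rw [restrictB_apply, projL_of_mem (hz hu), hcen _ (projL_mem _ _) u hu]
    simp only [h2, inner_zero_right, Finset.sum_const_zero, mul_zero, zero_add]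
    have h3 : ∀ (f : Fin (finrank ℝ E) → E), 0 ≤ ∑ i, ⟪f i, f i⟫ := fun f =>
      Finset.sum_nonneg fun i _ => real_inner_self_nonneg
    have h4 := h3 fun i => transp (restrictB μ p (stdONB E i)) u
    have h5 := h3 fun i => transp (adOn μ pᗮ (projL pᗮ (stdONB E i))) u
    linarith
  have h2 := trace_projL_comp_normalityDefect_nonneg hinv
  rw [trace_projL_comp] at h2
  have h3 : (1 / 2 : ℝ) * ∑ i, ⟪projL z (stdONB E i), normalityDefect μ p (projL z (stdONB E i))⟫ ≤
      c * ∑ i, ⟪projL z (stdONB E i), projL z (stdONB E i)⟫ := by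
    rw [Finset.mul_sum, Finset.mul_sum]
    exact Finset.sum_le_sum fun i _ => h1 _ (projL_mem _ _)
  have h4 : ∑ i, ⟪projL z (stdONB E i), projL z (stdONB E i)⟫ = 0 := by
    refine le_antisymm ?_ (Finset.sum_nonneg fun i _ => real_inner_self_nonneg)
    by_contra! h
    nlinarith [mul_neg_of_neg_of_pos hc h]
  have h5 : projL z = 0 := by
    refine eq_zero_of_trace_transp_comp_self ?_
    rw [trace_transp_comp, h4]
  refine (Submodule.eq_bot_iff _).2 fun u hu => ?_
  rw [← projL_of_mem hu, h5, LinearMap.zero_apply]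

/-- The derivation attached to a solsoliton with `c < 0` has the nilradical as its range. -/
theorem range_eq_nilradical (hLie : IsLieBracket μ) (hsolv : IsSolvableB μ)
    (hn : IsNilradical μ n) {G : E →ₗ[ℝ] E} (hG : transp G = G) (hd : IsDeriv μ G)
    (hi : IsIdeal μ (LinearMap.range G)) {c : ℝ} (hc : c < 0)
    (hR : Rop μ - (1 / 2 : ℝ) • Bop μ = c • LinearMap.id - c • G)
    (h0 : normalityDefect μ (LinearMap.range G) = 0) : LinearMap.range G = n := by
  have hle : LinearMap.range G ≤ n := by
    rintro _ ⟨x, rfl⟩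
    exact hn.deriv_mem hLie hsolv hd x
  have hsub : ∀ x ∈ (LinearMap.range G)ᗮ, ∀ y ∈ (LinearMap.range G)ᗮ,
      μ x y ∈ (LinearMap.range G)ᗮ := fun x hx y hy => bracket_mem_range_orthogonal hG hd hx hy
  have hsplit : ∀ x ∈ n, projL (LinearMap.range G)ᗮ x ∈ n ⊓ (LinearMap.range G)ᗮ := by
    intro x hx
    refine ⟨?_, projL_mem _ _⟩
    rw [eq_sub_of_add_eq' (projL_add_projL_orthogonal (LinearMap.range G) x)]
    exact n.sub_mem hx (hle (projL_mem _ _))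
  set n₀ := n ⊓ (LinearMap.range G)ᗮ with hn₀
  have hinv : ∀ Y ∈ (LinearMap.range G)ᗮ, ∀ x ∈ n₀, μ Y x ∈ n₀ := fun Y hY x hx =>
    ⟨hn.1 Y x hx.1, hsub Y hY x hx.2⟩
  have hz : annihilatedBy μ n n₀ = ⊥ := by
    refine eq_bot_of_Rop_neg hLie.antisymm (p := n) (inf_le_left.trans inf_le_left)
      (fun x hx u hu => (mem_annihilatedBy.1 hu).2 x hx)
      (crossAd_mem_annihilatedBy hLie inf_le_left
        (fun Y hY => hinv Y (Submodule.orthogonal_le hle hY)) fun Y _ => hn.1 Y) hc fun u hu => ?_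
    have hu' := (mem_annihilatedBy.1 hu).1
    have h := LinearMap.congr_fun hR u
    simp only [LinearMap.sub_apply, LinearMap.smul_apply, LinearMap.id_apply,
      Bop_of_mem hLie hsolv hn hu'.1, (mem_range_orthogonal_iff hG).1 hu'.2, smul_zero,
      sub_zero] at h
    rw [h, real_inner_smul_left]
  have hn₀bot : n₀ = ⊥ := by
    by_contra hne
    obtain ⟨u, hu, hu0, hann⟩ := exists_mem_annihilated hn.2.1 inf_le_left inf_le_left hne
      fun x hx => hinv x hx.2
    have h : u ∈ annihilatedBy μ n n₀ := by
      refine mem_annihilatedBy.2 ⟨hu, fun x hx => ?_⟩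
      rw [← projL_add_projL_orthogonal (LinearMap.range G) x, map_add, LinearMap.add_apply,
        hann _ (hsplit x hx), add_zero, hLie.antisymm,
        bracket_eq_zero_of_normalityDefect_eq_zero hLie hn.1 hn.2.1 hi hle hsub h0 hu
          (projL_mem _ _), neg_zero]
    rw [hz] at h
    exact hu0 h
  refine le_antisymm hle fun x hx => ?_
  have h := hsplit x hx
  rw [hn₀bot, Submodule.mem_bot] at h
  rw [← projL_add_projL_orthogonal (LinearMap.range G) x, h, add_zero]
  exact projL_mem _ _

end KernelOfWeights

section Forward

open Module

variable {E : Type*} [NormedAddCommGroup E] [InnerProductSpace ℝ E] [FiniteDimensional ℝ E]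
  {μ : E →ₗ[ℝ] E →ₗ[ℝ] E} {n : Submodule ℝ E}

theorem isDeriv_transp_of_normalityDefect_eq_zero (hLie : IsLieBracket μ)
    (hii : ∀ A ∈ nᗮ, ∀ A' ∈ nᗮ, μ A A' = 0) (h0 : normalityDefect μ n = 0) {A : E}
    (hA : A ∈ nᗮ) : IsDeriv μ (transp (μ A)) := by
  have hT : ∀ i, crossAd μ n i = μ (projL nᗮ (stdONB E i)) := fun i =>
    adOn_of_mem_orthogonal hii (projL_mem _ _)
  have h1 := trace_comp_normalityDefect (μ := μ) (Rop μ) n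
  rw [h0, LinearMap.comp_zero, map_zero] at h1
  have h2 : ∀ i, IsDeriv μ (transp (μ (projL nᗮ (stdONB E i)))) := by
    have h3 : ∀ i, LinearMap.trace ℝ E (Rop μ ∘ₗ (crossAd μ n i ∘ₗ transp (crossAd μ n i) -
        transp (crossAd μ n i) ∘ₗ crossAd μ n i)) =
        (1 / 4) * binner (piAct (transp (crossAd μ n i)) μ)
          (piAct (transp (crossAd μ n i)) μ) := fun i =>
      trace_Rop_comp_commutator hLie.antisymm (hT i ▸ hLie.isDeriv _) _
    intro i
    rw [isDeriv_iff_piAct_eq_zero, ← hT]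
    refine eq_zero_of_binner_self _ ?_
    have h4 := (Finset.sum_eq_zero_iff_of_nonneg fun i _ => ?_).1 h1.symm i (Finset.mem_univ _)
    · rw [h3] at h4
      linarith
    · rw [h3]
      exact mul_nonneg (by norm_num) (binner_self_nonneg _)
  have hsum : A = ∑ i, ⟪stdONB E i, A⟫ • projL nᗮ (stdONB E i) := by
    conv_lhs => rw [← projL_of_mem hA, ← (stdONB E).sum_repr A]
    simp [(stdONB E).repr_apply_apply]
  rw [hsum]
  refine Finset.sum_induction _ (fun A => IsDeriv μ (transp (μ A))) (fun a b ha hb => ?_) ?_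
    fun i _ => ?_
  · rw [map_add, transp_add]
    exact ha.add hb
  · intro x y
    simp [transp]
  · rw [map_smul, transp_smul]
    exact (h2 i).smul _

theorem structure_of_exists_isDeriv (hLie : IsLieBracket μ) (hsolv : IsSolvableB μ)
    (hn : IsNilradical μ n) {c : ℝ} (hc : c < 0) {D : E →ₗ[ℝ] E} (hD : IsDeriv μ D)
    (hRic : Ric μ = c • LinearMap.id + D) :
    (∃ D₁ : E →ₗ[ℝ] E, IsNilsolitonOn μ n c D₁) ∧
      (∀ A ∈ nᗮ, ∀ A' ∈ nᗮ, μ A A' = 0) ∧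
      (∀ A ∈ nᗮ, IsDeriv μ (transp (μ A))) ∧
      (∀ A ∈ nᗮ, ⟪A, A⟫ =
        -(1 / c) * LinearMap.trace ℝ E (symPart (μ A) ∘ₗ symPart (μ A))) := by
  obtain ⟨N, M, v, w, hw, hd, hR⟩ := exists_isDeriv_weightOp hLie hsolv hn hc hD hRic
  have hG := transp_weightOp v w
  have hi := isIdeal_range_weightOp hw hd
  have h0 := normalityDefect_range_eq_zero hLie hsolv hn hG hd hi hR
  have hr := range_eq_nilradical hLie hsolv hn hG hd hi hc hR h0
  generalize weightOp v w = G at *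
  subst hr
  have hbr := hn.bracket_mem hLie hsolv
  have hRx : ∀ x, Rop μ x - (1 / 2 : ℝ) • Bop μ x = c • x - c • G x :=
    fun x => LinearMap.congr_fun hR x
  have hii : ∀ A ∈ (LinearMap.range G)ᗮ, ∀ A' ∈ (LinearMap.range G)ᗮ, μ A A' = 0 := by
    intro A hA A' hA'
    exact inner_self_eq_zero.1 (Submodule.inner_right_of_mem_orthogonal (𝕜 := ℝ) (hbr A A')
      (bracket_mem_range_orthogonal hG hd hA hA'))
  have hiii : ∀ A ∈ (LinearMap.range G)ᗮ, IsDeriv μ (transp (μ A)) := fun A hA =>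
    isDeriv_transp_of_normalityDefect_eq_zero hLie hii h0 hA
  refine ⟨⟨(-c) • G, fun X _ => Submodule.smul_mem _ _ (LinearMap.mem_range_self G X),
    fun X _ Y _ => hd.smul _ X Y, fun X hX => ?_⟩, hii, hiii, fun A hA => ?_⟩
  · have h := hRx X
    rw [Bop_of_mem hLie hsolv hn hX, smul_zero, sub_zero,
      Rop_of_mem hLie hsolv hn hii hiii hX] at h
    rw [h, LinearMap.smul_apply, neg_smul, sub_eq_add_neg]
  · have h := inner_Rop_sub_Bop_self hLie.antisymm hbr hA
    rw [← real_inner_smul_left, ← inner_sub_left, hRx, (mem_range_orthogonal_iff hG).1 hA,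
      smul_zero, sub_zero, real_inner_smul_left] at h
    have := hc.ne
    rw [← neg_eq_iff_eq_neg.2 h]
    field_simp

end Forward

/-- structure theorem: a metric solvable Lie algebra with nilradical `n`, `a = nᗮ`
and `c < 0` satisfies `Ric = c I + D` for some derivation `D` if and only if:
(i) `(n, ⟨⬝,⬝⟩|ₙ)` is a nilsoliton with `Ric₁ = c I + D₁`;
(ii) `[a, a] = 0`;
(iii) `(ad A)ᵗ` is a derivation for every `A ∈ a`;
(iv) `⟨A, A⟩ = -(1/c) tr (S(ad A)²)` for every `A ∈ a`. -/
theorem solsoliton_structure_iff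
    {E : Type*} [NormedAddCommGroup E] [InnerProductSpace ℝ E] [FiniteDimensional ℝ E]
    (μ : E →ₗ[ℝ] E →ₗ[ℝ] E) (hLie : IsLieBracket μ) (hsolv : IsSolvableB μ)
    (n : Submodule ℝ E) (hn : IsNilradical μ n) (c : ℝ) (hc : c < 0) :
    (∃ D : E →ₗ[ℝ] E, IsDeriv μ D ∧ Ric μ = c • LinearMap.id + D) ↔
      ((∃ D₁ : E →ₗ[ℝ] E, IsNilsolitonOn μ n c D₁) ∧
        (∀ A ∈ nᗮ, ∀ A' ∈ nᗮ, μ A A' = 0) ∧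
        (∀ A ∈ nᗮ, IsDeriv μ (transp (μ A))) ∧
        (∀ A ∈ nᗮ, ⟪A, A⟫ =
          -(1 / c) * LinearMap.trace ℝ E (symPart (μ A) ∘ₗ symPart (μ A)))) :=
  ⟨fun ⟨_, hD, hRic⟩ => structure_of_exists_isDeriv hLie hsolv hn hc hD hRic,
    fun ⟨⟨_, hi⟩, hii, hiii, hiv⟩ => exists_isDeriv_of_structure hLie hsolv hn hc hi hii hiii hiv⟩
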